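/- Assume the Riemann Hypothesis and let 1 ≤ A₁ ≤ A₂ < ∞. If I(X,δ) := ∫₁^X (ψ((1+δ)x) − ψ(x) − δx)² dx ~ (1/2) δ X² log(1/δ) as X → ∞, uniformly for X^{−1/A₁}(log X)^{−3} ≤ δ ≤ X^{−1/A₂}(log X)³, then F(X,T) ~ (T/(2π)) log T as T → ∞, uniformly for T^{A₁} ≤ X ≤ T^{A₂}. -/

import Mathlib

open Complex Filter MeasureTheory Real Set

noncomputable section

/-- A non-trivial zero of the Riemann zeta function. -/
def ZetaNontrivZero (ρ : ℂ) : Prop := riemannZeta ρ = 0 ∧ 0 < ρ.re ∧ ρ.re < 1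

/-- The multiplicity of `ρ` as a zero of `ζ`. -/
def zetaMult (ρ : ℂ) : ℕ := sInf {n : ℕ | iteratedDeriv n riemannZeta ρ ≠ 0}

/-- The set of non-trivial zeros with ordinate in `(0, T]`. -/
def zerosUpTo (T : ℝ) : Set ℂ := {ρ | ZetaNontrivZero ρ ∧ 0 < ρ.im ∧ ρ.im ≤ T}

/-- Montgomery's pair correlation function `F(x,T)`, zeros counted with multiplicity. -/
def Fxt (x T : ℝ) : ℂ :=
  ∑' p : zerosUpTo T × zerosUpTo T,
    (zetaMult p.1 * zetaMult p.2 : ℂ) *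
      Complex.exp (Complex.I * (((p.1 : ℂ).im - (p.2 : ℂ).im : ℝ) : ℂ) * (Real.log x : ℂ)) *
      ((4 / (4 + ((p.1 : ℂ).im - (p.2 : ℂ).im) ^ 2) : ℝ) : ℂ)

/-- The Chebyshev function `ψ(x) = ∑_{n ≤ x} Λ(n)`. -/
def chebyshevPsi (x : ℝ) : ℝ := ∑ n ∈ Finset.Iic ⌊x⌋₊, ArithmeticFunction.vonMangoldt n

/-- The second moment of primes in short intervals
`I(X,δ) = ∫₁^X (ψ((1+δ)x) - ψ(x) - δx)² dx`. -/
def Imoment (X δ : ℝ) : ℝ :=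
  ∫ x in (1 : ℝ)..X, (chebyshevPsi ((1 + δ) * x) - chebyshevPsi x - δ * x) ^ 2

open Complex Filter MeasureTheory Real Set
open scoped Topology
namespace GM
noncomputable section

/-- The entire function `(s-1) ζ(s)`. -/
def xf : ℂ → ℂ := Function.update (fun s => (s - 1) * riemannZeta s) 1 1

lemma xf_of_ne {s : ℂ} (hs : s ≠ 1) : xf s = (s - 1) * riemannZeta s := by
  simp [xf, hs]

lemma xf_one : xf 1 = 1 := by simp [xf]

lemma differentiable_xf : Differentiable ℂ xf := by
  rw [← differentiableOn_univ,
    ← differentiableOn_compl_singleton_and_continuousAt_iff (c := 1) Filter.univ_mem]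
  refine ⟨fun s hs => ?_, ?_⟩
  · have h1 : s ≠ 1 := hs.2
    refine DifferentiableAt.differentiableWithinAt ?_
    have : xf =ᶠ[𝓝 s] fun s => (s - 1) * riemannZeta s := by
      filter_upwards [isOpen_ne.mem_nhds h1] with z hz using xf_of_ne hz
    rw [this.differentiableAt_iff]
    exact (by fun_prop : DifferentiableAt ℂ (fun s : ℂ => s - 1) s).mul
      (differentiableAt_riemannZeta h1)
  · rw [continuousAt_iff_punctured_nhds, xf_one]
    refine riemannZeta_residue_one.congr' ?_
    filter_upwards [self_mem_nhdsWithin] with z hz using (xf_of_ne hz).symm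

/-- fractional part cut off below 1 -/
def gfr : ℝ → ℂ := (Ioi (1:ℝ)).indicator (fun t => ((Int.fract t : ℝ) : ℂ))

lemma norm_gfr_le (t : ℝ) : ‖gfr t‖ ≤ 1 := by
  unfold gfr
  by_cases h : t ∈ Ioi (1:ℝ)
  · rw [indicator_of_mem h]
    simp only [Complex.norm_real, Real.norm_eq_abs, abs_of_nonneg (Int.fract_nonneg t)]
    exact (Int.fract_lt_one t).le
  · rw [indicator_of_notMem h]; simp

lemma measurable_gfr : Measurable gfr := by
  unfold gfr
  refine Measurable.indicator ?_ measurableSet_Ioi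
  exact Complex.measurable_ofReal.comp measurable_fract

lemma gfr_locInt : LocallyIntegrableOn gfr (Ioi 0) := by
  refine LocallyIntegrable.locallyIntegrableOn ?_ _
  have : LocallyIntegrable (fun _ : ℝ => (1:ℝ)) := locallyIntegrable_const _
  refine this.mono measurable_gfr.aestronglyMeasurable ?_
  exact Eventually.of_forall fun t => by simpa using norm_gfr_le t

lemma gfr_top : gfr =O[atTop] (fun t : ℝ => t ^ (-(0:ℝ))) := by
  refine Asymptotics.IsBigO.of_bound 1 (Eventually.of_forall fun t => ?_)
  simpa using norm_gfr_le t

lemma gfr_bot (b : ℝ) : gfr =O[𝓝[>] 0] (fun t : ℝ => t ^ (-b)) := by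
  refine Asymptotics.IsBigO.of_bound 1 ?_
  have : ∀ᶠ t : ℝ in 𝓝[>] 0, t < 1 :=
    mem_nhdsWithin_of_mem_nhds (Iio_mem_nhds one_pos)
  filter_upwards [this] with t ht
  have : gfr t = 0 := by
    unfold gfr; rw [indicator_of_notMem]; simp [ht.le]
  rw [this]; simp

lemma mellin_gfr_diff {s : ℂ} (hs : 0 < s.re) : DifferentiableAt ℂ (mellin gfr) (-s) :=
  mellin_differentiableAt_of_isBigO_rpow (a := 0) (b := -s.re - 1) gfr_locInt gfr_top
    (by simpa using hs) (gfr_bot _) (by simp)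

lemma mellin_gfr_eq (s : ℂ) : mellin gfr (-s) =
    ∫ t in Ioi (1:ℝ), ((t:ℂ) ^ (-s - 1)) * ((Int.fract t : ℝ) : ℂ) := by
  unfold mellin gfr
  have : ∀ t : ℝ, (t:ℂ) ^ (-s - 1) • (Ioi (1:ℝ)).indicator (fun t => ((Int.fract t : ℝ) : ℂ)) t
      = (Ioi (1:ℝ)).indicator (fun t => ((t:ℂ) ^ (-s - 1)) * ((Int.fract t : ℝ) : ℂ)) t := by
    intro t
    by_cases h : t ∈ Ioi (1:ℝ)
    · simp only [indicator_of_mem h, smul_eq_mul]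
    · simp only [indicator_of_notMem h, smul_zero]
  simp_rw [this]
  rw [setIntegral_indicator measurableSet_Ioi]
  congr 2
  ext t; simp

lemma norm_mellin_gfr_le {s : ℂ} (hs : 0 < s.re) : ‖mellin gfr (-s)‖ ≤ 1 / s.re := by
  rw [mellin_gfr_eq]
  have h1 : ∫ t in Ioi (1:ℝ), t ^ (-s.re - 1) = 1 / s.re := by
    rw [integral_Ioi_rpow_of_lt (by linarith) one_pos]
    simp
  rw [← h1]
  refine norm_integral_le_of_norm_le (integrableOn_Ioi_rpow_of_lt (by linarith) one_pos) ?_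
  refine (ae_restrict_iff' measurableSet_Ioi).mpr (Eventually.of_forall fun t ht => ?_)
  have ht0 : (0:ℝ) < t := one_pos.trans ht
  rw [norm_mul, Complex.norm_cpow_eq_rpow_re_of_pos ht0]
  simp only [sub_re, neg_re, one_re, Complex.norm_real, Real.norm_eq_abs,
    abs_of_nonneg (Int.fract_nonneg t)]
  exact mul_le_of_le_one_right (by positivity) (Int.fract_lt_one t).le

lemma xf_eq_of_one_lt {s : ℂ} (hs : 1 < s.re) :
    xf s = s - s * (s - 1) * mellin gfr (-s) := by
  have hs1 : s ≠ 1 := by rintro rfl; simp at hs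
  have hs0 : s ≠ 0 := by rintro rfl; simp at hs; linarith
  rw [xf_of_ne hs1]
  have hz : riemannZeta s = s * ∫ t in Ioi (1:ℝ), ((⌊t⌋₊ : ℂ)) * (t:ℂ) ^ (-(s + 1)) := by
    rw [← LSeries_one_eq_riemannZeta hs]
    have := LSeries_eq_mul_integral (fun _ => (1:ℂ)) (r := 1) zero_le_one hs
      (LSeriesSummable_one_iff.mpr hs) ?_
    · simpa using! this
    · refine Asymptotics.IsBigO.of_bound 1 (Eventually.of_forall fun n => ?_)
      simp
  have hI1 : IntegrableOn (fun t : ℝ => (t:ℂ) ^ (-s)) (Ioi 1) :=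
    integrableOn_Ioi_cpow_of_lt (by simpa using hs) one_pos
  have hI2 : IntegrableOn (fun t : ℝ => ((t:ℂ) ^ (-s - 1)) * ((Int.fract t : ℝ) : ℂ)) (Ioi 1) := by
    have hI3 : IntegrableOn (fun t : ℝ => ((t:ℂ) ^ (-s - 1))) (Ioi 1) :=
      integrableOn_Ioi_cpow_of_lt (by simp; linarith) one_pos
    refine Integrable.mono hI3 (hI3.aestronglyMeasurable.mul
      (Complex.measurable_ofReal.comp measurable_fract).aestronglyMeasurable) ?_
    refine Eventually.of_forall fun t => ?_
    rw [norm_mul]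
    refine mul_le_of_le_one_right (norm_nonneg _) ?_
    simp only [Complex.norm_real, Real.norm_eq_abs, abs_of_nonneg (Int.fract_nonneg t)]
    exact (Int.fract_lt_one t).le
  have h2 : ∫ t in Ioi (1:ℝ), ((⌊t⌋₊ : ℂ)) * (t:ℂ) ^ (-(s + 1)) =
      (∫ t in Ioi (1:ℝ), (t:ℂ) ^ (-s)) - mellin gfr (-s) := by
    rw [mellin_gfr_eq, ← integral_sub hI1 hI2]
    refine setIntegral_congr_fun measurableSet_Ioi fun t ht => ?_
    have ht0 : (0:ℝ) < t := one_pos.trans ht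
    have ht' : (t:ℂ) ≠ 0 := by exact_mod_cast ht0.ne'
    have e1 : (t:ℂ) ^ (-s) = t * (t:ℂ) ^ (-s-1) := by
      rw [cpow_sub _ _ ht', cpow_one]; field_simp
    have e2 : ((⌊t⌋₊ : ℂ)) = (t:ℂ) - ((Int.fract t : ℝ) : ℂ) := by
      have : (⌊t⌋₊ : ℝ) = t - Int.fract t := by
        rw [natCast_floor_eq_intCast_floor ht0.le]; 
        linarith [Int.floor_add_fract t]
      rw [← Complex.ofReal_sub, ← this]; simp
    rw [e1, e2, neg_add']; ring
  have h3 : ∫ t in Ioi (1:ℝ), (t:ℂ) ^ (-s) = 1 / (s - 1) := by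
    rw [integral_Ioi_cpow_of_lt (by simpa using hs) one_pos]
    have : -s + 1 ≠ 0 := by intro h; apply hs1; linear_combination -h
    have : s - 1 ≠ 0 := sub_ne_zero.mpr hs1
    simp
    field_simp
    ring
  rw [hz, h2, h3]
  have : s - 1 ≠ 0 := sub_ne_zero.mpr hs1
  field_simp

lemma xf_eq {s : ℂ} (hs : 0 < s.re) : xf s = s - s * (s - 1) * mellin gfr (-s) := by
  have hU : IsOpen {s : ℂ | 0 < s.re} := isOpen_lt continuous_const Complex.continuous_re
  have hf : AnalyticOnNhd ℂ xf {s : ℂ | 0 < s.re} :=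
    differentiable_xf.differentiableOn.analyticOnNhd hU
  have hg : AnalyticOnNhd ℂ (fun s => s - s * (s - 1) * mellin gfr (-s)) {s : ℂ | 0 < s.re} := by
    refine DifferentiableOn.analyticOnNhd (fun z hz => ?_) hU
    refine DifferentiableAt.differentiableWithinAt ?_
    have : DifferentiableAt ℂ (fun s => mellin gfr (-s)) z :=
      DifferentiableAt.comp (g := mellin gfr) z (mellin_gfr_diff hz) differentiableAt_id.neg
    fun_prop
  have hpre : IsPreconnected {s : ℂ | 0 < s.re} := (convex_halfSpace_re_gt 0).isPreconnected
  refine hf.eqOn_of_preconnected_of_eventuallyEq hg hpre (z₀ := 2) (by simp) ?_ hs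
  have : {s : ℂ | 1 < s.re} ∈ 𝓝 (2:ℂ) :=
    (isOpen_lt continuous_const Complex.continuous_re).mem_nhds (by simp)
  filter_upwards [this] with z hz using xf_eq_of_one_lt hz

lemma norm_xf_le {s : ℂ} (hs : 1 / 20 ≤ s.re) : ‖xf s‖ ≤ 20 * (1 + ‖s‖) ^ 2 := by
  have hs0 : 0 < s.re := by linarith
  rw [xf_eq hs0]
  have h1 : ‖mellin gfr (-s)‖ ≤ 20 := by
    refine (norm_mellin_gfr_le hs0).trans ?_
    rw [div_le_iff₀ hs0]; linarith
  calc ‖s - s * (s - 1) * mellin gfr (-s)‖ ≤ ‖s‖ + ‖s‖ * ‖s - 1‖ * ‖mellin gfr (-s)‖ := by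
        refine (norm_sub_le _ _).trans ?_
        rw [norm_mul, norm_mul]
    _ ≤ ‖s‖ + ‖s‖ * (‖s‖ + 1) * 20 := by
        have := norm_sub_le s 1
        simp only [norm_one] at this
        gcongr
    _ ≤ 20 * (1 + ‖s‖) ^ 2 := by nlinarith [norm_nonneg s]

end
end GM

open Complex Filter MeasureTheory Real Set
open scoped Topology
namespace GM
noncomputable section

lemma norm_Gamma_le {s : ℂ} (hs : 0 < s.re) : ‖Complex.Gamma s‖ ≤ Real.Gamma s.re := by
  rw [Complex.Gamma_eq_integral hs, Real.Gamma_eq_integral hs]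
  unfold Complex.GammaIntegral
  refine norm_integral_le_of_norm_le (Real.GammaIntegral_convergent hs) ?_
  refine (ae_restrict_iff' measurableSet_Ioi).mpr (Eventually.of_forall fun t ht => ?_)
  rw [norm_mul, Complex.norm_cpow_eq_rpow_re_of_pos ht, Complex.norm_real, Real.norm_eq_abs,
    abs_of_pos (Real.exp_pos _)]
  simp

lemma log_le_two_sqrt {x : ℝ} (hx : 0 < x) : Real.log x ≤ 2 * √x := by
  have h : Real.log x = 2 * Real.log (√x) := by rw [Real.log_sqrt hx.le]; ring
  have := Real.log_le_sub_one_of_pos (Real.sqrt_pos.mpr hx)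
  rw [h]; linarith

lemma Gamma_bound {σ r : ℝ} (hσ : 1 / 2 ≤ σ) (hr : 5 ≤ r) (h : σ ≤ 2 * r) :
    Real.Gamma σ ≤ 2 * Real.exp (12 * (r * √r)) := by
  have hσ0 : 0 < σ := by linarith
  have h1 : Real.Gamma (σ + 2) = (σ + 1) * (σ * Real.Gamma σ) := by
    rw [show σ + 2 = (σ + 1) + 1 by ring, Real.Gamma_add_one (by linarith),
      Real.Gamma_add_one (by linarith)]
  have hG : 0 < Real.Gamma σ := Real.Gamma_pos_of_pos hσ0
  have h2 : Real.Gamma σ ≤ 2 * Real.Gamma (σ + 2) := by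
    rw [h1]
    have : 1 / 2 ≤ (σ + 1) * σ := by nlinarith
    nlinarith
  set n : ℕ := ⌈σ⌉₊ + 1 with hn
  have hn1 : σ + 2 ≤ (n:ℝ) + 1 := by
    have := Nat.le_ceil σ
    push_cast [hn]; linarith
  have hn2 : (n:ℝ) ≤ 3 * r := by
    have := Nat.ceil_lt_add_one hσ0.le
    push_cast [hn]; linarith
  have h3 : Real.Gamma (σ + 2) ≤ Real.Gamma ((n:ℝ) + 1) :=
    Real.Gamma_strictMonoOn_Ici.monotoneOn (by simp; linarith) (by simp; linarith) hn1
  rw [Real.Gamma_nat_eq_factorial] at h3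
  have h4 : (n.factorial : ℝ) ≤ (n:ℝ) ^ n := by exact_mod_cast Nat.factorial_le_pow n
  have hnpos : (0:ℝ) < n := by linarith
  have h5 : (n:ℝ) ^ n ≤ Real.exp (12 * (r * √r)) := by
    rw [← Real.rpow_natCast, Real.rpow_def_of_pos hnpos]
    apply Real.exp_le_exp.mpr
    have hl := log_le_two_sqrt hnpos
    have hs : √(n:ℝ) ≤ √(4 * r) := Real.sqrt_le_sqrt (by linarith)
    have hs4 : √(4 * r) = 2 * √r := by
      rw [Real.sqrt_mul (by norm_num), show (4:ℝ) = 2 ^ 2 by norm_num, Real.sqrt_sq (by norm_num)]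
    have hr0 := Real.sqrt_nonneg r
    calc Real.log n * n ≤ (4 * √r) * (3 * r) := by
          have : Real.log n ≤ 4 * √r := by linarith
          exact mul_le_mul this hn2 hnpos.le (by positivity)
      _ = 12 * (r * √r) := by ring
  linarith

lemma norm_cos_le (z : ℂ) : ‖Complex.cos z‖ ≤ Real.exp ‖z‖ := by
  unfold Complex.cos
  have h1 := Complex.norm_exp_le_exp_norm (z * I)
  have h2 := Complex.norm_exp_le_exp_norm (-z * I)
  have h3 := norm_add_le (Complex.exp (z * I)) (Complex.exp (-z * I))
  simp at h1 h2 h3 ⊢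
  linarith

lemma xf_growth {s : ℂ} (hs : 5 ≤ ‖s - 2‖) :
    ‖xf s‖ ≤ Real.exp (40 * (‖s - 2‖ * √‖s - 2‖)) := by
  set r := ‖s - 2‖ with hr
  have hsq1 : 1 ≤ √r := by rw [Real.one_le_sqrt]; linarith
  have hrr : r ≤ r * √r := by nlinarith
  have hpoly : ∀ w : ℂ, 1 / 20 ≤ w.re → ‖w‖ ≤ 2 * r → ‖xf w‖ ≤ 180 * r ^ 2 := by
    intro w h1 h2
    refine (norm_xf_le h1).trans ?_
    have : 1 + ‖w‖ ≤ 3 * r := by linarith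
    nlinarith [norm_nonneg w]
  have hexpr : r ≤ Real.exp r := by linarith [Real.add_one_le_exp r]
  have e6 : (360:ℝ) ≤ Real.exp 6 := by
    have : (2.7:ℝ) ≤ Real.exp 1 := by linarith [Real.exp_one_gt_d9]
    rw [show (6:ℝ) = (6:ℕ) * 1 by norm_num, Real.exp_nat_mul]
    calc (360:ℝ) ≤ 2.7 ^ 6 := by norm_num
      _ ≤ _ := by gcongr
  by_cases h : 1 / 20 ≤ s.re
  · have hn : ‖s‖ ≤ 2 * r := by
      have := norm_add_le (s - 2) 2
      simp at this; linarith
    refine (hpoly s h hn).trans ?_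
    calc 180 * r ^ 2 ≤ Real.exp 6 * Real.exp r ^ 2 := by gcongr; linarith
      _ = Real.exp (6 + 2 * r) := by rw [← Real.exp_nat_mul, ← Real.exp_add]; norm_num
      _ ≤ _ := Real.exp_le_exp.mpr (by nlinarith)
  · push Not at h
    set w := 1 - s with hw
    have hwre : 1 / 2 ≤ w.re := by simp [hw]; linarith
    have hwn : ‖w‖ ≤ 2 * r := by
      have := norm_sub_le (-(s - 2)) 1
      rw [show -(s-2) - 1 = w by rw [hw]; ring] at this
      simp only [norm_neg, norm_one] at this; linarith
    have hs3 : 3 ≤ ‖s‖ := by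
      have := norm_sub_le s 2
      simp at this; linarith
    have hs1 : s ≠ 1 := by rintro rfl; simp at h; linarith
    have hw1 : w ≠ 1 := by
      intro h0; have : s = 0 := by rw [hw] at h0; linear_combination -h0
      rw [this] at hs3; simp at hs3; linarith
    have hw1' : w - 1 ≠ 0 := sub_ne_zero.mpr hw1
    have hfe := riemannZeta_one_sub (s := w) (fun n hn => by
      rw [hn] at hwre; simp at hwre; linarith [(Nat.cast_nonneg n : (0:ℝ) ≤ n)]) hw1
    have hsw : 1 - w = s := by rw [hw]; ring
    rw [hsw] at hfe
    have hx : xf s = -w * (2 * (2 * π) ^ (-w) * Complex.Gamma w * Complex.cos (π * w / 2)) *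
        (xf w / (w - 1)) := by
      rw [xf_of_ne hs1, xf_of_ne hw1, hfe, mul_div_cancel_left₀ _ hw1', ← hsw]; ring
    have b1 : ‖(2 * π : ℂ) ^ (-w)‖ ≤ 1 := by
      rw [show (2 * π : ℂ) = ((2 * π : ℝ) : ℂ) by push_cast; rfl,
        Complex.norm_cpow_eq_rpow_re_of_pos (by positivity)]
      refine Real.rpow_le_one_of_one_le_of_nonpos (by linarith [Real.pi_gt_three]) ?_
      simp; linarith
    have b2 : ‖Complex.Gamma w‖ ≤ 2 * Real.exp (12 * (r * √r)) := by
      refine (norm_Gamma_le (by linarith)).trans (Gamma_bound hwre hs ?_)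
      exact (Complex.re_le_norm w).trans hwn
    have b3 : ‖Complex.cos (π * w / 2)‖ ≤ Real.exp (4 * r) := by
      refine (norm_cos_le _).trans (Real.exp_le_exp.mpr ?_)
      rw [norm_div, norm_mul, Complex.norm_real, Real.norm_eq_abs, abs_of_pos Real.pi_pos]
      simp
      nlinarith [Real.pi_le_four, Real.pi_pos]
    have b4 : ‖xf w / (w - 1)‖ ≤ 60 * r ^ 2 := by
      rw [norm_div, div_le_iff₀ (norm_pos_iff.mpr hw1')]
      have : ‖w - 1‖ = ‖s‖ := by rw [hw]; rw [show 1 - s - 1 = -s by ring, norm_neg]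
      rw [this]
      have := hpoly w (by linarith) hwn
      nlinarith [sq_nonneg r]
    have hr0 : 0 < r := by linarith
    rw [hx]
    calc ‖-w * (2 * (2 * π) ^ (-w) * Complex.Gamma w * Complex.cos (π * w / 2)) *
        (xf w / (w - 1))‖
        = ‖w‖ * (2 * ‖(2 * π : ℂ) ^ (-w)‖ * ‖Complex.Gamma w‖ * ‖Complex.cos (π * w / 2)‖) *
          ‖xf w / (w - 1)‖ := by
          simp only [norm_mul, norm_neg]; simp
      _ ≤ (2 * r) * (2 * 1 * (2 * Real.exp (12 * (r * √r))) * Real.exp (4 * r)) * (60 * r ^ 2) := by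
          gcongr
      _ = 360 * (4/3) * r ^ 3 * Real.exp (12 * (r * √r)) * Real.exp (4 * r) := by ring
      _ ≤ Real.exp 6 * (Real.exp 6) * Real.exp r ^ 3 * Real.exp (12 * (r * √r)) * Real.exp (4 * r) := by
          gcongr
          linarith
      _ = Real.exp (12 + 7 * r + 12 * (r * √r)) := by
          rw [← Real.exp_nat_mul, ← Real.exp_add, ← Real.exp_add, ← Real.exp_add, ← Real.exp_add]
          norm_num; ring
      _ ≤ _ := Real.exp_le_exp.mpr (by nlinarith)

lemma xf_lower (t : ℝ) : 1 / 3 ≤ ‖xf (2 + t * I)‖ := by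
  have hs1 : (2 + t * I : ℂ) ≠ 1 := by
    intro h; have := congrArg Complex.re h; simp at this
  rw [xf_of_ne hs1, norm_mul]
  have h1 : 1 ≤ ‖(2 + t * I : ℂ) - 1‖ := by
    refine le_trans ?_ (Complex.re_le_norm _)
    simp; norm_num
  have hz : riemannZeta (2 + t * I) = ∑' n : ℕ, 1 / ((n:ℂ) + 1) ^ (2 + t * I) :=
    zeta_eq_tsum_one_div_nat_add_one_cpow (by simp)
  have hn : ∀ n : ℕ, ‖1 / ((n:ℂ) + 1) ^ (2 + t * I)‖ = 1 / ((n:ℝ) + 1) ^ 2 := by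
    intro n
    rw [norm_div, show ((n:ℂ) + 1) = ((n + 1 : ℕ) : ℂ) by push_cast; rfl,
      Complex.norm_natCast_cpow_of_pos (Nat.succ_pos n)]
    simp
  have hS : HasSum (fun n : ℕ => 1 / ((n:ℝ) + 1) ^ 2) (π ^ 2 / 6) := by
    have := (hasSum_nat_add_iff' 1).mpr hasSum_zeta_two
    simpa using this
  have hs : Summable (fun n : ℕ => 1 / ((n:ℂ) + 1) ^ (2 + t * I)) := by
    apply Summable.of_norm; simp_rw [hn]; exact hS.summable
  rw [hs.tsum_eq_zero_add] at hz
  have hS1 : HasSum (fun n : ℕ => 1 / (((n + 1 : ℕ):ℝ) + 1) ^ 2) (π ^ 2 / 6 - 1) := by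
    have := (hasSum_nat_add_iff' 1).mpr hS
    simpa using this
  have hb : ‖∑' n : ℕ, 1 / (((n + 1 : ℕ):ℂ) + 1) ^ (2 + t * I)‖ ≤ π ^ 2 / 6 - 1 := by
    refine tsum_of_norm_bounded hS1 fun n => (hn (n+1)).le
  have hpi : π ^ 2 ≤ 10 := by nlinarith [Real.pi_lt_d2, Real.pi_pos]
  have hz2 : 1 / 3 ≤ ‖riemannZeta (2 + t * I)‖ := by
    rw [hz]
    have := norm_sub_le_norm_add (1 / (((0:ℕ):ℂ) + 1) ^ (2 + t * I)) (∑' n : ℕ, 1 / (((n + 1 : ℕ):ℂ) + 1) ^ (2 + t * I))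
    rw [hn 0] at this
    norm_num at this
    norm_num at hb ⊢
    linarith
  nlinarith [norm_nonneg (riemannZeta (2 + t * I))]

lemma xf_zero_iff {s : ℂ} : xf s = 0 ↔ (s ≠ 1 ∧ riemannZeta s = 0) := by
  by_cases h : s = 1
  · subst h; simp [xf_one]
  · rw [xf_of_ne h, mul_eq_zero, sub_eq_zero]; tauto

lemma xf_zero_RH (hRH : RiemannHypothesis) {s : ℂ} (h : xf s = 0) :
    (∃ n : ℕ, s = -2 * (n + 1)) ∨ s.re = 1 / 2 := by
  obtain ⟨h1, h0⟩ := xf_zero_iff.mp h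
  by_cases hn : ∃ n : ℕ, s = -2 * (n + 1)
  · exact Or.inl hn
  · exact Or.inr (hRH s h0 hn h1)

end
end GM

open Complex Filter MeasureTheory Real Set
open scoped Topology
namespace GM
noncomputable section

/-- multiplicity of a zero of `xf` -/
def mu (ρ : ℂ) : ℕ := analyticOrderNatAt xf ρ

lemma analyticOnNhd_xf (U : Set ℂ) : AnalyticOnNhd ℂ xf U := fun z _ =>
  (differentiable_xf.analyticAt z)

lemma xf_two_ne : xf 2 ≠ 0 := by
  have := xf_lower 0
  simp at this
  intro h; rw [h] at this; norm_num at this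

lemma order_xf_ne_top (z : ℂ) : analyticOrderAt xf z ≠ ⊤ := by
  refine (analyticOnNhd_xf univ).analyticOrderAt_ne_top_of_isPreconnected
    (x := 2) isPreconnected_univ (mem_univ _) (mem_univ _) ?_
  rw [(differentiable_xf.analyticAt 2).analyticOrderAt_eq_zero.mpr xf_two_ne]
  simp

lemma mu_cast (z : ℂ) : (mu z : ℕ∞) = analyticOrderAt xf z :=
  Nat.cast_analyticOrderNatAt (order_xf_ne_top z)

lemma mu_pos {z : ℂ} (h : xf z = 0) : 0 < mu z := by
  rw [Nat.pos_iff_ne_zero]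
  intro h0
  have h1 := mu_cast z
  rw [h0] at h1
  exact ((differentiable_xf.analyticAt z).analyticOrderAt_eq_zero.mp (by simpa using h1.symm)) h

lemma divisor_xf {U : Set ℂ} {z : ℂ} (hz : z ∈ U) : MeromorphicOn.divisor xf U z = (mu z : ℤ) := by
  rw [MeromorphicOn.AnalyticOnNhd.divisor_apply (analyticOnNhd_xf U) hz, ← mu_cast]
  simp

lemma jensen {c : ℂ} {r R M : ℝ} (hr : 0 < r) (hrR : r < R) (hM : 1 ≤ M) (hc : xf c ≠ 0)
    (hb : ∀ z ∈ Metric.sphere c R, ‖xf z‖ ≤ M) (S : Finset ℂ)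
    (hS : ∀ ρ ∈ S, ρ ∈ Metric.closedBall c r) :
    ∑ ρ ∈ S, (mu ρ : ℝ) ≤ Real.log (M / ‖xf c‖) / Real.log (R / r) := by
  have hR : 0 < R := hr.trans hrR
  have := AnalyticOnNhd.sum_divisor_le (c := c) (r := r) (R := R) (M := M) (f := xf)
    (by rwa [abs_of_pos hr]) (by rwa [abs_of_pos hr, abs_of_pos hR]) hM (analyticOnNhd_xf _) hc
    (by rwa [abs_of_pos hR])
  refine le_trans ?_ this
  rw [abs_of_pos hr]
  have hfin := (MeromorphicOn.divisor xf (Metric.closedBall c r)).finiteSupport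
    (isCompact_closedBall c r)
  have hnn : ∀ z, 0 ≤ MeromorphicOn.divisor xf (Metric.closedBall c r) z := by
    intro z
    by_cases hz : z ∈ Metric.closedBall c r
    · rw [divisor_xf hz]; positivity
    · rw [Function.locallyFinsuppWithin.apply_eq_zero_of_notMem _ hz]
  rw [finsum_eq_sum_of_support_subset _ (s := S ∪ hfin.toFinset) (by
    intro z hz; simp at hz ⊢; right; exact hz)]
  push_cast
  calc ∑ ρ ∈ S, (mu ρ : ℝ) = ∑ ρ ∈ S, ((MeromorphicOn.divisor xf (Metric.closedBall c r) ρ : ℤ) : ℝ) := by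
        refine Finset.sum_congr rfl fun ρ h => ?_
        rw [divisor_xf (hS ρ h)]; simp
    _ ≤ _ := by
        refine Finset.sum_le_sum_of_subset_of_nonneg Finset.subset_union_left fun i _ _ => ?_
        exact_mod_cast hnn i

/-- local count -/
lemma local_count (t : ℝ) (S : Finset ℂ) (hS : ∀ ρ ∈ S, ρ.re = 1 / 2 ∧ |ρ.im - t| ≤ 1 / 2) :
    ∑ ρ ∈ S, (mu ρ : ℝ) ≤ 120 * Real.log (|t| + 2) := by
  have hx : 2 ≤ |t| + 2 := by linarith [abs_nonneg t]
  set x := |t| + 2 with hxd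
  have hlow := xf_lower t
  have hne : xf (2 + t * I) ≠ 0 := by
    intro h; rw [h] at hlow; norm_num at hlow
  have hj := jensen (c := 2 + t * I) (r := 8 / 5) (R := 39 / 20) (M := 20 * (x + 3) ^ 2)
    (by norm_num) (by norm_num) (by nlinarith) hne ?_ S ?_
  · refine hj.trans ?_
    have hl : 1 / 10 ≤ Real.log (39 / 20 / (8 / 5)) := by
      have := Real.one_sub_inv_le_log_of_pos (x := 39 / 20 / (8 / 5)) (by norm_num)
      norm_num at this ⊢; linarith
    have hl2 : Real.log (20 * (x + 3) ^ 2 / ‖xf (2 + t * I)‖) ≤ 12 * Real.log x := by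
      rw [← Real.log_rpow (by linarith)]
      apply Real.log_le_log
      · positivity
      · rw [div_le_iff₀ (by linarith)]
        have e : x ^ (12:ℝ) = x ^ 12 := by exact_mod_cast Real.rpow_natCast x 12
        rw [e]
        have h3 : x + 3 ≤ x ^ 3 := by nlinarith [sq_nonneg (x - 2), sq_nonneg x]
        have h6 : (60:ℝ) ≤ x ^ 6 := by
          calc (60:ℝ) ≤ 2 ^ 6 := by norm_num
            _ ≤ x ^ 6 := by gcongr
        have : 60 * (x + 3) ^ 2 ≤ x ^ 6 * (x ^ 3) ^ 2 := by gcongr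
        have h12 : x ^ 6 * (x ^ 3) ^ 2 = x ^ 12 := by ring
        have hp : 0 < x ^ 12 := by positivity
        nlinarith
    rw [div_le_iff₀ (by linarith)]
    have : 0 ≤ Real.log x := Real.log_nonneg (by linarith)
    nlinarith
  · intro z hz
    rw [mem_sphere_iff_norm] at hz
    have h1 : |(z - (2 + t * I)).re| ≤ 39 / 20 := hz ▸ Complex.abs_re_le_norm _
    simp at h1
    have hre := (abs_le.mp h1).1
    refine (norm_xf_le (by linarith)).trans ?_
    have h2 : ‖z‖ ≤ 4 + |t| := by
      have e : z = (z - (2 + t * I)) + (2 + t * I) := by ring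
      have ht : ‖(2 + t * I : ℂ)‖ ≤ 2 + |t| := by
        refine (norm_add_le _ _).trans ?_; simp
      calc ‖z‖ ≤ ‖z - (2 + t * I)‖ + ‖(2 + t * I : ℂ)‖ := by
            conv_lhs => rw [e]
            exact norm_add_le _ _
        _ ≤ _ := by rw [hz]; linarith
    have : 1 + ‖z‖ ≤ x + 3 := by rw [hxd]; linarith
    gcongr
  · intro ρ hρ
    obtain ⟨h1, h2⟩ := hS ρ hρ
    rw [mem_closedBall_iff_norm, Complex.norm_eq_sqrt_sq_add_sq]
    apply Real.sqrt_le_iff.mpr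
    refine ⟨by norm_num, ?_⟩
    simp [h1]
    have := (abs_le.mp h2)
    nlinarith

lemma summable_int_rpow {s : ℝ} (hs : 1 < s) : Summable (fun k : ℤ => (1 + |(k:ℝ)|) ^ (-s)) := by
  refine Summable.of_nonneg_of_le (fun k => by positivity) (fun k => ?_)
    ((Real.summable_one_div_int_add_rpow (1 / 2) s).mpr hs)
  have hk : (k:ℝ) + 1 / 2 ≠ 0 := by
    intro h
    have : (2 * k + 1 : ℤ) = 0 := by
      have : (2 * (k:ℝ) + 1) = 0 := by linarith
      exact_mod_cast this
    omega
  have h1 : 0 < |(k:ℝ) + 1 / 2| := abs_pos.mpr hk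
  rw [one_div, ← Real.rpow_neg h1.le]
  refine Real.rpow_le_rpow_of_nonpos h1 ?_ (by linarith)
  refine (abs_add_le _ _).trans ?_
  rw [abs_of_pos (by norm_num : (0:ℝ) < 1 / 2)]
  linarith

/-- density from local counts, abstractly -/
lemma density_of_local {ι : Type*} (γ m : ι → ℝ) (hm : ∀ i, 0 ≤ m i)
    (C : ℝ) (hC : 0 ≤ C)
    (hloc : ∀ (t : ℝ) (S : Finset ι), (∀ i ∈ S, |γ i - t| ≤ 1 / 2) →
      ∑ i ∈ S, m i ≤ C * Real.log (|t| + 2)) :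
    ∃ D : ℝ, 0 ≤ D ∧ ∀ t : ℝ, Summable (fun i => m i * (1 + |t - γ i|) ^ (-(5 / 4) : ℝ)) ∧
      ∑' i, m i * (1 + |t - γ i|) ^ (-(5 / 4) : ℝ) ≤ D * Real.log (|t| + 2) := by
  have hsum := summable_int_rpow (s := 9 / 8) (by norm_num)
  set A : ℝ := ∑' k : ℤ, (1 + |(k:ℝ)|) ^ (-(9 / 8) : ℝ) with hA
  have hA0 : 0 ≤ A := tsum_nonneg fun k => by positivity
  have key : ∀ (t : ℝ) (S : Finset ι), ∑ i ∈ S, m i * (1 + |t - γ i|) ^ (-(5 / 4) : ℝ) ≤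
      (68 * C * A) * Real.log (|t| + 2) := by
    intro t S
    classical
    set L := Real.log (|t| + 2) with hL
    have hL2 : 1 / 2 ≤ L := by
      have h2 : Real.log 2 ≤ L := Real.log_le_log (by norm_num) (by linarith [abs_nonneg t])
      linarith [Real.log_two_gt_d9]
    set g : ι → ℤ := fun i => round (γ i - t) with hg
    rw [← Finset.sum_fiberwise_of_maps_to (s := S) (t := S.image g) (g := g)
      (fun i hi => Finset.mem_image_of_mem g hi)]
    have step : ∀ k ∈ S.image g, ∑ i ∈ S with g i = k, m i * (1 + |t - γ i|) ^ (-(5 / 4) : ℝ) ≤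
        68 * C * L * (1 + |(k:ℝ)|) ^ (-(9 / 8) : ℝ) := by
      intro k _
      set K : ℝ := 1 + |(k:ℝ)| with hK
      have hK1 : 1 ≤ K := by linarith [abs_nonneg (k:ℝ)]
      have h1 : ∀ i ∈ S.filter (fun i => g i = k), |γ i - (t + k)| ≤ 1 / 2 := by
        intro i hi
        have := abs_sub_round (γ i - t)
        have e : round (γ i - t) = k := (Finset.mem_filter.mp hi).2
        rw [e] at this
        rwa [← sub_sub]
      have h2 := hloc (t + k) _ h1
      have h3 : ∀ i ∈ S.filter (fun i => g i = k),
          m i * (1 + |t - γ i|) ^ (-(5 / 4) : ℝ) ≤ m i * (4 * K ^ (-(5 / 4) : ℝ)) := by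
        intro i hi
        refine mul_le_mul_of_nonneg_left ?_ (hm i)
        have hh := h1 i hi
        have : K / 2 ≤ 1 + |t - γ i| := by
          have e : (k:ℝ) = -(γ i - (t + k)) + -(t - γ i) := by ring
          have : |(k:ℝ)| ≤ |γ i - (t + k)| + |t - γ i| := by
            conv_lhs => rw [e]
            refine (abs_add_le _ _).trans ?_
            rw [abs_neg, abs_neg]
          rw [hK]; linarith [abs_nonneg (t - γ i)]
        calc (1 + |t - γ i|) ^ (-(5 / 4) : ℝ) ≤ (K / 2) ^ (-(5 / 4) : ℝ) :=
              Real.rpow_le_rpow_of_nonpos (by linarith) this (by norm_num)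
          _ = K ^ (-(5 / 4) : ℝ) * 2 ^ (5 / 4 : ℝ) := by
              rw [Real.div_rpow (by linarith) (by norm_num), Real.rpow_neg (by norm_num : (0:ℝ) ≤ 2)]
              field_simp
          _ ≤ K ^ (-(5 / 4) : ℝ) * 4 := by
              gcongr
              calc (2:ℝ) ^ (5 / 4 : ℝ) ≤ 2 ^ (2:ℝ) :=
                    Real.rpow_le_rpow_of_exponent_le (by norm_num) (by norm_num)
                _ = 4 := by norm_num
          _ = _ := by ring
      have h4 : Real.log (|t + k| + 2) ≤ L * (17 * K ^ (1 / 8 : ℝ)) := by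
        have a1 : |t + k| + 2 ≤ (|t| + 2) * K := by
          have := abs_add_le t k
          rw [hK]; nlinarith [abs_nonneg t, abs_nonneg (k:ℝ)]
        have a2 : Real.log (|t + k| + 2) ≤ L + Real.log K := by
          rw [hL, ← Real.log_mul (by positivity) (by linarith)]
          exact Real.log_le_log (by positivity) a1
        have a3 : Real.log K ≤ K ^ (1 / 8 : ℝ) / (1 / 8) := Real.log_le_rpow_div (by linarith) (by norm_num)
        have a4 : 1 ≤ K ^ (1 / 8 : ℝ) := Real.one_le_rpow hK1 (by norm_num)
        nlinarith
      calc ∑ i ∈ S with g i = k, m i * (1 + |t - γ i|) ^ (-(5 / 4) : ℝ)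
          ≤ ∑ i ∈ S with g i = k, m i * (4 * K ^ (-(5 / 4) : ℝ)) := Finset.sum_le_sum h3
        _ = (∑ i ∈ S with g i = k, m i) * (4 * K ^ (-(5 / 4) : ℝ)) := by rw [Finset.sum_mul]
        _ ≤ (C * (L * (17 * K ^ (1 / 8 : ℝ)))) * (4 * K ^ (-(5 / 4) : ℝ)) := by
            gcongr
            exact h2.trans (by gcongr)
        _ = 68 * C * L * (K ^ (1 / 8 : ℝ) * K ^ (-(5 / 4) : ℝ)) := by ring
        _ = _ := by rw [← Real.rpow_add (by linarith)]; norm_num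
    refine (Finset.sum_le_sum step).trans ?_
    rw [← Finset.mul_sum]
    have : ∑ k ∈ S.image g, (1 + |(k:ℝ)|) ^ (-(9 / 8) : ℝ) ≤ A :=
      hsum.sum_le_tsum _ (fun k _ => by positivity)
    calc _ ≤ 68 * C * L * A := by gcongr
      _ = _ := by ring
  refine ⟨68 * C * A, by positivity, fun t => ⟨?_, ?_⟩⟩
  · exact summable_of_sum_le (fun i => mul_nonneg (hm i) (by positivity)) (key t)
  · exact Real.tsum_le_of_sum_le (fun i => mul_nonneg (hm i) (by positivity)) (key t)

lemma global_count {R : ℝ} (hR : 5 ≤ R) (S : Finset ℂ) (hS : ∀ ρ ∈ S, ‖ρ - 2‖ ≤ R) :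
    ∑ ρ ∈ S, (mu ρ : ℝ) ≤ 300 * (R * √R) := by
  have hlow := xf_lower 0
  simp at hlow
  have hs1 : 1 ≤ √R := by rw [Real.one_le_sqrt]; linarith
  have h2 : √2 ≤ 1.42 := by
    rw [Real.sqrt_le_left (by norm_num)]; norm_num
  have hj := jensen (c := 2) (r := R) (R := 2 * R)
    (M := Real.exp (40 * ((2 * R) * √(2 * R)))) (by linarith) (by linarith)
    (Real.one_le_exp (by positivity)) xf_two_ne ?_ S
    (fun ρ h => by rw [mem_closedBall_iff_norm]; exact hS ρ h)
  · refine hj.trans ?_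
    have e : 2 * R / R = 2 := by field_simp
    rw [e, Real.log_div (Real.exp_pos _).ne' (by linarith), Real.log_exp,
      div_le_iff₀ (Real.log_pos (by norm_num))]
    have h3 : -2 ≤ Real.log ‖xf 2‖ := by
      have := Real.one_sub_inv_le_log_of_pos (x := ‖xf 2‖) (by linarith)
      have h4 : ‖xf 2‖⁻¹ ≤ 3 := by
        rw [inv_le_comm₀ (by linarith) (by norm_num)]; linarith
      linarith
    rw [Real.sqrt_mul (by norm_num)]
    have hR0 : 0 < R * √R := by positivity
    have hR1 : 5 ≤ R * √R := by nlinarith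
    have : 40 * (2 * R * (√2 * √R)) = (80 * √2) * (R * √R) := by ring
    rw [this]
    nlinarith [Real.log_two_gt_d9]
  · intro z hz
    rw [mem_sphere_iff_norm] at hz
    have := xf_growth (s := z) (by rw [hz]; linarith)
    rwa [hz] at this

lemma zero_re_lt {ρ : ℂ} (h : xf ρ = 0) : ρ.re < 1 := by
  by_contra hc
  push Not at hc
  exact riemannZeta_ne_zero_of_one_le_re hc (xf_zero_iff.mp h).2

lemma one_lt_norm_sub {ρ : ℂ} (h : xf ρ = 0) : 1 < ‖ρ - 2‖ := by
  have h1 := zero_re_lt h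
  have h2 := Complex.abs_re_le_norm (ρ - 2)
  simp at h2
  have := neg_abs_le (ρ.re - 2)
  linarith

/-- the type of zeros of `xf` -/
abbrev Zt := {ρ : ℂ // xf ρ = 0}

lemma summable_global : Summable (fun ρ : Zt => (mu ρ : ℝ) / ‖(ρ:ℂ) - 2‖ ^ 2) := by
  have hq : √2 / 2 < 1 := by
    have : √2 < 2 := by rw [Real.sqrt_lt' (by norm_num)]; norm_num
    linarith
  have hgeo : Summable (fun k : ℕ => (√2 / 2) ^ k) :=
    summable_geometric_of_lt_one (by positivity) hq
  refine summable_of_sum_le (c := 300 * (8 * √8) * ∑' k : ℕ, (√2 / 2) ^ k)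
    (fun i => by positivity) fun S => ?_
  classical
  set g : Zt → ℕ := fun ρ => Nat.log 2 ⌊‖(ρ:ℂ) - 2‖⌋₊ with hg
  rw [← Finset.sum_fiberwise_of_maps_to (s := S) (t := S.image g) (g := g)
      (fun i hi => Finset.mem_image_of_mem g hi)]
  have step : ∀ k ∈ S.image g, ∑ ρ ∈ S with g ρ = k, (mu ρ : ℝ) / ‖(ρ:ℂ) - 2‖ ^ 2 ≤
      300 * (8 * √8) * (√2 / 2) ^ k := by
    intro k _
    have hlo : ∀ ρ ∈ S.filter (fun i => g i = k), (2:ℝ) ^ k ≤ ‖(ρ:ℂ) - 2‖ ∧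
        ‖(ρ:ℂ) - 2‖ ≤ 8 * 2 ^ k := by
      intro ρ hρ
      have e : Nat.log 2 ⌊‖(ρ:ℂ) - 2‖⌋₊ = k := (Finset.mem_filter.mp hρ).2
      have h1 := one_lt_norm_sub ρ.2
      have hf : ⌊‖(ρ:ℂ) - 2‖⌋₊ ≠ 0 := by
        have := (Nat.le_floor_iff (norm_nonneg ((ρ:ℂ) - 2)) (n := 1)).mpr (by simpa using h1.le)
        omega
      constructor
      · have := Nat.pow_log_le_self 2 hf
        rw [e] at this
        have h2 : ((2 ^ k : ℕ) : ℝ) ≤ (⌊‖(ρ:ℂ) - 2‖⌋₊ : ℝ) := by exact_mod_cast this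
        refine le_trans (by simpa using h2) (Nat.floor_le (norm_nonneg _))
      · have := Nat.lt_pow_succ_log_self (b := 2) (by norm_num) ⌊‖(ρ:ℂ) - 2‖⌋₊
        rw [e] at this
        have h2 := (Nat.floor_lt (norm_nonneg _)).mp this
        push_cast [pow_succ] at h2
        have : (0:ℝ) < 2 ^ k := by positivity
        linarith
    have h5 : (5:ℝ) ≤ 8 * 2 ^ k := by
      have : (1:ℝ) ≤ 2 ^ k := one_le_pow₀ (by norm_num)
      linarith
    have hc := global_count h5 ((S.filter (fun i => g i = k)).map ⟨Subtype.val, Subtype.val_injective⟩)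
      (by
        intro ρ hρ
        obtain ⟨a, ha, rfl⟩ := Finset.mem_map.mp hρ
        exact (hlo a ha).2)
    rw [Finset.sum_map] at hc
    simp only [Function.Embedding.coeFn_mk] at hc
    calc ∑ ρ ∈ S with g ρ = k, (mu ρ : ℝ) / ‖(ρ:ℂ) - 2‖ ^ 2
        ≤ ∑ ρ ∈ S with g ρ = k, (mu ρ : ℝ) / (2 ^ k) ^ 2 := by
          refine Finset.sum_le_sum fun ρ hρ => ?_
          have := (hlo ρ hρ).1
          gcongr
      _ = (∑ ρ ∈ S with g ρ = k, (mu ρ : ℝ)) / (2 ^ k) ^ 2 := by rw [Finset.sum_div]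
      _ ≤ 300 * (8 * 2 ^ k * √(8 * 2 ^ k)) / (2 ^ k) ^ 2 := by gcongr
      _ = _ := by
          rw [Real.sqrt_mul (by norm_num), div_pow]
          have : √((2:ℝ) ^ k) = √2 ^ k := by
            rw [Real.sqrt_eq_iff_mul_self_eq (by positivity) (by positivity), ← mul_pow,
              Real.mul_self_sqrt (by norm_num)]
          rw [this]
          field_simp
  refine (Finset.sum_le_sum step).trans ?_
  rw [← Finset.mul_sum]
  gcongr
  exact hgeo.sum_le_tsum _ (fun k _ => by positivity)

end
end GM

open Complex Filter MeasureTheory Real Set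
open scoped Topology
namespace GM
noncomputable section

lemma logDeriv_bound {u : ℂ → ℂ} (hu : Differentiable ℂ u) {R M : ℝ} (hR : 0 < R) (hM : 0 < M)
    (hne : ∀ z ∈ Metric.ball (0:ℂ) R, u z ≠ 0) (h0 : u 0 = 1)
    (hb : ∀ z ∈ Metric.ball (0:ℂ) R, ‖u z‖ ≤ Real.exp M) {z : ℂ} (hz : ‖z‖ ≤ R / 4) :
    ‖logDeriv u z - logDeriv u 0‖ ≤ 128 * M / R ^ 2 * ‖z‖ := by
  have hu' : Differentiable ℂ (deriv u) := fun z =>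
    ((hu.analyticAt z).deriv).differentiableAt
  have hd : DifferentiableOn ℂ (logDeriv u) (Metric.ball 0 R) := fun w hw =>
    ((hu' w).div (hu w) (hne w hw)).differentiableWithinAt
  obtain ⟨L, hL0, hL⟩ := hd.isExactOn_ball.with_val_at 0 0
  have hexp : ∀ w ∈ Metric.ball (0:ℂ) R, u w = Complex.exp (L w) := by
    have hcd : ∀ w ∈ Metric.ball (0:ℂ) R, HasDerivAt (fun w => u w * Complex.exp (-L w)) 0 w := by
      intro w hw
      have h1 : HasDerivAt (fun w => u w * cexp (-L w))
          (deriv u w * cexp (-L w) + u w * (cexp (-L w) * -logDeriv u w)) w :=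
        (hu w).hasDerivAt.mul ((hL w hw).neg.cexp)
      have hz0 : deriv u w * cexp (-L w) + u w * (cexp (-L w) * -logDeriv u w) = 0 := by
        rw [logDeriv_apply]
        have := hne w hw
        field_simp
        ring
      rw [hz0] at h1
      exact h1
    intro w hw
    have hconst := (convex_ball (0:ℂ) R).is_const_of_fderivWithin_eq_zero (𝕜 := ℂ)
      (f := fun w => u w * Complex.exp (-L w))
      (fun w hw => (hcd w hw).differentiableAt.differentiableWithinAt)
      (fun w hw => by
        rw [fderivWithin_of_isOpen Metric.isOpen_ball hw]
        ext; simp [(hcd w hw).deriv])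
      hw (Metric.mem_ball_self hR)
    simp only [hL0, h0, neg_zero, Complex.exp_zero, mul_one] at hconst
    rw [Complex.exp_neg] at hconst
    have := Complex.exp_ne_zero (L w)
    field_simp at hconst
    exact hconst
  have hLd : DifferentiableOn ℂ L (Metric.ball 0 R) := fun w hw =>
    (hL w hw).differentiableAt.differentiableWithinAt
  have hre : MapsTo L (Metric.ball 0 R) {z | z.re ≤ M} := by
    intro w hw
    have := hb w hw
    rw [hexp w hw, Complex.norm_exp] at this
    exact Real.exp_le_exp.mp this
  have hLb : ∀ w : ℂ, ‖w‖ ≤ R / 2 → ‖L w‖ ≤ 2 * M := by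
    intro w hw
    have hwb : w ∈ Metric.ball (0:ℂ) R := by rw [mem_ball_zero_iff]; linarith
    refine (Complex.borelCaratheodory_zero hM hLd hre hR hwb hL0).trans ?_
    rw [div_le_iff₀ (by linarith)]
    nlinarith
  have hsub : ∀ w : ℂ, ∀ r : ℝ, ‖w‖ + r < R → Metric.closedBall w r ⊆ Metric.ball 0 R := by
    intro w r h v hv
    rw [mem_closedBall_iff_norm] at hv
    rw [mem_ball_zero_iff]
    have := norm_add_le (v - w) w
    rw [sub_add_cancel] at this
    linarith
  have hnear : ∀ w v : ℂ, ∀ r : ℝ, v ∈ Metric.sphere w r → ‖v‖ ≤ ‖w‖ + r := by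
    intro w v r hv
    rw [mem_sphere_iff_norm] at hv
    have := norm_add_le (v - w) w
    rw [sub_add_cancel] at this
    linarith
  have hφb : ∀ w : ℂ, ‖w‖ ≤ 3 * R / 8 → ‖logDeriv u w‖ ≤ 16 * M / R := by
    intro w hw
    have hwb : w ∈ Metric.ball (0:ℂ) R := by rw [mem_ball_zero_iff]; linarith
    rw [← (hL w hwb).deriv]
    have : DiffContOnCl ℂ L (Metric.ball w (R / 8)) := by
      refine (hLd.mono ?_).diffContOnCl
      rw [closure_ball _ (by positivity)]
      exact hsub w _ (by linarith)
    refine (Complex.norm_deriv_le_of_forall_mem_sphere_norm_le (by positivity) this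
      (fun v hv => hLb v (by linarith [hnear w v _ hv]))).trans (le_of_eq ?_)
    field_simp; norm_num
  have hφ' : ∀ w : ℂ, ‖w‖ ≤ R / 4 → ‖deriv (logDeriv u) w‖ ≤ 128 * M / R ^ 2 := by
    intro w hw
    have : DiffContOnCl ℂ (logDeriv u) (Metric.ball w (R / 8)) := by
      refine (hd.mono ?_).diffContOnCl
      rw [closure_ball _ (by positivity)]
      exact hsub w _ (by linarith)
    refine (Complex.norm_deriv_le_of_forall_mem_sphere_norm_le (by positivity) this
      (fun v hv => hφb v (by linarith [hnear w v _ hv]))).trans (le_of_eq ?_)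
    field_simp; norm_num
  have := (convex_closedBall (0:ℂ) (R / 4)).norm_image_sub_le_of_norm_deriv_le (𝕜 := ℂ)
    (f := logDeriv u) (C := 128 * M / R ^ 2) (x := 0) (y := z)
    (fun w hw => (hd.differentiableAt (Metric.isOpen_ball.mem_nhds (by
      rw [mem_closedBall_zero_iff] at hw; rw [mem_ball_zero_iff]; linarith))))
    (fun w hw => hφ' w (by rwa [mem_closedBall_zero_iff] at hw))
    (by simp; linarith) (by simpa using hz)
  simpa using this

lemma factor_one {f : ℂ → ℂ} (hf : Differentiable ℂ f) (a : ℂ) (n : ℕ)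
    (h : (n : ℕ∞) ≤ analyticOrderAt f a) :
    ∃ g : ℂ → ℂ, Differentiable ℂ g ∧ ∀ z, f z = (z - a) ^ n * g z := by
  induction n with
  | zero => exact ⟨f, hf, by simp⟩
  | succ n ih =>
    obtain ⟨g, hg, hfg⟩ := ih (le_trans (by exact_mod_cast Nat.le_succ n) h)
    have hga : g a = 0 := by
      by_contra hne
      have e : f = ((· - a) ^ n) * g := by ext z; simpa using hfg z
      have : analyticOrderAt f a = n := by
        rw [e, analyticOrderAt_mul (by fun_prop) (hg.analyticAt a), analyticOrderAt_centeredMonomial,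
          (hg.analyticAt a).analyticOrderAt_eq_zero.mpr hne, add_zero]
      rw [this] at h
      exact absurd (by exact_mod_cast h : n + 1 ≤ n) (by omega)
    refine ⟨dslope g a, ?_, fun z => ?_⟩
    · rw [← differentiableOn_univ, Complex.differentiableOn_dslope univ_mem]
      exact hg.differentiableOn
    · have := sub_smul_dslope g a z
      rw [hga, sub_zero, smul_eq_mul] at this
      rw [hfg, ← this]; ring

lemma factor {f : ℂ → ℂ} (hf : Differentiable ℂ f) (hord : ∀ z, analyticOrderAt f z ≠ ⊤)
    (S : Finset ℂ) :
    ∃ g : ℂ → ℂ, Differentiable ℂ g ∧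
      (∀ z, f z = (∏ ρ ∈ S, (z - ρ) ^ analyticOrderNatAt f ρ) * g z) ∧ ∀ ρ ∈ S, g ρ ≠ 0 := by
  classical
  induction S using Finset.induction_on with
  | empty => exact ⟨f, hf, by simp, by simp⟩
  | insert a S ha ih =>
    obtain ⟨g, hg, hfg, hgS⟩ := ih
    have e : f = (fun z => ∏ ρ ∈ S, (z - ρ) ^ analyticOrderNatAt f ρ) * g := by
      ext z; exact hfg z
    have hP : Differentiable ℂ (fun z => ∏ ρ ∈ S, (z - ρ) ^ analyticOrderNatAt f ρ) := by fun_prop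
    have hPa : (∏ ρ ∈ S, (a - ρ) ^ analyticOrderNatAt f ρ) ≠ 0 := by
      refine Finset.prod_ne_zero_iff.mpr fun ρ hρ => pow_ne_zero _ (sub_ne_zero.mpr ?_)
      rintro rfl; exact ha hρ
    have ho : analyticOrderAt f a = analyticOrderAt g a := by
      conv_lhs => rw [e]
      rw [analyticOrderAt_mul (hP.analyticAt a) (hg.analyticAt a),
        (hP.analyticAt a).analyticOrderAt_eq_zero.mpr hPa, zero_add]
    have hn : ((analyticOrderNatAt f a : ℕ) : ℕ∞) = analyticOrderAt g a := by
      rw [Nat.cast_analyticOrderNatAt (hord a), ho]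
    obtain ⟨k, hk, hgk⟩ := factor_one hg a _ hn.le
    have hka : k a ≠ 0 := by
      intro h0
      have e : g = ((· - a) ^ (analyticOrderNatAt f a)) * k := by ext z; simpa using hgk z
      have : analyticOrderAt g a = (analyticOrderNatAt f a : ℕ∞) + analyticOrderAt k a := by
        conv_lhs => rw [e]
        rw [analyticOrderAt_mul (by fun_prop) (hk.analyticAt a), analyticOrderAt_centeredMonomial]
      rw [← hn] at this
      have h1 : analyticOrderAt k a ≠ 0 := by
        rw [Ne, (hk.analyticAt a).analyticOrderAt_eq_zero]; simpa using h0
      apply h1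
      have := this.symm
      generalize analyticOrderAt k a = q at this
      induction q using ENat.recTopCoe with
      | top => simp at this
      | coe q =>
        norm_cast at this ⊢
        omega
    refine ⟨k, hk, fun z => ?_, fun ρ hρ => ?_⟩
    · rw [Finset.prod_insert ha, hfg, hgk]; ring
    · rcases Finset.mem_insert.mp hρ with rfl | hρ
      · exact hka
      · intro h0
        apply hgS ρ hρ
        rw [hgk, h0, mul_zero]

lemma eventually_far (R : ℝ) : ∀ᶠ ρ : Zt in cofinite, R < ‖(ρ:ℂ) - 2‖ := by
  have h := summable_global.tendsto_cofinite_zero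
  have hR : (0:ℝ) < 1 / (|R| + 1) ^ 2 := by positivity
  filter_upwards [h.eventually (gt_mem_nhds hR)] with ρ hρ
  have h1 : (1:ℝ) ≤ mu ρ := by exact_mod_cast mu_pos ρ.2
  have h2 : 0 < ‖(ρ:ℂ) - 2‖ := by linarith [one_lt_norm_sub ρ.2]
  rw [div_lt_div_iff₀ (by positivity) (by positivity)] at hρ
  have h3 : (|R| + 1) ^ 2 < ‖(ρ:ℂ) - 2‖ ^ 2 := by nlinarith [sq_nonneg (|R| + 1)]
  have := lt_of_pow_lt_pow_left₀ 2 h2.le h3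
  linarith [le_abs_self R]

lemma finite_near (R : ℝ) : {ρ : Zt | ‖(ρ:ℂ) - 2‖ ≤ R}.Finite := by
  have := eventually_far R
  rw [Filter.eventually_cofinite] at this
  simpa using this

lemma hadamard_summable {s : ℂ} :
    Summable (fun ρ : Zt => (mu ρ : ℂ) * (1 / (s - ρ) - 1 / (2 - ρ))) := by
  refine Summable.of_norm_bounded_eventually (summable_global.mul_left (2 * ‖s - 2‖)) ?_
  filter_upwards [eventually_far (2 * ‖s - 2‖)] with ρ hρ
  have h0 : 0 < ‖(ρ:ℂ) - 2‖ := by linarith [one_lt_norm_sub ρ.2]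
  have h1 : ‖(ρ:ℂ) - 2‖ / 2 ≤ ‖s - ρ‖ := by
    have := norm_sub_le (s - 2) (s - ρ)
    rw [show s - 2 - (s - ρ) = ρ - 2 by ring] at this
    linarith
  have h2 : s - ρ ≠ 0 := norm_pos_iff.mp (by linarith)
  have h3 : (2:ℂ) - ρ ≠ 0 := by rw [← neg_sub, neg_ne_zero]; exact norm_pos_iff.mp h0
  have e : (1 / (s - ρ) - 1 / (2 - ρ) : ℂ) = -(s - 2) / ((s - ρ) * (2 - ρ)) := by
    field_simp; ring
  rw [e, norm_mul, norm_div, norm_neg, norm_mul, Complex.norm_natCast, norm_sub_rev 2 (ρ:ℂ)]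
  have hm : (0:ℝ) ≤ mu ρ := by positivity
  calc (mu ρ : ℝ) * (‖s - 2‖ / (‖s - ρ‖ * ‖(ρ:ℂ) - 2‖))
      ≤ mu ρ * (‖s - 2‖ / (‖(ρ:ℂ) - 2‖ / 2 * ‖(ρ:ℂ) - 2‖)) := by gcongr
    _ = _ := by field_simp

lemma hadamard {s : ℂ} (hs : xf s ≠ 0) :
    HasSum (fun ρ : Zt => (mu ρ : ℂ) * (1 / (s - ρ) - 1 / (2 - ρ)))
      (logDeriv xf s - logDeriv xf 2) := by
  have hsum := (hadamard_summable (s := s)).hasSum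
  set φ : Zt → ℂ := fun ρ => (mu ρ : ℂ) * (1 / (s - ρ) - 1 / (2 - ρ)) with hφ
  set Sn : ℕ → Finset Zt := fun n => (finite_near n).toFinset with hSn
  have hSt : Tendsto Sn atTop atTop := by
    refine tendsto_atTop_finset_of_monotone ?_ ?_
    · intro a b hab ρ hρ
      simp [hSn] at hρ ⊢
      exact hρ.trans (by exact_mod_cast hab)
    · intro ρ
      obtain ⟨n, hn⟩ := exists_nat_ge ‖(ρ:ℂ) - 2‖
      exact ⟨n, by simpa [hSn] using hn⟩
  have h1 : Tendsto (fun n => ∑ ρ ∈ Sn n, φ ρ) atTop (𝓝 (∑' ρ, φ ρ)) := hsum.comp hSt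
  have hlow := xf_lower 0
  simp at hlow
  suffices h2 : Tendsto (fun n => ∑ ρ ∈ Sn n, φ ρ) atTop (𝓝 (logDeriv xf s - logDeriv xf 2)) by
    rw [← tendsto_nhds_unique h1 h2]; exact hsum
  rw [tendsto_iff_norm_sub_tendsto_zero]
  have hlim : Tendsto (fun n : ℕ => 128 * 400 * ‖s - 2‖ / √(n:ℝ)) atTop (𝓝 0) :=
    Tendsto.div_atTop tendsto_const_nhds
      (Real.tendsto_sqrt_atTop.comp tendsto_natCast_atTop_atTop)
  refine squeeze_zero' (Eventually.of_forall fun _ => norm_nonneg _) ?_ hlim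
  filter_upwards [eventually_ge_atTop 5, (tendsto_natCast_atTop_atTop (R := ℝ)).eventually_ge_atTop (4 * ‖s - 2‖)] with n hn5 hns
  have hR5 : (5:ℝ) ≤ n := by exact_mod_cast hn5
  set R : ℝ := (n : ℝ) with hR
  classical
  set S : Finset ℂ := (Sn n).map ⟨Subtype.val, Subtype.val_injective⟩ with hS
  have hSmem : ∀ ρ : ℂ, ρ ∈ S ↔ (xf ρ = 0 ∧ ‖ρ - 2‖ ≤ R) := by
    intro ρ
    simp [hS, hSn, hR, and_comm]
  obtain ⟨g, hg, hfg, hgS⟩ := factor differentiable_xf order_xf_ne_top S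
  have hg_ne : ∀ z, ‖z - 2‖ ≤ R → g z ≠ 0 := by
    intro z hz h0
    have hx : xf z = 0 := by rw [hfg, h0, mul_zero]
    exact hgS z ((hSmem z).mpr ⟨hx, hz⟩) h0
  have hg2 : g 2 ≠ 0 := hg_ne 2 (by simp; linarith)
  set P : ℂ → ℂ := fun z => ∏ ρ ∈ S, (z - ρ) ^ analyticOrderNatAt xf ρ with hP
  set u : ℂ → ℂ := fun z => g (z + 2) / g 2 with hu
  have hud : Differentiable ℂ u := by
    have : Differentiable ℂ (fun z => g (z + 2)) := hg.comp (by fun_prop)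
    exact this.div_const _
  have hsph : ∀ z : ℂ, ‖z‖ = 3 * R → ‖u z‖ ≤ Real.exp (400 * (R * √R)) := by
    intro z hz
    have hP2 : P 2 ≠ 0 := by
      intro h0; exact xf_two_ne (by rw [hfg 2]; change P 2 * g 2 = 0; rw [h0, zero_mul])
    have hPle : ‖P 2‖ ≤ ‖P (z + 2)‖ := by
      simp only [hP, norm_prod, norm_pow]
      refine Finset.prod_le_prod (fun _ _ => by positivity) fun ρ hρ => ?_
      have h2 := ((hSmem ρ).mp hρ).2
      gcongr
      have := norm_sub_le (z + 2 - ρ) (-(ρ - 2))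
      rw [show z + 2 - ρ - -(ρ - 2) = z by ring, norm_neg] at this
      rw [norm_sub_rev]; linarith
    have hPp : 0 < ‖P 2‖ := norm_pos_iff.mpr hP2
    have e1 : xf (z + 2) = P (z + 2) * g (z + 2) := hfg _
    have e2 : xf 2 = P 2 * g 2 := hfg _
    have hgr := xf_growth (s := z + 2) (by rw [add_sub_cancel_right, hz]; linarith)
    rw [add_sub_cancel_right, hz, e1, norm_mul] at hgr
    rw [e2, norm_mul] at hlow
    have hg2p : 0 < ‖g 2‖ := norm_pos_iff.mpr hg2
    simp only [hu, norm_div]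
    rw [div_le_iff₀ hg2p]
    have h3 : √(3 * R) ≤ 2 * √R := by
      rw [Real.sqrt_mul (by norm_num)]
      gcongr
      rw [Real.sqrt_le_left (by norm_num)]; norm_num
    have hRR : 1 ≤ R * √R := by
      have : 1 ≤ √R := by rw [Real.one_le_sqrt]; linarith
      nlinarith
    have h4 : 40 * (3 * R * √(3 * R)) + 2 ≤ 400 * (R * √R) := by
      have : 3 * R * √(3 * R) ≤ 3 * R * (2 * √R) := by gcongr
      nlinarith
    have h5 : 3 * Real.exp (40 * (3 * R * √(3 * R))) ≤ Real.exp (400 * (R * √R)) := by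
      refine le_trans ?_ (Real.exp_le_exp.mpr h4)
      rw [Real.exp_add]
      have : 3 ≤ Real.exp 2 := by linarith [Real.add_one_le_exp 2]
      nlinarith [Real.exp_pos (40 * (3 * R * √(3 * R)))]
    have h6 : ‖P 2‖ * ‖g (z + 2)‖ ≤ ‖P (z + 2)‖ * ‖g (z + 2)‖ := by gcongr
    set E := Real.exp (400 * (R * √R))
    have h7 : ‖P 2‖ * ‖g (z+2)‖ ≤ ‖P 2‖ * (E * ‖g 2‖) := by
      have hE : 0 < E := Real.exp_pos _
      nlinarith
    exact le_of_mul_le_mul_left h7 hPp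
  have hball : ∀ z ∈ Metric.ball (0:ℂ) R, ‖u z‖ ≤ Real.exp (400 * (R * √R)) := by
    intro z hz
    refine Complex.norm_le_of_forall_mem_frontier_norm_le (U := Metric.ball (0:ℂ) (3 * R))
      Metric.isBounded_ball hud.diffContOnCl ?_ (subset_closure (Metric.ball_subset_ball (by linarith) hz))
    intro w hw
    rw [frontier_ball _ (by linarith), mem_sphere_zero_iff_norm] at hw
    exact hsph w hw
  have hlb := logDeriv_bound hud (R := R) (M := 400 * (R * √R)) (by linarith) (by positivity)
    (fun z hz => div_ne_zero (hg_ne _ (by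
      rw [mem_ball_zero_iff] at hz; rw [add_sub_cancel_right]; exact hz.le)) hg2)
    (by simp [hu, hg2]) hball (z := s - 2) (by linarith)
  have hlu : ∀ z, logDeriv u z = logDeriv g (z + 2) := by
    intro z
    rw [logDeriv_apply, logDeriv_apply]
    have : deriv u z = deriv g (z + 2) / g 2 := by
      simp only [hu]
      rw [deriv_div_const, deriv_comp_add_const]
    rw [this]
    simp only [hu]
    field_simp
  have hlx : ∀ z, xf z ≠ 0 → logDeriv xf z = (∑ ρ ∈ S, (mu ρ : ℂ) / (z - ρ)) + logDeriv g z := by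
    intro z hz
    have e : xf = fun z => P z * g z := by ext z; exact hfg z
    have hne : ∀ ρ ∈ S, z - ρ ≠ 0 := by
      intro ρ hρ h0
      apply hz
      rw [sub_eq_zero.mp h0]; exact ((hSmem ρ).mp hρ).1
    have hPz : P z ≠ 0 := Finset.prod_ne_zero_iff.mpr fun ρ hρ => pow_ne_zero _ (hne ρ hρ)
    have hgz : g z ≠ 0 := by
      intro h0; apply hz; rw [hfg, h0, mul_zero]
    conv_lhs => rw [e]
    rw [logDeriv_mul z hPz hgz (by simp only [hP]; fun_prop) (hg z)]
    congr 1
    simp only [hP]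
    rw [logDeriv_prod (f := fun (ρ : ℂ) (z : ℂ) => (z - ρ) ^ analyticOrderNatAt xf ρ) (fun ρ hρ => pow_ne_zero _ (hne ρ hρ)) (fun ρ _ => by fun_prop)]
    refine Finset.sum_congr rfl fun ρ hρ => ?_
    rw [logDeriv_fun_pow (by fun_prop), logDeriv_apply]
    simp [mu, div_eq_mul_inv]
  rw [hlu, hlu, sub_add_cancel, zero_add] at hlb
  have hsumS : ∑ ρ ∈ Sn n, φ ρ = ∑ ρ ∈ S, (mu ρ : ℂ) / (s - ρ) - ∑ ρ ∈ S, (mu ρ : ℂ) / (2 - ρ) := by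
    rw [hS, Finset.sum_map, Finset.sum_map, ← Finset.sum_sub_distrib]
    refine Finset.sum_congr rfl fun ρ _ => ?_
    simp [hφ]; ring
  rw [hsumS, hlx s hs, hlx 2 xf_two_ne]
  calc _ = ‖logDeriv g s - logDeriv g 2‖ := by rw [← norm_neg]; congr 1; ring
    _ ≤ _ := hlb
    _ = _ := by
      have hR0 : 0 < R := by linarith
      have hq : 0 < √R := Real.sqrt_pos.mpr hR0
      have : √R * √R = R := Real.mul_self_sqrt hR0.le
      field_simp
      rw [sq, this]

end
end GM

open Complex Filter MeasureTheory Real Set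
open scoped Topology
namespace GM
noncomputable section

lemma laplace_unique {f : ℝ → ℂ} (hc : ContinuousOn f (Ici 0)) (h0 : f 0 = 0)
    (hi : IntegrableOn f (Ioi 0))
    (hF : ∀ t : ℝ, ∫ y in Ioi (0:ℝ), f y * cexp (-(t * y) * I) = 0) :
    ∀ y, 0 ≤ y → f y = 0 := by
  set g : ℝ → ℂ := (Ici (0:ℝ)).indicator f with hg
  have hgc : Continuous g := by
    have : g = fun y => f (max y 0) := by
      ext y
      by_cases hy : 0 ≤ y
      · simp [hg, hy]
      · push Not at hy
        simp [hg, hy.le, not_le.mpr hy, h0]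
    rw [this]
    exact hc.comp_continuous (by fun_prop) (fun y => mem_Ici.mpr (le_max_right _ _))
  have hgi : Integrable g := by
    rw [hg, integrable_indicator_iff measurableSet_Ici]
    exact Iff.mpr integrableOn_Ici_iff_integrableOn_Ioi hi
  have hFz : FourierTransform.fourier g = 0 := by
    ext w
    rw [Real.fourier_real_eq_integral_exp_smul]
    have := hF (2 * π * w)
    simp only [Pi.zero_apply]
    rw [← this, ← integral_Ici_eq_integral_Ioi, ← integral_indicator measurableSet_Ici]
    congr 1
    ext y
    by_cases hy : 0 ≤ y
    · simp only [hg, indicator_of_mem (show y ∈ Ici (0:ℝ) from hy), smul_eq_mul]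
      rw [mul_comm]; congr 2; push_cast; ring
    · simp [hg, hy]
  intro y hy
  have h := hgi.fourierInv_fourier_eq (by rw [hFz]; exact integrable_zero _ _ _)
    (hgc.continuousAt (x := y))
  rw [hFz] at h
  have h2 : g y = f y := by simp [hg, hy]
  rw [← h2, ← h]
  simp [Real.fourierInv_eq']

lemma lap {ι : Type*} [Countable ι] {F : ι → ℝ → ℂ} {B : ι → ℝ} (hB : Summable B)
    (hB0 : ∀ i, 0 ≤ B i)
    (hc : ∀ i, Continuous (F i)) (hb : ∀ i y, 0 ≤ y → ‖F i y‖ ≤ B i * rexp (-y)) :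
    (∀ y, 0 ≤ y → Summable (fun i => F i y)) ∧
    ContinuousOn (fun y => ∑' i, F i y) (Ici 0) ∧ IntegrableOn (fun y => ∑' i, F i y) (Ioi 0) ∧
    ∀ t : ℝ, HasSum (fun i => ∫ y in Ioi (0:ℝ), F i y * cexp (-(t * y) * I))
      (∫ y in Ioi (0:ℝ), (∑' i, F i y) * cexp (-(t * y) * I)) := by
  have hb' : ∀ i y, 0 ≤ y → ‖F i y‖ ≤ B i := fun i y hy => (hb i y hy).trans
    (mul_le_of_le_one_right (hB0 i) (Real.exp_le_one_iff.mpr (by linarith)))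
  have hco : ContinuousOn (fun y => ∑' i, F i y) (Ici 0) :=
    continuousOn_tsum (fun i => (hc i).continuousOn) hB (fun i y hy => hb' i y hy)
  have hs : ∀ y, 0 ≤ y → Summable (fun i => F i y) := fun y hy =>
    Summable.of_norm_bounded hB (fun i => hb' i y hy)
  have hexp : IntegrableOn (fun y : ℝ => rexp (-y)) (Ioi 0) := integrableOn_exp_neg_Ioi 0
  have hnorm : ∀ t y : ℝ, ‖cexp (-(t * y) * I)‖ = 1 := by
    intro t y
    rw [show (-(t * y) * I : ℂ) = ((-(t*y) : ℝ) : ℂ) * I by push_cast; ring]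
    exact Complex.norm_exp_ofReal_mul_I _
  have hFi : ∀ (t : ℝ) i, IntegrableOn (fun y : ℝ => F i y * cexp (-(t * y) * I)) (Ioi 0) := by
    intro t i
    refine Integrable.mono' (hexp.const_mul (B i)) ?_ ?_
    · have := hc i
      exact (by fun_prop : Continuous (fun y : ℝ => F i y * cexp (-(t * y) * I))).aestronglyMeasurable
    · filter_upwards [ae_restrict_mem measurableSet_Ioi] with y hy
      rw [norm_mul, hnorm, mul_one]; exact hb i y (le_of_lt hy)
  refine ⟨hs, hco, ?_, ?_⟩
  · refine Integrable.mono' (hexp.const_mul (∑' i, B i)) ?_ ?_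
    · exact (hco.mono Ioi_subset_Ici_self).aestronglyMeasurable measurableSet_Ioi
    · filter_upwards [ae_restrict_mem measurableSet_Ioi] with y hy
      rw [← tsum_mul_right]
      exact tsum_of_norm_bounded (hB.mul_right _).hasSum (fun i => hb i y (le_of_lt hy))
  · intro t
    simp_rw [← tsum_mul_right]
    refine hasSum_integral_of_summable_integral_norm (hFi t) ?_
    refine Summable.of_nonneg_of_le (fun i => integral_nonneg fun _ => norm_nonneg _) (fun i => ?_) hB
    calc ∫ y in Ioi (0:ℝ), ‖F i y * cexp (-(t * y) * I)‖ ≤ ∫ y in Ioi (0:ℝ), B i * rexp (-y) := by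
          refine setIntegral_mono_on (hFi t i).norm (hexp.const_mul _) measurableSet_Ioi ?_
          intro y hy
          rw [norm_mul, hnorm, mul_one]; exact hb i y (le_of_lt hy)
      _ = B i := by rw [integral_const_mul, integral_exp_neg_Ioi_zero, mul_one]

/-- Laplace transform of a ramp. -/
lemma lap_ramp {s : ℂ} (hs : 0 < s.re) (c : ℝ) :
    IntegrableOn (fun y : ℝ => ((y:ℂ) - c) * cexp (-s * y)) (Ioi c) ∧
    ∫ y in Ioi c, ((y:ℂ) - c) * cexp (-s * y) = cexp (-s * c) / s ^ 2 := by
  have hs0 : s ≠ 0 := by intro h; simp [h] at hs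
  have hnm : ∀ y : ℝ, ‖cexp (-s * y)‖ = rexp (-s.re * y) := by
    intro y; rw [Complex.norm_exp]; simp
  set σ := s.re
  have hle : ∀ x : ℝ, x ≤ 2 / σ * rexp (σ * x / 2) := by
    intro x
    have := Real.add_one_le_exp (σ * x / 2)
    have : x = 2 / σ * (σ * x / 2) := by field_simp
    calc x = 2 / σ * (σ * x / 2) := this
      _ ≤ _ := by gcongr; linarith
  have hi : IntegrableOn (fun y : ℝ => ((y:ℂ) - c) * cexp (-s * y)) (Ioi c) := by
    have h1 : IntegrableOn (fun y : ℝ => rexp (-(σ/2) * y)) (Ioi c) :=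
      integrableOn_exp_mul_Ioi (by linarith) c
    refine Integrable.mono' (h1.const_mul (2 / σ * rexp (-(σ * c / 2)))) ?_ ?_
    · exact (by fun_prop : Continuous (fun y : ℝ => ((y:ℂ) - c) * cexp (-s * y))).aestronglyMeasurable
    · filter_upwards [ae_restrict_mem measurableSet_Ioi] with y hy
      rw [norm_mul, hnm, ← Complex.ofReal_sub, Complex.norm_real, Real.norm_of_nonneg (by linarith [mem_Ioi.mp hy])]
      calc (y - c) * rexp (-σ * y) ≤ 2 / σ * rexp (σ * (y - c) / 2) * rexp (-σ * y) := by
            gcongr; exact hle _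
        _ = _ := by
          rw [mul_assoc, mul_assoc, ← Real.exp_add, ← Real.exp_add]; congr 2; ring
  refine ⟨hi, ?_⟩
  have hlim : Tendsto (fun y : ℝ => -(((y:ℂ) - c) / s + 1 / s ^ 2) * cexp (-s * y)) atTop (𝓝 0) := by
    rw [tendsto_zero_iff_norm_tendsto_zero]
    have h1 : Tendsto (fun y : ℝ => (|y| + |c|) / ‖s‖ * rexp (-σ * y) + 1 / ‖s‖ ^ 2 * rexp (-σ * y)) atTop (𝓝 0) := by
      have ha : Tendsto (fun y : ℝ => rexp (-σ * y)) atTop (𝓝 0) := by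
        refine Real.tendsto_exp_atBot.comp ?_
        exact (tendsto_id.const_mul_atTop_of_neg (by linarith : -σ < 0))
      have hb : Tendsto (fun y : ℝ => y * rexp (-σ * y)) atTop (𝓝 0) := by
        have := Real.tendsto_pow_mul_exp_neg_atTop_nhds_zero 1
        have h2 := (this.comp (tendsto_id.const_mul_atTop hs)).const_mul (1/σ)
        simp only [mul_zero] at h2
        refine h2.congr fun y => ?_
        have : σ ≠ 0 := hs.ne'
        simp; field_simp
      have h3 := (hb.mul_const (1 / ‖s‖)).add ((ha.const_mul (|c| / ‖s‖)).add (ha.const_mul (1 / ‖s‖ ^ 2)))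
      simp only [mul_zero, zero_mul, add_zero] at h3
      refine h3.congr' ?_
      filter_upwards [eventually_ge_atTop 0] with y hy
      rw [abs_of_nonneg hy]; ring
    refine squeeze_zero (fun _ => norm_nonneg _) (fun y => ?_) h1
    rw [norm_mul, norm_neg, hnm, ← add_mul]
    gcongr
    refine (norm_add_le _ _).trans ?_
    rw [norm_div, norm_div, norm_one, norm_pow]
    gcongr
    rw [← Complex.ofReal_sub, Complex.norm_real]
    exact abs_sub _ _
  have hd : ∀ y ∈ Ici c, HasDerivAt (fun y : ℝ => -(((y:ℂ) - c) / s + 1 / s ^ 2) * cexp (-s * y))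
      (((y:ℂ) - c) * cexp (-s * y)) y := by
    intro y _
    have h1 : HasDerivAt (fun y : ℝ => (y:ℂ)) 1 y := Complex.ofRealCLM.hasDerivAt
    have h2 : HasDerivAt (fun y : ℝ => -(((y:ℂ) - c) / s + 1 / s ^ 2) * cexp (-s * y))
        (-(1 / s) * cexp (-s * y) + -(((y:ℂ) - c) / s + 1 / s ^ 2) * (cexp (-s * y) * (-s * 1))) y :=
      ((((h1.sub_const (c:ℂ)).div_const s).add_const (1 / s ^ 2)).neg).mul ((h1.const_mul (-s)).cexp)
    have e : -(1 / s) * cexp (-s * y) + -(((y:ℂ) - c) / s + 1 / s ^ 2) * (cexp (-s * y) * (-s * 1))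
        = ((y:ℂ) - c) * cexp (-s * y) := by
      field_simp; ring
    rwa [e] at h2
  have := integral_Ioi_of_hasDerivAt_of_tendsto' hd hi hlim
  rw [this]; simp; ring

end
end GM

open Complex Filter MeasureTheory Real Set
open scoped Topology
namespace GM
noncomputable section

lemma summand_pos (ρ : Zt) : 0 < (mu ρ:ℝ)/‖(ρ:ℂ)-2‖^2 := by
  have h1 : (1:ℝ) ≤ mu ρ := by exact_mod_cast mu_pos ρ.2
  have h2 : 0 < ‖(ρ:ℂ) - 2‖ := by linarith [one_lt_norm_sub ρ.2]
  positivity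

instance countable_Zt : Countable Zt := by
  have h := summable_global.countable_support
  have : Function.support (fun ρ:Zt => (mu ρ:ℝ)/‖(ρ:ℂ)-2‖^2) = univ := by
    ext ρ; simp only [Function.mem_support, mem_univ, iff_true]; exact (summand_pos ρ).ne'
  rw [this] at h
  exact countable_univ_iff.mp h

lemma Zt_re (hRH : RiemannHypothesis) (ρ : Zt) : (ρ:ℂ).re ≤ 1/2 := by
  rcases xf_zero_RH hRH ρ.2 with ⟨n, hn⟩ | h
  · rw [hn]; simp; have : (0:ℝ) ≤ n := by positivity
    linarith
  · exact h.le

lemma Zt_norm (hRH : RiemannHypothesis) (ρ : Zt) : 1/2 ≤ ‖(ρ:ℂ)‖ := by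
  rcases xf_zero_RH hRH ρ.2 with ⟨n, hn⟩ | h
  · rw [hn]
    have : (-2 * ((n:ℂ) + 1)) = ((-2 * (n + 1) : ℝ) : ℂ) := by push_cast; ring
    rw [this, Complex.norm_real, norm_mul, Real.norm_of_nonneg (by positivity : (0:ℝ) ≤ n + 1)]
    have : (0:ℝ) ≤ n := by positivity
    norm_num; linarith
  · have := Complex.abs_re_le_norm (ρ:ℂ)
    rw [h] at this; simpa [abs_of_pos] using this

lemma summable_inv_sq (hRH : RiemannHypothesis) : Summable (fun ρ:Zt => (mu ρ:ℝ)/‖(ρ:ℂ)‖^2) := by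
  refine Summable.of_nonneg_of_le (fun _ => by positivity) (fun ρ => ?_) (summable_global.mul_left 25)
  have h1 := Zt_norm hRH ρ
  have h2 : 0 < ‖(ρ:ℂ) - 2‖ := by linarith [one_lt_norm_sub ρ.2]
  have h3 : ‖(ρ:ℂ) - 2‖ ≤ 5 * ‖(ρ:ℂ)‖ := by
    have := norm_sub_le (ρ:ℂ) 2
    simp at this; linarith
  rw [← mul_div_assoc, div_le_div_iff₀ (by positivity) (by positivity)]
  have : ‖(ρ:ℂ) - 2‖^2 ≤ (5 * ‖(ρ:ℂ)‖)^2 := by gcongr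
  have hm : (0:ℝ) ≤ mu ρ := by positivity
  nlinarith

lemma Zt_norm_le (hRH : RiemannHypothesis) (ρ : Zt) : ‖(ρ:ℂ)‖ ≤ ‖(2:ℂ) - ρ‖ := by
  rw [Complex.norm_def, Complex.norm_def]
  apply Real.sqrt_le_sqrt
  simp only [Complex.normSq_apply]
  have := Zt_re hRH ρ
  simp; nlinarith

def psi1 (y : ℝ) : ℝ := ∑' n : ℕ, ArithmeticFunction.vonMangoldt n * max (y - Real.log n) 0

def qf (ρ : ℂ) (y : ℝ) : ℂ := y * (1/(2-ρ) + 1/ρ) + (1 - cexp (ρ * y)) / ρ^2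

lemma qf_bound (hRH : RiemannHypothesis) (ρ : Zt) {y : ℝ} (hy : 0 ≤ y) :
    ‖qf ρ y‖ ≤ 4 / ‖(ρ:ℂ)‖^2 * rexp y := by
  have h1 := Zt_norm hRH ρ
  have h2 := Zt_norm_le hRH ρ
  have hρ : (ρ:ℂ) ≠ 0 := norm_pos_iff.mp (by linarith)
  have hρ2 : (2:ℂ) - ρ ≠ 0 := norm_pos_iff.mp (by linarith)
  have e : (1/(2-(ρ:ℂ)) + 1/ρ) = 2 / (ρ * (2 - ρ)) := by field_simp; ring
  have hey := Real.add_one_le_exp y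
  have hexp : ‖cexp (ρ * y)‖ ≤ rexp y := by
    rw [Complex.norm_exp]; simp
    have := Zt_re hRH ρ
    nlinarith
  unfold qf
  rw [e]
  calc _ ≤ ‖(y:ℂ) * (2 / (ρ * (2 - ρ)))‖ + ‖(1 - cexp (ρ * y)) / (ρ:ℂ)^2‖ := norm_add_le _ _
    _ ≤ y * (2 / (‖(ρ:ℂ)‖ * ‖(ρ:ℂ)‖)) + (1 + rexp y) / ‖(ρ:ℂ)‖^2 := by
      rw [norm_mul, norm_div, norm_div, norm_mul, norm_pow, Complex.norm_real, Real.norm_of_nonneg hy]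
      have : ‖1 - cexp (ρ * y)‖ ≤ 1 + rexp y := (norm_sub_le _ _).trans (by simpa using hexp)
      have h3 : ‖(2:ℂ)‖ = 2 := by simp
      rw [h3]
      gcongr
    _ = (2 * y + 1 + rexp y) / ‖(ρ:ℂ)‖^2 := by field_simp; ring
    _ ≤ (4 * rexp y) / ‖(ρ:ℂ)‖^2 := by gcongr; linarith
    _ = _ := by ring

lemma lap_exp {z : ℂ} (hz : 0 < z.re) :
    IntegrableOn (fun y : ℝ => cexp (-z * y)) (Ioi 0) ∧ ∫ y in Ioi (0:ℝ), cexp (-z * y) = 1 / z := by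
  refine ⟨integrableOn_exp_mul_complex_Ioi (by simpa using hz) 0, ?_⟩
  rw [integral_exp_mul_complex_Ioi (by simpa using hz)]
  simp

lemma int_fun_sub {α : Type*} [MeasurableSpace α] {μ : Measure α} {f g : α → ℂ}
    (hf : Integrable f μ) (hg : Integrable g μ) : Integrable (fun x => f x - g x) μ := hf.sub hg

lemma lap_qf {ρ s : ℂ} (hρ : ρ ≠ 0) (hs : 0 < s.re) (hsr : 0 < (s - ρ).re) :
    ∫ y in Ioi (0:ℝ), qf ρ y * cexp (-s * y) = (1/(2-ρ) - 1/(s-ρ)) / s^2 := by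
  obtain ⟨i1, e1⟩ := lap_ramp hs 0
  obtain ⟨i2, e2⟩ := lap_exp hs
  obtain ⟨i3, e3⟩ := lap_exp hsr
  simp only [ofReal_zero, sub_zero, mul_zero, Complex.exp_zero] at i1 e1
  have hs0 : s ≠ 0 := by intro h; simp [h] at hs
  have hsr0 : s - ρ ≠ 0 := by intro h; simp [h] at hsr
  have : ∀ y : ℝ, qf ρ y * cexp (-s * y) = (1/(2-ρ) + 1/ρ) * (y * cexp (-s * y)) +
      (1/ρ^2 * cexp (-s * y) - 1/ρ^2 * cexp (-(s - ρ) * y)) := by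
    intro y
    unfold qf
    rw [show -(s - ρ) * y = ρ * y + -s * y by ring, Complex.exp_add]
    ring
  simp_rw [this]
  rw [integral_add (i1.const_mul _) (int_fun_sub (i2.const_mul _) (i3.const_mul _)),
    integral_sub (i2.const_mul _) (i3.const_mul _), integral_const_mul, integral_const_mul,
    integral_const_mul, e1, e2, e3]
  generalize hw : (1:ℂ) / (2 - ρ) = w
  field_simp
  ring

lemma lap_max {s : ℂ} (hs : 0 < s.re) {c : ℝ} (hc : 0 ≤ c) :
    ∫ y in Ioi (0:ℝ), ((max (y - c) 0 : ℝ) : ℂ) * cexp (-s * y) = cexp (-s * c) / s ^ 2 := by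
  rw [← (lap_ramp hs c).2]
  rw [setIntegral_eq_of_subset_of_forall_sdiff_eq_zero measurableSet_Ioi (Ioi_subset_Ioi hc)]
  · refine setIntegral_congr_fun measurableSet_Ioi fun y hy => ?_
    have : 0 ≤ y - c := by linarith [mem_Ioi.mp hy]
    simp [this]
  · intro y hy
    have : y - c ≤ 0 := by have := hy.2; simp at this; linarith
    simp [this]

lemma logDeriv_xf_eq {s : ℂ} (hs : 1 < s.re) :
    logDeriv xf s = 1 / (s - 1) + deriv riemannZeta s / riemannZeta s := by
  have h1 : s ≠ 1 := by intro h; simp [h] at hs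
  have hz : riemannZeta s ≠ 0 := riemannZeta_ne_zero_of_one_le_re hs.le
  have hev : xf =ᶠ[𝓝 s] fun z => (z - 1) * riemannZeta z := by
    filter_upwards [isOpen_ne.mem_nhds h1] with z hz
    exact xf_of_ne hz
  rw [logDeriv_apply, hev.deriv_eq, hev.eq_of_nhds, ← logDeriv_apply,
    logDeriv_mul (f := fun z => z - 1) s (sub_ne_zero.mpr h1) hz (by fun_prop) (differentiableAt_riemannZeta h1)]
  congr 1
  rw [logDeriv_apply]; simp

lemma norm_cexp3 (y : ℝ) : ‖cexp (-3 * y)‖ = rexp (-3 * y) := by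
  rw [Complex.norm_exp]; simp

lemma hasSum_congr_value {ι : Type*} {f : ι → ℂ} {a b : ℂ} (h : HasSum f a) (e : b = a) :
    HasSum f b := e ▸ h

lemma explicit_formula (hRH : RiemannHypothesis) {y : ℝ} (hy : 0 ≤ y) :
    Summable (fun n : ℕ => ArithmeticFunction.vonMangoldt n * max (y - Real.log n) 0) ∧
    HasSum (fun ρ : Zt => (mu ρ : ℂ) * qf ρ y)
      ((psi1 y : ℂ) - (rexp y - 1 : ℝ) - (-logDeriv xf 2 - 1) * y) := by
  set c0 : ℂ := -logDeriv xf 2 - 1 with hc0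
  set F : ℕ → ℝ → ℂ := fun n y => (ArithmeticFunction.vonMangoldt n : ℂ) *
    (((max (y - Real.log n) 0 : ℝ) : ℂ) * cexp (-3 * y)) with hF
  set G : Zt → ℝ → ℂ := fun ρ y => (mu ρ : ℂ) * (qf ρ y * cexp (-3 * y)) with hG
  have hBF : Summable (fun n : ℕ => ArithmeticFunction.vonMangoldt n * (n:ℝ) ^ (-(3/2):ℝ)) := by
    have h := (ArithmeticFunction.LSeriesSummable_vonMangoldt (s := ((3/2 : ℝ) : ℂ)) (by simp; norm_num)).norm
    refine h.congr fun n => ?_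
    rw [LSeries.term_def]
    split_ifs with hn
    · simp [hn]
    · rw [norm_div, Complex.norm_natCast_cpow_of_pos (by omega), Complex.norm_real,
        Real.norm_of_nonneg ArithmeticFunction.vonMangoldt_nonneg, Complex.ofReal_re,
        Real.rpow_neg (by positivity), div_eq_mul_inv]
  obtain ⟨sF, cF, iF, lF⟩ := lap (F := F) hBF
    (fun n => mul_nonneg ArithmeticFunction.vonMangoldt_nonneg (by positivity))
    (fun n => by simp only [hF]; fun_prop) (by
      intro n y hy
      simp only [hF]
      rw [norm_mul, norm_mul, norm_cexp3, Complex.norm_real, Complex.norm_real,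
        Real.norm_of_nonneg ArithmeticFunction.vonMangoldt_nonneg,
        Real.norm_of_nonneg (le_max_right _ _), mul_assoc]
      rcases Nat.eq_zero_or_pos n with rfl | hn
      · simp
      refine mul_le_mul_of_nonneg_left ?_ ArithmeticFunction.vonMangoldt_nonneg
      have hn' : (0:ℝ) < n := by exact_mod_cast hn
      rw [Real.rpow_def_of_pos hn']
      have h1 : max (y - Real.log n) 0 ≤ rexp (3/2 * (y - Real.log n)) := by
        refine max_le ?_ (Real.exp_pos _).le
        have := Real.add_one_le_exp (3/2 * (y - Real.log n))
        by_cases h : 0 ≤ y - Real.log n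
        · linarith
        · linarith [Real.exp_pos (3/2 * (y - Real.log n))]
      calc _ ≤ rexp (3/2 * (y - Real.log n)) * rexp (-3 * y) := by gcongr
        _ ≤ _ := by
          rw [← Real.exp_add, ← Real.exp_add]
          apply Real.exp_le_exp.mpr; linarith)
  obtain ⟨sG, cG, iG, lG⟩ := lap (F := G) ((summable_inv_sq hRH).mul_left 4)
    (fun n => by positivity)
    (fun n => by simp only [hG, qf]; fun_prop) (by
      intro ρ y hy
      simp only [hG]
      rw [norm_mul, norm_mul, norm_cexp3, Complex.norm_natCast]
      have h1 := qf_bound hRH ρ hy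
      calc (mu ρ:ℝ) * (‖qf ρ y‖ * rexp (-3 * y)) ≤ mu ρ * ((4 / ‖(ρ:ℂ)‖^2 * rexp y) * rexp (-3 * y)) := by gcongr
        _ = 4 * (mu ρ / ‖(ρ:ℂ)‖^2) * rexp (-2 * y) := by
          rw [mul_assoc (4 / _), ← Real.exp_add]; ring_nf
        _ ≤ _ := by gcongr; linarith)
  set f : ℝ → ℂ := fun y => (∑' n, F n y) - (cexp (-2 * y) - cexp (-3 * y)) - c0 * (y * cexp (-3 * y)) - ∑' ρ, G ρ y with hf
  have hi1 : IntegrableOn (fun y : ℝ => cexp (-2 * y)) (Ioi 0) := (lap_exp (by simp)).1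
  have hi2 : IntegrableOn (fun y : ℝ => cexp (-3 * y)) (Ioi 0) := (lap_exp (by simp)).1
  have hi3 : IntegrableOn (fun y : ℝ => y * cexp (-3 * y)) (Ioi 0) := by
    simpa using (lap_ramp (s := 3) (by simp) 0).1
  have hfz : ∀ y, 0 ≤ y → f y = 0 := by
    refine laplace_unique ?_ ?_ ?_ ?_
    · refine ((cF.sub ?_).sub ?_).sub cG
      · exact Continuous.continuousOn (by fun_prop)
      · exact Continuous.continuousOn (by fun_prop)
    · have h1 : ∀ n, F n 0 = 0 := by
        intro n
        have : max (0 - Real.log n) 0 = 0 := by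
          simp only [zero_sub, max_eq_right_iff, Left.neg_nonpos_iff]
          exact Real.log_natCast_nonneg n
        simp only [hF, this]; simp
      have h2 : ∀ ρ, G ρ 0 = 0 := by
        intro ρ; simp [hG, qf]
      simp [hf, h1, h2]
    · exact ((iF.sub (hi1.sub hi2)).sub (hi3.const_mul _)).sub iG
    · intro t
      set s : ℂ := 3 + t * I with hs
      have hsre : s.re = 3 := by simp [hs]
      have hs0 : s ≠ 0 := by intro h; simp [h] at hsre
      have hs1 : s - 1 ≠ 0 := by intro h; rw [sub_eq_zero] at h; simp [h] at hsre
      have hE : ∀ a : ℂ, ∀ y : ℝ, cexp (-a * y) * cexp (-(t * y) * I) = cexp (-(a + t * I) * y) := by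
        intro a y; rw [← Complex.exp_add]; congr 1; ring
      have hE3 : ∀ y : ℝ, cexp (-3 * y) * cexp (-(t * y) * I) = cexp (-s * y) := fun y => hE 3 y
      have hitg : ∀ g : ℝ → ℂ, IntegrableOn g (Ioi 0) →
          IntegrableOn (fun y : ℝ => g y * cexp (-(t * y) * I)) (Ioi 0) := by
        intro g hg
        refine Integrable.mul_bdd (c := 1) hg ?_ ?_
        · exact (by fun_prop : Continuous (fun y : ℝ => cexp (-(t * y) * I))).aestronglyMeasurable
        · refine Eventually.of_forall fun y => ?_
          rw [show (-(t * y) * I : ℂ) = ((-(t*y) : ℝ) : ℂ) * I by push_cast; ring]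
          exact (Complex.norm_exp_ofReal_mul_I _).le
      have v1 : ∫ y in Ioi (0:ℝ), (∑' n, F n y) * cexp (-(t * y) * I) =
          (-deriv riemannZeta s / riemannZeta s) / s^2 := by
        refine (lF t).unique ?_
        rw [← ArithmeticFunction.LSeries_vonMangoldt_eq_deriv_riemannZeta_div (by rw [hsre]; norm_num)]
        have h := (ArithmeticFunction.LSeriesSummable_vonMangoldt (s := s) (by rw [hsre]; norm_num)).hasSum
        refine (h.div_const (s^2)).congr_fun fun n => ?_
        rw [LSeries.term_def]
        split_ifs with hn
        · simp [hF, hn]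
        · have hn' : (n:ℂ) ≠ 0 := by exact_mod_cast hn
          have h3 := lap_max (s := s) (by rw [hsre]; norm_num) (Real.log_natCast_nonneg n)
          simp only [hF]
          simp_rw [mul_assoc, hE3]
          rw [integral_const_mul, h3, Complex.cpow_def_of_ne_zero hn', div_eq_mul_inv (_ : ℂ) (cexp _),
            ← Complex.exp_neg, Complex.ofReal_log (by positivity), Complex.ofReal_natCast]
          rw [show -s * Complex.log n = -(Complex.log n * s) by ring]
          ring
      have v2 : ∫ y in Ioi (0:ℝ), (∑' ρ, G ρ y) * cexp (-(t * y) * I) =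
          -(logDeriv xf s - logDeriv xf 2) / s^2 := by
        refine (lG t).unique ?_
        have hxs : xf s ≠ 0 := by
          intro h0
          have := zero_re_lt h0
          rw [hsre] at this; norm_num at this
        refine ((hadamard hxs).neg.div_const (s^2)).congr_fun fun ρ => ?_
        simp only [hG]
        simp_rw [mul_assoc, hE3]
        have h1 := Zt_norm hRH ρ
        have h2 := Zt_re hRH ρ
        rw [integral_const_mul, lap_qf (norm_pos_iff.mp (by linarith)) (by rw [hsre]; norm_num)
          (by simp only [Complex.sub_re, hsre]; linarith)]
        ring
      have v3 : ∫ y in Ioi (0:ℝ), (y * cexp (-3 * y)) * cexp (-(t * y) * I) = 1 / s^2 := by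
        simp_rw [mul_assoc, hE3]
        simpa using (lap_ramp (s := s) (by rw [hsre]; norm_num) 0).2
      have v4 : ∫ y in Ioi (0:ℝ), cexp (-3 * y) * cexp (-(t * y) * I) = 1 / s := by
        simp_rw [hE3]
        exact (lap_exp (by rw [hsre]; norm_num)).2
      have v5 : ∫ y in Ioi (0:ℝ), cexp (-2 * y) * cexp (-(t * y) * I) = 1 / (s - 1) := by
        simp_rw [hE 2]
        rw [(lap_exp (by simp)).2, hs]; congr 1; ring
      have e : ∀ y : ℝ, f y * cexp (-(t * y) * I) = (∑' n, F n y) * cexp (-(t * y) * I)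
          - (cexp (-2 * y) * cexp (-(t * y) * I) - cexp (-3 * y) * cexp (-(t * y) * I))
          - c0 * ((y * cexp (-3 * y)) * cexp (-(t * y) * I)) - (∑' ρ, G ρ y) * cexp (-(t * y) * I) := by
        intro y; simp only [hf]; ring
      simp_rw [e]
      have j1 := hitg _ iF
      have j2 := hitg _ iG
      have j3 := hitg _ hi1
      have j4 := hitg _ hi2
      have j5 := hitg _ hi3
      rw [integral_sub ((j1.fun_sub (j3.fun_sub j4)).fun_sub (j5.const_mul _)) j2,
        integral_sub (j1.fun_sub (j3.fun_sub j4)) (j5.const_mul _), integral_sub j1 (j3.fun_sub j4),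
        integral_sub j3 j4, integral_const_mul, v1, v2, v3, v4, v5, hc0,
        logDeriv_xf_eq (s := s) (by rw [hsre]; norm_num)]
      rw [neg_div]
      generalize deriv riemannZeta s / riemannZeta s = w
      field_simp
      ring
  have hfy := hfz y hy
  have hne : cexp (-3 * y) ≠ 0 := Complex.exp_ne_zero _
  have hinv : ∀ z : ℂ, z * cexp (-3 * y) * cexp (3 * y) = z := by
    intro z; rw [mul_assoc, ← Complex.exp_add]; simp
  have hsF := (sF y hy).mul_right (cexp (3 * y))
  have hsG := (sG y hy).mul_right (cexp (3 * y))
  have eF : ∀ n, F n y * cexp (3 * y) =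
      ((ArithmeticFunction.vonMangoldt n * max (y - Real.log n) 0 : ℝ) : ℂ) := by
    intro n; simp only [hF]; rw [← mul_assoc, hinv]; push_cast; rfl
  have eG : ∀ ρ, G ρ y * cexp (3 * y) = (mu ρ : ℂ) * qf ρ y := by
    intro n; simp only [hG]; rw [← mul_assoc, hinv]
  simp_rw [eF] at hsF
  simp_rw [eG] at hsG
  refine ⟨Complex.summable_ofReal.mp hsF, ?_⟩
  have e2 : f y * cexp (3 * y) = 0 := by rw [hfy, zero_mul]
  have e3 : (psi1 y : ℂ) = (∑' n, F n y) * cexp (3 * y) := by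
    rw [← tsum_mul_right]; simp_rw [eF]; rw [psi1, Complex.ofReal_tsum]
  have e4 : ∑' ρ : Zt, (mu ρ : ℂ) * qf ρ y = (∑' ρ, G ρ y) * cexp (3 * y) := by
    rw [← tsum_mul_right]; simp_rw [eG]
  refine (hasSum_congr_value hsG.hasSum ?_)
  rw [e3, e4]
  have e5 : cexp (-2 * y) * cexp (3 * y) = cexp y := by
    rw [← Complex.exp_add]; congr 1; ring
  have e6 : cexp (-3 * y) * cexp (3 * y) = 1 := by
    rw [← Complex.exp_add]; simp
  simp only [hf] at e2
  push_cast
  linear_combination e2 + e5 - e6 + c0 * y * e6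

end
end GM

open Complex Filter MeasureTheory Real Set
open scoped Topology
namespace GM
noncomputable section

lemma plancherel {f : ℝ → ℂ} (hc : Continuous f) (hi : Integrable f)
    (hF : Integrable (FourierTransform.fourier f)) :
    ∫ w, ‖FourierTransform.fourier f w‖ ^ 2 = ∫ y, ‖f y‖ ^ 2 := by
  set g : ℝ → ℂ := fun w => (starRingEnd ℂ) (FourierTransform.fourier f w) with hg
  have hgi : Integrable g := (Complex.conjCLE.toContinuousLinearMap.integrable_comp hF)
  have hFg : ∀ y, FourierTransform.fourier g y = (starRingEnd ℂ) (f y) := by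
    intro y
    have h := hi.fourierInv_fourier_eq hF (hc.continuousAt (x := y))
    rw [← h, Real.fourierInv_eq', Real.fourier_eq', ← integral_conj]
    congr 1
    ext v
    simp only [hg, smul_eq_mul, map_mul, ← Complex.exp_conj, Complex.conj_ofReal, Complex.conj_I]
    congr 2
    push_cast; ring
  have h1 : ∫ w, FourierTransform.fourier f w * g w = ∫ y, f y * FourierTransform.fourier g y :=
    by simpa using! (VectorFourier.integral_fourierIntegral_smul_eq_flip (L := innerₗ ℝ)
      Real.continuous_fourierChar continuous_inner hi hgi)
  have e1 : ∀ w, FourierTransform.fourier f w * g w = ((‖FourierTransform.fourier f w‖ ^ 2 : ℝ) : ℂ) := by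
    intro w; simp only [hg]; rw [Complex.mul_conj, Complex.normSq_eq_norm_sq]
  have e2 : ∀ y, f y * FourierTransform.fourier g y = ((‖f y‖ ^ 2 : ℝ) : ℂ) := by
    intro y; rw [hFg, Complex.mul_conj, Complex.normSq_eq_norm_sq]
  rw [integral_congr_ae (Eventually.of_forall e1), integral_congr_ae (Eventually.of_forall e2),
    integral_complex_ofReal, integral_complex_ofReal] at h1
  exact_mod_cast h1

lemma exp_abs_integrable {a : ℝ} (ha : 0 < a) : Integrable (fun y : ℝ => rexp (-(a * |y|))) := by
  rw [← integrableOn_univ, ← Iic_union_Ioi (a := (0:ℝ))]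
  refine IntegrableOn.union ?_ ?_
  · have := integrableOn_exp_mul_Iic (a := a) ha 0
    refine this.congr_fun (fun y hy => ?_) measurableSet_Iic
    simp only [abs_of_nonpos (mem_Iic.mp hy)]; congr 1; ring
  · have := integrableOn_exp_mul_Ioi (a := -a) (by linarith) 0
    refine this.congr_fun (fun y hy => ?_) measurableSet_Ioi
    simp only [abs_of_pos (mem_Ioi.mp hy)]; congr 1; ring

lemma ft_exp_abs {a : ℝ} (ha : 0 < a) (u : ℝ) :
    ∫ y : ℝ, (rexp (-(a * |y|)) : ℂ) * cexp (I * u * y) = ((2 * a / (a^2 + u^2) : ℝ) : ℂ) := by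
  have hitg : Integrable (fun y : ℝ => (rexp (-(a * |y|)) : ℂ) * cexp (I * u * y)) := by
    refine Integrable.mul_bdd (c := 1) (exp_abs_integrable ha).ofReal ?_ ?_
    · exact (by fun_prop : Continuous (fun y : ℝ => cexp (I * u * y))).aestronglyMeasurable
    · refine Eventually.of_forall fun y => ?_
      rw [show (I * u * y : ℂ) = ((u*y : ℝ) : ℂ) * I by push_cast; ring]
      exact (Complex.norm_exp_ofReal_mul_I _).le
  rw [← intervalIntegral.integral_Iic_add_Ioi (b := 0) hitg.integrableOn hitg.integrableOn,
    ← neg_zero, ← integral_comp_neg_Ioi, neg_zero]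
  have h1 : ∫ y in Ioi (0:ℝ), (rexp (-(a * |y|)) : ℂ) * cexp (I * u * y) = 1 / (a - I * u) := by
    rw [← (lap_exp (z := a - I * u) (by simpa using ha)).2]
    refine setIntegral_congr_fun measurableSet_Ioi fun y hy => ?_
    simp only [abs_of_pos (mem_Ioi.mp hy)]
    rw [Complex.ofReal_exp, ← Complex.exp_add]; congr 1; push_cast; ring
  have h2 : ∫ y in Ioi (0:ℝ), (rexp (-(a * |-y|)) : ℂ) * cexp (I * u * (-y : ℝ)) = 1 / (a + I * u) := by
    rw [← (lap_exp (z := a + I * u) (by simpa using ha)).2]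
    refine setIntegral_congr_fun measurableSet_Ioi fun y hy => ?_
    simp only [abs_neg, abs_of_pos (mem_Ioi.mp hy)]
    rw [Complex.ofReal_exp, ← Complex.exp_add]; congr 1; push_cast; ring
  rw [h1, h2]
  have n1 : (a:ℂ) - I * u ≠ 0 := by intro h; have := congrArg Complex.re h; simp at this; exact ha.ne' this
  have n2 : (a:ℂ) + I * u ≠ 0 := by intro h; have := congrArg Complex.re h; simp at this; exact ha.ne' this
  have n3 : ((a:ℂ)^2 + (u:ℂ)^2) ≠ 0 := by
    have : (a^2 + u^2 : ℝ) ≠ 0 := by positivity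
    exact_mod_cast this
  push_cast
  rw [div_add_div _ _ n2 n1, div_eq_div_iff (mul_ne_zero n2 n1) n3]
  linear_combination (2 * a * u^2 : ℂ) * I_sq

lemma lorentz_integrable (a : ℝ) : Integrable (fun t : ℝ => 1 / (1 + (t - a)^2)) := by
  have := (integrable_inv_one_add_sq).comp_sub_right a
  simpa [one_div] using this

lemma integrable_tsum {ι : Type*} [Countable ι] {F : ι → ℝ → ℂ} (hi : ∀ i, Integrable (F i))
    (hs : Summable (fun i => ∫ t, ‖F i t‖)) : Integrable (fun t => ∑' i, F i t) := by
  have h1 : ∫⁻ t, ∑' i, ‖F i t‖ₑ ≠ ⊤ := by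
    rw [lintegral_tsum (fun i => (hi i).1.enorm)]
    have : ∀ i, ∫⁻ a, ‖F i a‖ₑ = ‖∫ a, ‖F i a‖‖ₑ := by
      intro i
      dsimp [enorm]
      rw [lintegral_coe_eq_integral _ (hi i).norm, ENNReal.coe_nnreal_eq, coe_nnnorm,
        Real.norm_of_nonneg (integral_nonneg (fun a ↦ norm_nonneg (F i a)))]
      simp only [coe_nnnorm]
    rw [funext this]
    exact ENNReal.tsum_coe_ne_top_iff_summable.2 <| NNReal.summable_coe.1 hs.abs
  refine ⟨?_, ?_⟩
  · have hae : ∀ᵐ t, Summable (fun i => F i t) := by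
      have h2 := ae_lt_top' (AEMeasurable.tsum (fun i => (hi i).1.enorm)) h1
      filter_upwards [h2] with t ht
      refine Summable.of_norm ?_
      have := (ENNReal.tsum_coe_ne_top_iff_summable (f := fun i => ‖F i t‖₊)).1 ht.ne
      exact NNReal.summable_coe.2 this
    obtain hfin | hinf := finite_or_infinite ι
    · have := Fintype.ofFinite ι
      simp_rw [tsum_fintype]
      exact Finset.aestronglyMeasurable_fun_sum _ fun i _ => (hi i).1
    · have ⟨e⟩ := nonempty_equiv_of_countable (α := ℕ) (β := ι)
      refine aestronglyMeasurable_of_tendsto_ae (u := atTop) (f := fun (n : ℕ) t => ∑ k ∈ Finset.range n, F (e k) t) ?_ ?_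
      · intro n
        exact Finset.aestronglyMeasurable_fun_sum _ fun i _ => (hi _).1
      · filter_upwards [hae] with t ht
        have h3 := (e.hasSum_iff.mpr ht.hasSum).tendsto_sum_nat
        exact h3
  · refine lt_of_le_of_lt (lintegral_mono fun t => ?_) (lt_top_iff_ne_top.mpr h1)
    exact enorm_tsum_le_tsum_enorm

lemma parseval {ι : Type*} [Countable ι] (c : ι → ℂ) (γ : ι → ℝ) (hc : Summable (fun i => ‖c i‖)) :
    ∫ y : ℝ, rexp (-(2 * |y|)) * ‖∑' i, c i * cexp (I * γ i * y)‖ ^ 2 =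
      2 / π * ∫ t : ℝ, ‖∑' i, c i / ((1 + (t - γ i)^2 : ℝ) : ℂ)‖ ^ 2 := by
  have hn : ∀ (i : ι) (y : ℝ), ‖c i * cexp (I * γ i * y)‖ = ‖c i‖ := by
    intro i y
    rw [norm_mul, show (I * γ i * y : ℂ) = ((γ i *y : ℝ) : ℂ) * I by push_cast; ring,
      Complex.norm_exp_ofReal_mul_I, mul_one]
  have hPc : Continuous (fun y : ℝ => ∑' i, c i * cexp (I * γ i * y)) :=
    continuous_tsum (fun i => by fun_prop) hc (fun i y => (hn i y).le)
  set f : ℝ → ℂ := fun y => (rexp (-(1 * |y|)) : ℂ) * ∑' i, c i * cexp (I * γ i * y) with hf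
  have hfc : Continuous f := by
    refine Continuous.mul ?_ hPc
    fun_prop
  have hfi : Integrable f := by
    refine Integrable.mul_bdd (c := ∑' i, ‖c i‖) (exp_abs_integrable one_pos).ofReal hPc.aestronglyMeasurable ?_
    refine Eventually.of_forall fun y => ?_
    exact tsum_of_norm_bounded hc.hasSum (fun i => (hn i y).le)
  have hFf : ∀ w : ℝ, FourierTransform.fourier f w = 2 * ∑' i, c i / ((1 + (2 * π * w - γ i)^2 : ℝ) : ℂ) := by
    intro w
    rw [Real.fourier_real_eq_integral_exp_smul]
    have e1 : ∀ y : ℝ, cexp (((-2 * π * y * w : ℝ) : ℂ) * I) • f y =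
        ∑' i, (c i * ((rexp (-(1 * |y|)) : ℂ) * cexp (I * ((γ i - 2 * π * w : ℝ) : ℂ) * y))) := by
      intro y
      simp only [hf, smul_eq_mul]
      rw [← tsum_mul_left, ← tsum_mul_left]
      congr 1; ext i
      rw [show I * ((γ i - 2 * π * w : ℝ) : ℂ) * y = ((-2 * π * y * w : ℝ) : ℂ) * I + I * γ i * y by
        push_cast; ring, Complex.exp_add]
      ring
    simp_rw [e1]
    have hs := hasSum_integral_of_summable_integral_norm (μ := volume)
      (F := fun i (y : ℝ) => (c i * ((rexp (-(1 * |y|)) : ℂ) * cexp (I * ((γ i - 2 * π * w : ℝ) : ℂ) * y))))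
      (fun i => by
        refine Integrable.const_mul ?_ _
        refine Integrable.mul_bdd (c := 1) (exp_abs_integrable one_pos).ofReal ?_ ?_
        · exact (by fun_prop : Continuous (fun y : ℝ => cexp (I * ((γ i - 2 * π * w : ℝ) : ℂ) * y))).aestronglyMeasurable
        · refine Eventually.of_forall fun y => ?_
          rw [show (I * ((γ i - 2 * π * w : ℝ) : ℂ) * y : ℂ) = (((γ i - 2 * π * w)*y : ℝ) : ℂ) * I by push_cast; ring]
          exact (Complex.norm_exp_ofReal_mul_I _).le)
      (by
        have : ∀ i, ∫ y : ℝ, ‖(c i * ((rexp (-(1 * |y|)) : ℂ) * cexp (I * ((γ i - 2 * π * w : ℝ) : ℂ) * y)))‖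
            = ‖c i‖ * ∫ y : ℝ, rexp (-(1 * |y|)) := by
          intro i
          rw [← integral_const_mul]
          congr 1; ext y
          rw [norm_mul, norm_mul, show (I * ((γ i - 2 * π * w : ℝ) : ℂ) * y : ℂ) = (((γ i - 2 * π * w)*y : ℝ) : ℂ) * I by push_cast; ring,
            Complex.norm_exp_ofReal_mul_I, mul_one, Complex.norm_real, Real.norm_of_nonneg (Real.exp_pos _).le]
        simp_rw [this]
        exact hc.mul_right _)
    rw [← hs.tsum_eq, ← tsum_mul_left]
    congr 1; ext i
    rw [integral_const_mul, ft_exp_abs one_pos]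
    push_cast
    rw [show (2 * (π:ℂ) * w - γ i)^2 = (γ i - 2 * π * w)^2 by ring]
    ring
  set L : ℝ → ℂ := fun t => ∑' i, c i / ((1 + (t - γ i)^2 : ℝ) : ℂ) with hL
  have hLi : Integrable L := by
    have hi : ∀ i, Integrable (fun t : ℝ => c i / ((1 + (t - γ i)^2 : ℝ) : ℂ)) := by
      intro i
      have := ((lorentz_integrable (γ i)).ofReal (𝕜 := ℂ)).const_mul (c i)
      refine this.congr (Eventually.of_forall fun t => ?_)
      change c i * ((1 / (1 + (t - γ i)^2) : ℝ) : ℂ) = _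
      push_cast; ring
    have hnn : ∀ i, ∫ t : ℝ, ‖c i / ((1 + (t - γ i)^2 : ℝ) : ℂ)‖ = ‖c i‖ * π := by
      intro i
      have : ∀ t : ℝ, ‖c i / ((1 + (t - γ i)^2 : ℝ) : ℂ)‖ = ‖c i‖ * (1 + (t - γ i)^2)⁻¹ := by
        intro t
        rw [norm_div, Complex.norm_real, Real.norm_of_nonneg (by positivity), div_eq_mul_inv]
      simp_rw [this]
      rw [integral_const_mul, integral_sub_right_eq_self (fun t : ℝ => (1 + t^2)⁻¹) (γ i),
        integral_univ_inv_one_add_sq]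
    exact integrable_tsum hi (by simp_rw [hnn]; exact hc.mul_right _)
  have h := plancherel hfc hfi (by
    have e : FourierTransform.fourier f = fun w => 2 * L (2 * π * w) := by ext w; exact hFf w
    rw [e]
    exact (hLi.comp_mul_left' (by positivity)).const_mul 2)
  simp_rw [hFf] at h
  have e1 : ∀ y, ‖f y‖^2 = rexp (-(2 * |y|)) * ‖∑' i, c i * cexp (I * γ i * y)‖ ^ 2 := by
    intro y
    simp only [hf]
    rw [norm_mul, mul_pow, Complex.norm_real, Real.norm_of_nonneg (Real.exp_pos _).le, ← Real.exp_nat_mul]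
    congr 2; push_cast; ring
  simp_rw [e1] at h
  rw [← h]
  have e2 : ∀ w : ℝ, ‖2 * L (2 * π * w)‖^2 = 4 * (fun t => ‖L t‖^2) (2 * π * w) := by
    intro w; rw [norm_mul, mul_pow]; norm_num
  change ∫ w : ℝ, ‖2 * L (2 * π * w)‖^2 = _
  rw [integral_congr_ae (Eventually.of_forall e2)]
  rw [integral_const_mul, Measure.integral_comp_mul_left (fun t => ‖L t‖^2), abs_of_pos (by positivity), smul_eq_mul]
  field_simp
  ring

end
end GM

open Complex Filter MeasureTheory Real Set
open scoped Topology
namespace GM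
noncomputable section

def avs (σ h t : ℝ) : ℂ := ∫ v in (0:ℝ)..h, cexp ((σ + t * I) * v)

lemma avs_eq {σ h t : ℝ} (hz : (σ + t * I : ℂ) ≠ 0) :
    avs σ h t = (cexp ((σ + t * I) * h) - 1) / (σ + t * I) := by
  unfold avs
  rw [integral_exp_mul_complex hz]; simp

lemma norm_cexp_line (σ t v : ℝ) : ‖cexp ((σ + t * I) * v)‖ = rexp (σ * v) := by
  rw [Complex.norm_exp]; simp

lemma exp_half_le {σ v : ℝ} (h0 : 0 ≤ σ) (h1 : σ ≤ 1/2) (hv : 0 ≤ v) (hv1 : v ≤ 1) :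
    rexp (σ * v) ≤ 1 + v ∧ 1 ≤ rexp (σ * v) := by
  refine ⟨?_, Real.one_le_exp (by positivity)⟩
  have h2 : σ * v ≤ v / 2 := by nlinarith
  have h3 : v / 2 ≤ Real.log (1 + v) := by
    have := Real.one_sub_inv_le_log_of_pos (show 0 < 1 + v by linarith)
    refine le_trans ?_ this
    have : (1 + v)⁻¹ ≤ 1 - v/2 := by
      rw [inv_le_iff_one_le_mul₀ (by linarith)]; nlinarith
    linarith
  calc rexp (σ * v) ≤ rexp (Real.log (1 + v)) := Real.exp_le_exp.mpr (by linarith)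
    _ = 1 + v := Real.exp_log (by linarith)

lemma avs_le_two {σ h t : ℝ} (h0 : 0 ≤ σ) (h1 : σ ≤ 1/2) (hh : 0 < h) (hh1 : h ≤ 1) :
    ‖avs σ h t‖ ≤ 2 * h := by
  have := intervalIntegral.norm_integral_le_of_norm_le_const (a := 0) (b := h) (C := 2)
    (f := fun v : ℝ => cexp ((σ + t * I) * v)) (by
      intro v hv
      rw [uIoc_of_le hh.le] at hv
      rw [norm_cexp_line]
      have := (exp_half_le h0 h1 hv.1.le (by linarith [hv.2])).1
      linarith [hv.2])
  simpa [avs, abs_of_pos hh] using this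

lemma avs_le {σ h t : ℝ} (h0 : 0 ≤ σ) (h1 : σ ≤ 1/2) (hh : 0 < h) (hh1 : h ≤ 1) :
    ‖avs σ h t‖ ≤ 5 * h / (1 + h * |t|) := by
  have h2 := avs_le_two (t := t) h0 h1 hh hh1
  rw [le_div_iff₀ (by positivity)]
  have h3 : ‖avs σ h t‖ * |t| ≤ 3 := by
    by_cases ht : t = 0
    · simp [ht]
    have hz : (σ + t * I : ℂ) ≠ 0 := by
      intro h; have := congrArg Complex.im h; simp at this; exact ht this
    rw [avs_eq hz, norm_div]
    have h4 : |t| ≤ ‖(σ + t * I : ℂ)‖ := by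
      have := Complex.abs_im_le_norm (σ + t * I : ℂ); simpa using this
    have h5 : ‖cexp ((σ + t * I) * h) - 1‖ ≤ 3 := by
      refine (norm_sub_le _ _).trans ?_
      rw [norm_cexp_line]
      have := (exp_half_le h0 h1 hh.le hh1).1
      simp; linarith
    have h6 : 0 < ‖(σ + t * I : ℂ)‖ := norm_pos_iff.mpr hz
    rw [div_mul_eq_mul_div, div_le_iff₀ h6]
    have := norm_nonneg (cexp ((σ + t * I) * h) - 1)
    nlinarith [abs_nonneg t]
  nlinarith

lemma avs_sub_le {σ h s t : ℝ} (h0 : 0 ≤ σ) (h1 : σ ≤ 1/2) (hh : 0 < h) (hh1 : h ≤ 1) :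
    ‖avs σ h s - avs 0 h t‖ ≤ 2 * h^2 * (1 + |t - s|) := by
  unfold avs
  rw [← intervalIntegral.integral_sub (Continuous.intervalIntegrable (by fun_prop) _ _)
    (Continuous.intervalIntegrable (by fun_prop) _ _)]
  have := intervalIntegral.norm_integral_le_of_norm_le_const (a := 0) (b := h)
    (C := 2 * h * (1 + |t - s|))
    (f := fun v : ℝ => cexp ((σ + s * I) * v) - cexp (((0:ℝ) + t * I) * v)) (by
      intro v hv
      rw [uIoc_of_le hh.le] at hv
      have hv1 : v ≤ 1 := by linarith [hv.2]
      obtain ⟨b1, b2⟩ := exp_half_le h0 h1 hv.1.le hv1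
      have e : cexp ((σ + s * I) * v) - cexp (((0:ℝ) + t * I) * v) =
          ((rexp (σ * v) - 1 : ℝ) : ℂ) * cexp (I * ((s * v : ℝ) : ℂ)) +
            (cexp (I * ((s * v : ℝ) : ℂ)) - cexp (I * ((t * v : ℝ) : ℂ))) := by
        rw [show (σ + s * I) * v = ((σ * v : ℝ) : ℂ) + I * ((s * v : ℝ) : ℂ) by push_cast; ring,
          Complex.exp_add, show ((0:ℝ) + t * I) * v = I * ((t * v : ℝ) : ℂ) by push_cast; ring]
        push_cast; ring
      rw [e]
      refine (norm_add_le _ _).trans ?_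
      have n1 : ‖((rexp (σ * v) - 1 : ℝ) : ℂ) * cexp (I * ((s * v : ℝ) : ℂ))‖ ≤ v := by
        rw [norm_mul, mul_comm I, Complex.norm_exp_ofReal_mul_I, mul_one, Complex.norm_real,
          Real.norm_of_nonneg (by linarith)]
        linarith
      have n2 : ‖cexp (I * ((s * v : ℝ) : ℂ)) - cexp (I * ((t * v : ℝ) : ℂ))‖ ≤ |t - s| * v := by
        have e2 : cexp (I * ((s * v : ℝ) : ℂ)) - cexp (I * ((t * v : ℝ) : ℂ)) =
          cexp (((t * v : ℝ) : ℂ) * I) * (cexp (I * ((s * v - t * v : ℝ) : ℂ)) - 1) := by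
          rw [mul_sub, ← Complex.exp_add]; congr 2
          · push_cast; ring
          · ring
        rw [e2, norm_mul, Complex.norm_exp_ofReal_mul_I, one_mul]
        refine (Real.norm_exp_I_mul_ofReal_sub_one_le).trans ?_
        rw [← sub_mul, norm_mul, Real.norm_of_nonneg hv.1.le, Real.norm_eq_abs, abs_sub_comm]
      have hu := abs_nonneg (t - s)
      nlinarith [hv.2, hv.1])
  rw [sub_zero, abs_of_pos hh] at this
  refine this.trans (le_of_eq (by ring))

lemma interp {d a b : ℝ} (hd : 0 ≤ d) (ha : d ≤ a) (hb : d ≤ b) :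
    d ≤ a ^ (1/4:ℝ) * b ^ (3/4:ℝ) := by
  calc d = d ^ (1/4:ℝ) * d ^ (3/4:ℝ) := by
        rw [← Real.rpow_add_of_nonneg hd (by norm_num) (by norm_num)]; norm_num
    _ ≤ _ := by
        have := hd.trans ha
        gcongr

/-- Weight `(1+h|t|)^{-3/4}`. -/
def wt (h t : ℝ) : ℝ := (1 + h * |t|) ^ (-(3/4) : ℝ)

lemma wt_pos {h t : ℝ} (hh : 0 < h) : 0 < wt h t := by unfold wt; positivity

lemma one_add_mul_le {h s t : ℝ} (hh : 0 < h) : 1 + h * |t| ≤ (1 + h * |s|) * (1 + h * |t - s|) := by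
  have h1 : |t| ≤ |s| + |t - s| := by
    have := abs_add_le s (t - s); simpa using this
  have := abs_nonneg s
  have := abs_nonneg (t - s)
  nlinarith [mul_nonneg (mul_nonneg hh.le (abs_nonneg s)) (mul_nonneg hh.le (abs_nonneg (t - s)))]

lemma inv_le_wt {h t : ℝ} (hh : 0 < h) : 1 / (1 + h * |t|) ≤ wt h t := by
  unfold wt
  have h1 : 1 ≤ 1 + h * |t| := by have := abs_nonneg t; nlinarith
  rw [one_div, ← Real.rpow_neg_one]
  exact Real.rpow_le_rpow_of_exponent_le h1 (by norm_num)

lemma wt_shift {h s t : ℝ} (hh : 0 < h) : wt h s ≤ wt h t * (1 + h * |t - s|) ^ (3/4:ℝ) := by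
  have h1 := one_add_mul_le (s := s) (t := t) hh
  have p1 : 0 < 1 + h * |t| := by positivity
  have p2 : 0 < 1 + h * |s| := by positivity
  have p3 : 0 < 1 + h * |t - s| := by positivity
  unfold wt
  rw [Real.rpow_neg p1.le, Real.rpow_neg p2.le, inv_mul_eq_div, le_div_iff₀ (by positivity),
    inv_mul_eq_div, div_le_iff₀ (by positivity), ← Real.mul_rpow p3.le p2.le]
  apply Real.rpow_le_rpow p1.le (by linarith) (by norm_num)

lemma avs_wt {σ h s t : ℝ} (h0 : 0 ≤ σ) (h1 : σ ≤ 1/2) (hh : 0 < h) (hh1 : h ≤ 1) :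
    ‖avs σ h s‖ ≤ 5 * h * wt h t * (1 + |t - s|) ^ (3/4:ℝ) := by
  calc ‖avs σ h s‖ ≤ 5 * h / (1 + h * |s|) := avs_le h0 h1 hh hh1
    _ = 5 * h * (1 / (1 + h * |s|)) := by ring
    _ ≤ 5 * h * (wt h t * (1 + h * |t - s|) ^ (3/4:ℝ)) := by
      gcongr
      exact (inv_le_wt hh).trans (wt_shift hh)
    _ ≤ 5 * h * (wt h t * (1 + |t - s|) ^ (3/4:ℝ)) := by
      have := (wt_pos (t := t) hh).le
      gcongr
      have := abs_nonneg (t - s)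
      nlinarith
    _ = _ := by ring

lemma avs_diff_wt {σ h s t : ℝ} (h0 : 0 ≤ σ) (h1 : σ ≤ 1/2) (hh : 0 < h) (hh1 : h ≤ 1) :
    ‖avs σ h s - avs 0 h t‖ ≤ 40 * h ^ (5/4:ℝ) * wt h t * (1 + |t - s|) ^ (3/4:ℝ) := by
  set u := |t - s| with hu
  have hu0 : 0 ≤ u := abs_nonneg _
  have hw := (wt_pos (t := t) hh).le
  have hh54 : h ^ (5/4:ℝ) = h * h ^ (1/4:ℝ) := by
    rw [show (5/4:ℝ) = 1 + 1/4 by norm_num, Real.rpow_add hh, Real.rpow_one]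
  have hb1 : ‖avs σ h s - avs 0 h t‖ ≤ 5 * h / (1 + h * |s|) + 5 * h / (1 + h * |t|) :=
    (norm_sub_le _ _).trans (add_le_add (avs_le h0 h1 hh hh1) (avs_le le_rfl (by norm_num) hh hh1))
  by_cases hz : 1 ≤ h * u
  · have h2 : 5 * h / (1 + h * |s|) + 5 * h / (1 + h * |t|) ≤ 10 * h * (wt h t * (1 + h * u) ^ (3/4:ℝ)) := by
      have a1 : 1 / (1 + h * |s|) ≤ wt h t * (1 + h * u) ^ (3/4:ℝ) := (inv_le_wt hh).trans (wt_shift hh)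
      have a2 : 1 / (1 + h * |t|) ≤ wt h t * (1 + h * u) ^ (3/4:ℝ) := by
        refine (inv_le_wt hh).trans (le_mul_of_one_le_right hw ?_)
        apply Real.one_le_rpow (by nlinarith) (by norm_num)
      have e : 5 * h / (1 + h * |s|) + 5 * h / (1 + h * |t|) = 5 * h * (1 / (1 + h * |s|) + 1 / (1 + h * |t|)) := by ring
      rw [e]
      nlinarith
    have h3 : (1 + h * u) ^ (3/4:ℝ) ≤ 2 * (h ^ (1/4:ℝ) * (1 + u) ^ (3/4:ℝ)) := by
      calc (1 + h * u) ^ (3/4:ℝ) ≤ (2 * (h * (1 + u))) ^ (3/4:ℝ) := by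
            gcongr; nlinarith
        _ = 2 ^ (3/4:ℝ) * (h ^ (3/4:ℝ) * (1 + u) ^ (3/4:ℝ)) := by
            rw [Real.mul_rpow (by norm_num) (by positivity), Real.mul_rpow hh.le (by positivity)]
        _ ≤ 2 * (h ^ (1/4:ℝ) * (1 + u) ^ (3/4:ℝ)) := by
            gcongr ?_ * (?_ * _)
            · exact Real.rpow_le_self_of_one_le (by norm_num) (by norm_num)
            · exact Real.rpow_le_rpow_of_exponent_ge hh hh1 (by norm_num)
    rw [hh54]
    calc _ ≤ 10 * h * (wt h t * (1 + h * u) ^ (3/4:ℝ)) := hb1.trans h2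
      _ ≤ 10 * h * (wt h t * (2 * (h ^ (1/4:ℝ) * (1 + u) ^ (3/4:ℝ)))) := by gcongr
      _ = 20 * (h * h ^ (1/4:ℝ) * wt h t * (1 + u) ^ (3/4:ℝ)) := by ring
      _ ≤ 40 * (h * h ^ (1/4:ℝ) * wt h t * (1 + u) ^ (3/4:ℝ)) := by gcongr; norm_num
      _ = _ := by ring
  · push Not at hz
    have p2 : 0 < 1 + h * |s| := by positivity
    have h2 : ‖avs σ h s - avs 0 h t‖ ≤ 20 * h * (1 / (1 + h * |t|)) := by
      have := one_add_mul_le (s := s) (t := t) hh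
      have h3 : 1 / (1 + h * |s|) ≤ 2 * (1 / (1 + h * |t|)) := by
        rw [mul_one_div, div_le_div_iff₀ p2 (by positivity)]
        nlinarith
      have e : 5 * h / (1 + h * |s|) + 5 * h / (1 + h * |t|) = 5 * h * (1 / (1 + h * |s|) + 1 / (1 + h * |t|)) := by ring
      rw [e] at hb1
      have : (0:ℝ) ≤ 1 / (1 + h * |t|) := by positivity
      nlinarith
    refine (interp (norm_nonneg _) (avs_sub_le h0 h1 hh hh1) h2).trans ?_
    have e1 : (2 * h ^ 2 * (1 + |t - s|)) ^ (1/4:ℝ) = 2 ^ (1/4:ℝ) * h ^ (1/2:ℝ) * (1 + u) ^ (1/4:ℝ) := by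
      rw [Real.mul_rpow (by positivity) (by positivity), Real.mul_rpow (by norm_num) (by positivity),
        ← Real.rpow_natCast, ← Real.rpow_mul hh.le, ← hu]; norm_num
    have e2 : (20 * h * (1 / (1 + h * |t|))) ^ (3/4:ℝ) = 20 ^ (3/4:ℝ) * h ^ (3/4:ℝ) * wt h t := by
      rw [Real.mul_rpow (by positivity) (by positivity), Real.mul_rpow (by norm_num) (by positivity), one_div,
        Real.inv_rpow (by positivity), wt, Real.rpow_neg (by positivity)]
    rw [e1, e2]
    have e3 : h ^ (5/4:ℝ) = h ^ (1/2:ℝ) * h ^ (3/4:ℝ) := by rw [← Real.rpow_add hh]; norm_num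
    rw [e3]
    have k1 : (2:ℝ) ^ (1/4:ℝ) ≤ 2 := Real.rpow_le_self_of_one_le (by norm_num) (by norm_num)
    have k2 : (20:ℝ) ^ (3/4:ℝ) ≤ 20 := Real.rpow_le_self_of_one_le (by norm_num) (by norm_num)
    have k3 : (1 + u) ^ (1/4:ℝ) ≤ (1 + u) ^ (3/4:ℝ) :=
      Real.rpow_le_rpow_of_exponent_le (by linarith) (by norm_num)
    calc _ ≤ 2 * h ^ (1/2:ℝ) * (1 + u) ^ (3/4:ℝ) * (20 * h ^ (3/4:ℝ) * wt h t) := by gcongr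
      _ = _ := by ring

end
end GM

open Complex Filter MeasureTheory Real Set
open scoped Topology
namespace GM
noncomputable section

open Classical in
/-- multiplicity weight of a zero, restricted to the critical line -/
def mm (ρ : Zt) : ℝ := if (ρ:ℂ).re = 1/2 then (mu ρ : ℝ) else 0

/-- ordinate -/
def gg (ρ : Zt) : ℝ := (ρ:ℂ).im

lemma mm_nonneg (ρ : Zt) : 0 ≤ mm ρ := by unfold mm; split_ifs <;> positivity

lemma exists_D : ∃ D : ℝ, 0 ≤ D ∧ ∀ t : ℝ, Summable (fun i => mm i * (1 + |t - gg i|) ^ (-(5 / 4) : ℝ)) ∧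
      ∑' i, mm i * (1 + |t - gg i|) ^ (-(5 / 4) : ℝ) ≤ D * Real.log (|t| + 2) := by
  classical
  refine density_of_local gg mm mm_nonneg 120 (by norm_num) ?_
  intro t S hS
  have h := local_count t ((S.filter (fun ρ : Zt => (ρ:ℂ).re = 1/2)).map (Function.Embedding.subtype _)) (by
    intro ρ hρ
    simp only [Finset.mem_map, Finset.mem_filter, Function.Embedding.subtype_apply] at hρ
    obtain ⟨z, ⟨hz, hz2⟩, rfl⟩ := hρ
    exact ⟨hz2, hS z hz⟩)
  rw [Finset.sum_map, Finset.sum_filter] at h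
  refine le_trans (le_of_eq ?_) h
  refine Finset.sum_congr rfl fun i _ => ?_
  unfold mm; simp only [Function.Embedding.subtype_apply]

def DD : ℝ := exists_D.choose
lemma DD_nonneg : 0 ≤ DD := exists_D.choose_spec.1
lemma DD_summable (t : ℝ) : Summable (fun i => mm i * (1 + |t - gg i|) ^ (-(5 / 4) : ℝ)) :=
  (exists_D.choose_spec.2 t).1
lemma DD_le (t : ℝ) : ∑' i, mm i * (1 + |t - gg i|) ^ (-(5 / 4) : ℝ) ≤ DD * Real.log (|t| + 2) :=
  (exists_D.choose_spec.2 t).2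

/-- general term -/
def Wt (k : ℝ → ℂ) (Y t : ℝ) (ρ : Zt) : ℂ :=
  (mm ρ : ℂ) * k (gg ρ) * cexp (I * gg ρ * Y) / ((1 + (t - gg ρ)^2 : ℝ) : ℂ)

def W (k : ℝ → ℂ) (Y t : ℝ) : ℂ := ∑' ρ : Zt, Wt k Y t ρ

lemma norm_cexp_I (g Y : ℝ) : ‖cexp (I * g * Y)‖ = 1 := by
  rw [show (I * g * Y : ℂ) = ((g * Y : ℝ) : ℂ) * I by push_cast; ring, Complex.norm_exp_ofReal_mul_I]

lemma norm_Wt (k : ℝ → ℂ) (Y t : ℝ) (ρ : Zt) :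
    ‖Wt k Y t ρ‖ = mm ρ * ‖k (gg ρ)‖ * (1 / (1 + (t - gg ρ)^2)) := by
  unfold Wt
  rw [norm_div, norm_mul, norm_mul, norm_cexp_I, Complex.norm_real, Complex.norm_real,
    Real.norm_of_nonneg (mm_nonneg ρ), Real.norm_of_nonneg (by positivity)]
  ring

lemma lorentz_le (u : ℝ) : 1 / (1 + u^2) ≤ 2 * (1 + |u|) ^ (-(2:ℝ)) := by
  rw [Real.rpow_neg (by positivity), Real.rpow_two, ← div_eq_mul_inv,
    div_le_div_iff₀ (by positivity) (by positivity)]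
  nlinarith [sq_abs u, sq_nonneg (1 - |u|)]

lemma norm_Wt_le {k : ℝ → ℂ} {Y t K : ℝ} {ρ : Zt}
    (hk : ‖k (gg ρ)‖ ≤ K * (1 + |t - gg ρ|) ^ (3/4:ℝ)) :
    ‖Wt k Y t ρ‖ ≤ 2 * K * (mm ρ * (1 + |t - gg ρ|) ^ (-(5/4):ℝ)) := by
  rw [norm_Wt]
  have h1 := lorentz_le (t - gg ρ)
  have p : 0 < 1 + |t - gg ρ| := by positivity
  calc _ ≤ mm ρ * (K * (1 + |t - gg ρ|) ^ (3/4:ℝ)) * (2 * (1 + |t - gg ρ|) ^ (-(2:ℝ))) := by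
        have := mm_nonneg ρ
        have := (norm_nonneg _).trans hk
        gcongr
    _ = 2 * K * (mm ρ * ((1 + |t - gg ρ|) ^ (3/4:ℝ) * (1 + |t - gg ρ|) ^ (-(2:ℝ)))) := by ring
    _ = _ := by rw [← Real.rpow_add p]; norm_num

lemma Wt_summable {k : ℝ → ℂ} {Y t K : ℝ} (hk : ∀ ρ : Zt, ‖k (gg ρ)‖ ≤ K * (1 + |t - gg ρ|) ^ (3/4:ℝ)) :
    Summable (Wt k Y t) :=
  Summable.of_norm_bounded ((DD_summable t).mul_left (2 * K)) (fun ρ => norm_Wt_le (hk ρ))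

lemma W_bound {k : ℝ → ℂ} {Y t K : ℝ} (hK : 0 ≤ K) (hk : ∀ ρ : Zt, ‖k (gg ρ)‖ ≤ K * (1 + |t - gg ρ|) ^ (3/4:ℝ)) :
    ‖W k Y t‖ ≤ 2 * K * (DD * Real.log (|t| + 2)) := by
  have h := tsum_of_norm_bounded ((DD_summable t).mul_left (2 * K)).hasSum (fun ρ => norm_Wt_le (Y := Y) (hk ρ))
  refine h.trans ?_
  rw [tsum_mul_left]
  gcongr
  exact DD_le t

lemma W_measurable (k : ℝ → ℂ) (Y : ℝ) : Measurable (fun t => W k Y t) := by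
  unfold W
  refine Measurable.tsum fun ρ => ?_
  unfold Wt
  fun_prop

lemma one_le_pw (u : ℝ) : (1:ℝ) ≤ (1 + |u|) ^ (3/4:ℝ) :=
  Real.one_le_rpow (by linarith [abs_nonneg u]) (by norm_num)

lemma W_sub_smul {k l : ℝ → ℂ} (c : ℂ) {Y t : ℝ} (hk : Summable (Wt k Y t)) (hl : Summable (Wt l Y t)) :
    W k Y t - c * W l Y t = W (fun s => k s - c * l s) Y t := by
  unfold W
  rw [← tsum_mul_left, ← (hk.tsum_sub (hl.mul_left c))]
  refine tsum_congr fun ρ => ?_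
  unfold Wt; ring

/-- the envelope -/
def BB (h t : ℝ) : ℝ := h * wt h t * Real.log (|t| + 2)

def S1 : ℝ → ℂ := fun _ => 1

lemma log_nonneg2 (t : ℝ) : 0 ≤ Real.log (|t| + 2) := Real.log_nonneg (by linarith [abs_nonneg t])

lemma BB_nonneg {h t : ℝ} (hh : 0 < h) : 0 ≤ BB h t := by
  have := (wt_pos (t := t) hh).le
  have := log_nonneg2 t
  unfold BB; positivity

lemma S_bound (Y t : ℝ) : ‖W S1 Y t‖ ≤ 2 * DD * Real.log (|t| + 2) := by
  have := W_bound (k := S1) (Y := Y) (t := t) (K := 1) (by norm_num) (fun ρ => by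
    simpa [S1] using one_le_pw _)
  linarith

lemma S_summable (Y t : ℝ) : Summable (Wt S1 Y t) := Wt_summable (K := 1) (fun ρ => by
    simpa [S1] using one_le_pw _)

lemma A_bound {h : ℝ} (hh : 0 < h) (hh1 : h ≤ 1) (Y t : ℝ) :
    ‖W (avs (1/2) h) Y t‖ ≤ 10 * DD * BB h t := by
  have := W_bound (k := avs (1/2) h) (Y := Y) (t := t) (K := 5 * h * wt h t)
    (by have := (wt_pos (t := t) hh).le; positivity) (fun ρ => avs_wt (by norm_num) le_rfl hh hh1)
  refine this.trans (le_of_eq ?_)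
  unfold BB; ring

lemma A_summable {h : ℝ} (hh : 0 < h) (hh1 : h ≤ 1) (Y t : ℝ) : Summable (Wt (avs (1/2) h) Y t) :=
  Wt_summable (fun ρ => avs_wt (by norm_num) le_rfl hh hh1)

lemma AS_bound {h : ℝ} (hh : 0 < h) (hh1 : h ≤ 1) (Y t : ℝ) :
    ‖avs 0 h t * W S1 Y t‖ ≤ 10 * DD * BB h t := by
  have h1 := avs_wt (σ := 0) (s := t) (t := t) le_rfl (by norm_num) hh hh1
  simp only [sub_self, abs_zero, add_zero, Real.one_rpow, mul_one] at h1
  rw [norm_mul]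
  calc _ ≤ (5 * h * wt h t) * (2 * DD * Real.log (|t| + 2)) :=
        mul_le_mul h1 (S_bound Y t) (norm_nonneg _) ((norm_nonneg _).trans h1)
    _ = _ := by unfold BB; ring

lemma A_diff {h : ℝ} (hh : 0 < h) (hh1 : h ≤ 1) (Y t : ℝ) :
    ‖W (avs (1/2) h) Y t - avs 0 h t * W S1 Y t‖ ≤ 80 * DD * h ^ (1/4:ℝ) * BB h t := by
  rw [W_sub_smul _ (A_summable hh hh1 Y t) (S_summable Y t)]
  have := W_bound (k := fun s => avs (1/2) h s - avs 0 h t * S1 s) (Y := Y) (t := t)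
    (K := 40 * h ^ (5/4:ℝ) * wt h t)
    (by have := (wt_pos (t := t) hh).le; positivity) (fun ρ => by
      simpa only [S1, mul_one] using avs_diff_wt (by norm_num) le_rfl hh hh1)
  refine this.trans (le_of_eq ?_)
  have hh54 : h ^ (5/4:ℝ) = h * h ^ (1/4:ℝ) := by
    rw [show (5/4:ℝ) = 1 + 1/4 by norm_num, Real.rpow_add hh, Real.rpow_one]
  rw [hh54]
  unfold BB; ring

/-- the logarithm scale -/
def LL (h : ℝ) : ℝ := 1 - Real.log h

lemma LL_ge {h : ℝ} (hh : 0 < h) (hh1 : h ≤ 1) : 1 ≤ LL h := by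
  unfold LL; linarith [Real.log_nonpos hh.le hh1]

lemma log_le_LL {h : ℝ} (hh : 0 < h) (hh1 : h ≤ 1) (t : ℝ) :
    Real.log (|t| + 2) ≤ 17 * LL h * (1 + h * |t|) ^ (1/16:ℝ) := by
  have hL := LL_ge hh hh1
  have p : 0 < 1 + h * |t| := by positivity
  have h1 : |t| + 2 ≤ 2 / h * (1 + h * |t|) := by
    rw [div_mul_eq_mul_div, le_div_iff₀ hh]
    have := abs_nonneg t
    nlinarith [mul_nonneg hh.le this]
  have h2 : Real.log (|t| + 2) ≤ Real.log 2 - Real.log h + Real.log (1 + h * |t|) := by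
    rw [← Real.log_div (by norm_num) hh.ne', ← Real.log_mul (by positivity) p.ne']
    exact Real.log_le_log (by positivity) h1
  have h3 : Real.log (1 + h * |t|) ≤ 16 * (1 + h * |t|) ^ (1/16:ℝ) := by
    have := Real.log_le_rpow_div p.le (show (0:ℝ) < 1/16 by norm_num)
    linarith
  have h4 : (1:ℝ) ≤ (1 + h * |t|) ^ (1/16:ℝ) :=
    Real.one_le_rpow (by have := abs_nonneg t; nlinarith) (by norm_num)
  have h5 := Real.log_two_lt_d9
  unfold LL at *
  nlinarith

lemma BB_sq_le {h : ℝ} (hh : 0 < h) (hh1 : h ≤ 1) (t : ℝ) :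
    BB h t ^ 2 ≤ 289 * h^2 * LL h ^ 2 * (1 + |h * t|) ^ (-(11/8):ℝ) := by
  have p : 0 < 1 + h * |t| := by positivity
  have hw := (wt_pos (t := t) hh).le
  have h1 : BB h t ≤ h * wt h t * (17 * LL h * (1 + h * |t|) ^ (1/16:ℝ)) := by
    unfold BB; gcongr; exact log_le_LL hh hh1 t
  have h2 := pow_le_pow_left₀ (BB_nonneg hh) h1 2
  refine h2.trans (le_of_eq ?_)
  have e : (wt h t * (1 + h * |t|) ^ (1/16:ℝ))^2 = (1 + |h * t|) ^ (-(11/8):ℝ) := by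
    rw [abs_mul, abs_of_pos hh]
    unfold wt
    rw [← Real.rpow_add p, ← Real.rpow_natCast, ← Real.rpow_mul p.le]; norm_num
  rw [← e]; ring

/-- the integral of the Japanese bracket -/
def CJ : ℝ := ∫ t : ℝ, (1 + |t|) ^ (-(11/8):ℝ)

lemma jb_integrable : Integrable (fun t : ℝ => (1 + |t|) ^ (-(11/8):ℝ)) := by
  have := integrable_one_add_norm (E := ℝ) (μ := volume) (r := 11/8) (by simp; norm_num)
  simpa using this

lemma CJ_nonneg : 0 ≤ CJ := integral_nonneg fun t => by positivity

lemma BB_measurable (h : ℝ) : Measurable (BB h) := by unfold BB wt; fun_prop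

lemma BB_sq_integrable {h : ℝ} (hh : 0 < h) (hh1 : h ≤ 1) : Integrable (fun t => BB h t ^ 2) := by
  refine ((jb_integrable.comp_mul_left' hh.ne').const_mul (289 * h^2 * LL h ^ 2)).mono'
    (by have := BB_measurable h; fun_prop) (Eventually.of_forall fun t => ?_)
  rw [Real.norm_of_nonneg (by positivity)]
  exact BB_sq_le hh hh1 t

lemma BB_sq_integral {h : ℝ} (hh : 0 < h) (hh1 : h ≤ 1) :
    ∫ t, BB h t ^ 2 ≤ 289 * CJ * h * LL h ^ 2 := by
  have h1 := integral_mono (BB_sq_integrable hh hh1)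
    ((jb_integrable.comp_mul_left' hh.ne').const_mul (289 * h^2 * LL h ^ 2)) (fun t => BB_sq_le hh hh1 t)
  refine h1.trans (le_of_eq ?_)
  rw [integral_const_mul, Measure.integral_comp_mul_left (fun t : ℝ => (1 + |t|) ^ (-(11/8):ℝ)),
    abs_of_pos (inv_pos.mpr hh)]
  unfold CJ
  simp only [smul_eq_mul]
  field_simp

/-- generic: functions bounded by a multiple of the envelope are square integrable -/
lemma sq_integrable_of_BB {f : ℝ → ℂ} (hf : Measurable f) {h C : ℝ} (hh : 0 < h) (hh1 : h ≤ 1)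
    (hb : ∀ t, ‖f t‖ ≤ C * BB h t) : Integrable (fun t => ‖f t‖^2) := by
  refine ((BB_sq_integrable hh hh1).const_mul (C^2)).mono' (by fun_prop) (Eventually.of_forall fun t => ?_)
  rw [Real.norm_of_nonneg (by positivity), ← mul_pow]
  exact pow_le_pow_left₀ (norm_nonneg _) (hb t) 2

lemma avs_measurable (σ h : ℝ) : Measurable (avs σ h) := by
  have : Continuous (avs σ h) := by
    unfold avs
    apply intervalIntegral.continuous_parametric_intervalIntegral_of_continuous'
    fun_prop
  exact this.measurable

def JJ (Y h : ℝ) : ℝ := 2/π * ∫ t, ‖W (avs (1/2) h) Y t‖^2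

lemma JJ_integrable {h : ℝ} (hh : 0 < h) (hh1 : h ≤ 1) (Y : ℝ) :
    Integrable (fun t => ‖W (avs (1/2) h) Y t‖^2) :=
  sq_integrable_of_BB (W_measurable _ _) hh hh1 (A_bound hh hh1 Y)

lemma AS_integrable {h : ℝ} (hh : 0 < h) (hh1 : h ≤ 1) (Y : ℝ) :
    Integrable (fun t => ‖avs 0 h t * W S1 Y t‖^2) :=
  sq_integrable_of_BB ((avs_measurable 0 h).mul (W_measurable _ _)) hh hh1 (AS_bound hh hh1 Y)

lemma two_div_pi_le : 2/π ≤ 1 := by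
  rw [div_le_one Real.pi_pos]; exact Real.two_le_pi

lemma exists_JJ_bound : ∃ C : ℝ, 0 ≤ C ∧ ∀ h, 0 < h → h ≤ 1 → ∀ Y, JJ Y h ≤ C * (h * LL h ^ 2) := by
  refine ⟨100 * DD^2 * (289 * CJ), by have := CJ_nonneg; positivity, fun h hh hh1 Y => ?_⟩
  have h1 : ∫ t, ‖W (avs (1/2) h) Y t‖^2 ≤ ∫ t, 100 * DD^2 * BB h t ^2 := by
    refine integral_mono (JJ_integrable hh hh1 Y) ((BB_sq_integrable hh hh1).const_mul _) (fun t => ?_)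
    have := pow_le_pow_left₀ (norm_nonneg _) (A_bound hh hh1 Y t) 2
    refine this.trans (le_of_eq ?_); ring
  rw [integral_const_mul] at h1
  have h2 := BB_sq_integral hh hh1
  have h3 : 0 ≤ ∫ t, ‖W (avs (1/2) h) Y t‖^2 := integral_nonneg fun t => by positivity
  unfold JJ
  have : 2/π * ∫ t, ‖W (avs (1/2) h) Y t‖^2 ≤ ∫ t, ‖W (avs (1/2) h) Y t‖^2 :=
    mul_le_of_le_one_left h3 two_div_pi_le
  refine this.trans (h1.trans ?_)
  calc _ ≤ 100 * DD^2 * (289 * CJ * h * LL h ^ 2) := by gcongr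
    _ = _ := by ring

lemma JJ_nonneg (Y h : ℝ) : 0 ≤ JJ Y h := by
  unfold JJ
  have := integral_nonneg (μ := volume) (f := fun t => ‖W (avs (1/2) h) Y t‖^2) fun t => by positivity
  positivity

/-- Replacing the smoothed sum by the product. -/
lemma exists_JJ_approx : ∃ C : ℝ, 0 ≤ C ∧ ∀ h, 0 < h → h ≤ 1 → ∀ Y,
    |JJ Y h - 2/π * ∫ t, ‖avs 0 h t * W S1 Y t‖^2| ≤ C * (h ^ (5/4:ℝ) * LL h ^ 2) := by
  refine ⟨1600 * DD^2 * (289 * CJ), by have := CJ_nonneg; positivity, fun h hh hh1 Y => ?_⟩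
  unfold JJ
  rw [← mul_sub, ← integral_sub (JJ_integrable hh hh1 Y) (AS_integrable hh hh1 Y), abs_mul,
    abs_of_pos (by positivity : 0 < 2/π)]
  refine (mul_le_of_le_one_left (abs_nonneg _) two_div_pi_le).trans ?_
  have h1 : |∫ t, (‖W (avs (1/2) h) Y t‖^2 - ‖avs 0 h t * W S1 Y t‖^2)| ≤
      ∫ t, 1600 * DD^2 * h ^ (1/4:ℝ) * BB h t ^2 := by
    rw [← Real.norm_eq_abs]
    refine norm_integral_le_of_norm_le ((BB_sq_integrable hh hh1).const_mul _) (Eventually.of_forall fun t => ?_)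
    have a1 := A_bound hh hh1 Y t
    have a2 := AS_bound hh hh1 Y t
    have a3 := A_diff hh hh1 Y t
    have a4 := abs_norm_sub_norm_le (W (avs (1/2) h) Y t) (avs 0 h t * W S1 Y t)
    rw [Real.norm_eq_abs, sq_sub_sq, abs_mul, abs_of_nonneg (by positivity)]
    calc _ ≤ (10 * DD * BB h t + 10 * DD * BB h t) * (80 * DD * h ^ (1/4:ℝ) * BB h t) :=
          mul_le_mul (add_le_add a1 a2) (a4.trans a3) (abs_nonneg _)
            (by have := (norm_nonneg _).trans a1; linarith)
      _ = _ := by ring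
  rw [integral_const_mul] at h1
  refine h1.trans ?_
  have h2 := BB_sq_integral hh hh1
  have hh54 : h ^ (5/4:ℝ) = h * h ^ (1/4:ℝ) := by
    rw [show (5/4:ℝ) = 1 + 1/4 by norm_num, Real.rpow_add hh, Real.rpow_one]
  calc _ ≤ 1600 * DD^2 * h ^ (1/4:ℝ) * (289 * CJ * h * LL h ^ 2) := by gcongr
    _ = _ := by rw [hh54]; ring

end
end GM

open Complex Filter MeasureTheory Real Set
open scoped Topology
namespace GM
noncomputable section

/-- smoothed kernel -/
def ke (h ε s : ℝ) : ℂ := avs (1/2) h s * (avs (1/2) ε s / ε)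

lemma bs_le {ε s : ℝ} (he : 0 < ε) (he1 : ε ≤ 1) : ‖avs (1/2) ε s / (ε:ℂ)‖ ≤ 2 := by
  rw [norm_div, Complex.norm_real, Real.norm_of_nonneg he.le, div_le_iff₀ he]
  exact avs_le_two (by norm_num) le_rfl he he1

lemma bs_tendsto (s : ℝ) : Tendsto (fun ε : ℝ => avs (1/2) ε s / (ε:ℂ)) (𝓝[>] 0) (𝓝 1) := by
  have hc : Continuous (fun v : ℝ => cexp ((((1/2:ℝ):ℂ) + s * I) * v)) := by fun_prop
  have h1 : HasDerivAt (fun ε : ℝ => avs (1/2) ε s) 1 0 := by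
    have := intervalIntegral.integral_hasDerivAt_right (a := (0:ℝ)) (b := 0) (hc.intervalIntegrable _ _)
      hc.stronglyMeasurable.stronglyMeasurableAtFilter hc.continuousAt
    simpa [avs] using this
  have h2 := h1.tendsto_slope_zero_right
  refine h2.congr fun ε => ?_
  have : avs (1/2) 0 s = 0 := by simp [avs]
  rw [zero_add, this, sub_zero, Complex.real_smul, Complex.ofReal_inv]; ring

lemma ke_le {h ε : ℝ} (hh : 0 < h) (hh1 : h ≤ 1) (he : 0 < ε) (he1 : ε ≤ 1) (s t : ℝ) :
    ‖ke h ε s‖ ≤ 10 * h * wt h t * (1 + |t - s|) ^ (3/4:ℝ) := by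
  unfold ke
  rw [norm_mul]
  have h1 := avs_wt (s := s) (t := t) (by norm_num : (0:ℝ) ≤ 1/2) le_rfl hh hh1
  have h2 := bs_le (s := s) he he1
  have := mul_le_mul h1 h2 (norm_nonneg _) ((norm_nonneg _).trans h1)
  linarith

lemma Ae_bound {h ε : ℝ} (hh : 0 < h) (hh1 : h ≤ 1) (he : 0 < ε) (he1 : ε ≤ 1) (Y t : ℝ) :
    ‖W (ke h ε) Y t‖ ≤ 20 * DD * BB h t := by
  have := W_bound (k := ke h ε) (Y := Y) (t := t) (K := 10 * h * wt h t)
    (by have := (wt_pos (t := t) hh).le; positivity) (fun ρ => ke_le hh hh1 he he1 _ _)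
  refine this.trans (le_of_eq ?_)
  unfold BB; ring

lemma Ae_tendsto {h : ℝ} (hh : 0 < h) (hh1 : h ≤ 1) (Y t : ℝ) :
    Tendsto (fun ε => W (ke h ε) Y t) (𝓝[>] 0) (𝓝 (W (avs (1/2) h) Y t)) := by
  unfold W
  refine tendsto_tsum_of_dominated_convergence ((DD_summable t).mul_left (2 * (10 * h * wt h t))) ?_ ?_
  · intro ρ
    unfold Wt ke
    have := bs_tendsto (gg ρ)
    have h2 : Tendsto (fun ε : ℝ => (mm ρ : ℂ) * (avs (1/2) h (gg ρ) * (avs (1/2) ε (gg ρ) / ε)) * cexp (I * gg ρ * Y) / ((1 + (t - gg ρ)^2 : ℝ) : ℂ))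
      (𝓝[>] 0) (𝓝 ((mm ρ : ℂ) * (avs (1/2) h (gg ρ) * 1) * cexp (I * gg ρ * Y) / ((1 + (t - gg ρ)^2 : ℝ) : ℂ))) :=
      (((this.const_mul _).const_mul _).mul_const _).div_const _
    simpa using h2
  · filter_upwards [Ioc_mem_nhdsGT (show (0:ℝ) < 1 by norm_num)] with ε he ρ
    exact norm_Wt_le (ke_le hh hh1 he.1 he.2 _ _)

/-- full quadratic integral -/
def JE (Y h ε : ℝ) : ℝ := 2/π * ∫ t, ‖W (ke h ε) Y t‖^2

lemma JE_tendsto {h : ℝ} (hh : 0 < h) (hh1 : h ≤ 1) (Y : ℝ) :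
    Tendsto (fun ε => JE Y h ε) (𝓝[>] 0) (𝓝 (JJ Y h)) := by
  unfold JE JJ
  refine Tendsto.const_mul _ ?_
  refine tendsto_integral_filter_of_dominated_convergence (fun t => (20 * DD)^2 * BB h t ^2) ?_ ?_
    ((BB_sq_integrable hh hh1).const_mul _) ?_
  · refine Eventually.of_forall fun ε => ?_
    have := W_measurable (ke h ε) Y
    fun_prop
  · filter_upwards [Ioc_mem_nhdsGT (show (0:ℝ) < 1 by norm_num)] with ε he
    refine Eventually.of_forall fun t => ?_
    rw [Real.norm_of_nonneg (by positivity), ← mul_pow]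
    exact pow_le_pow_left₀ (norm_nonneg _) (Ae_bound hh hh1 he.1 he.2 Y t) 2
  · exact Eventually.of_forall fun t => ((Ae_tendsto hh hh1 Y t).norm.pow 2)

/-- the sum over critical zeros in the y variable -/
def PP (h ε y : ℝ) : ℂ := ∑' ρ : Zt, ((mm ρ : ℂ) * ke h ε (gg ρ)) * cexp (I * gg ρ * y)

lemma ke_summable {h ε : ℝ} (hh : 0 < h) (hh1 : h ≤ 1) (he : 0 < ε) (he1 : ε ≤ 1) :
    Summable (fun ρ : Zt => ‖(mm ρ : ℂ) * ke h ε (gg ρ)‖) := by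
  refine Summable.of_nonneg_of_le (fun _ => norm_nonneg _) (fun ρ => ?_) ((DD_summable 0).mul_left (25/ε))
  have a0 := abs_nonneg (gg ρ)
  have a1 : ‖avs (1/2) h (gg ρ)‖ ≤ 5 / (1 + |gg ρ|) := by
    refine (avs_le (by norm_num) le_rfl hh hh1).trans ?_
    rw [div_le_div_iff₀ (by positivity) (by positivity)]
    nlinarith
  have a2 : ‖avs (1/2) ε (gg ρ) / (ε:ℂ)‖ ≤ 5 / ε / (1 + |gg ρ|) := by
    rw [norm_div, Complex.norm_real, Real.norm_of_nonneg he.le, div_le_iff₀ he]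
    refine (avs_le (by norm_num) le_rfl he he1).trans ?_
    rw [div_div, div_mul_eq_mul_div, div_le_div_iff₀ (by positivity) (by positivity)]
    nlinarith [mul_nonneg he.le a0, mul_pos he he]
  rw [norm_mul, Complex.norm_real, Real.norm_of_nonneg (mm_nonneg ρ), ke, norm_mul]
  have a3 := mul_le_mul a1 a2 (norm_nonneg _) (by positivity)
  have a4 : 1 / (1 + |gg ρ|)^2 ≤ (1 + |0 - gg ρ|) ^ (-(5 / 4) : ℝ) := by
    rw [zero_sub, abs_neg, one_div, ← Real.rpow_two, ← Real.rpow_neg (by positivity)]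
    exact Real.rpow_le_rpow_of_exponent_le (by linarith) (by norm_num)
  calc _ ≤ mm ρ * (5 / (1 + |gg ρ|) * (5 / ε / (1 + |gg ρ|))) := by
        have := mm_nonneg ρ; gcongr
    _ = 25/ε * (mm ρ * (1 / (1 + |gg ρ|)^2)) := by field_simp; ring
    _ ≤ _ := by have := mm_nonneg ρ; gcongr

lemma PP_continuous {h ε : ℝ} (hh : 0 < h) (hh1 : h ≤ 1) (he : 0 < ε) (he1 : ε ≤ 1) :
    Continuous (PP h ε) := by
  unfold PP
  refine continuous_tsum (fun i => by fun_prop) (ke_summable hh hh1 he he1) (fun i y => ?_)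
  rw [norm_mul, norm_cexp_I, mul_one]

lemma PP_bounded {h ε : ℝ} (hh : 0 < h) (hh1 : h ≤ 1) (he : 0 < ε) (he1 : ε ≤ 1) :
    ∃ C, ∀ y, ‖PP h ε y‖ ≤ C := by
  refine ⟨_, fun y => tsum_of_norm_bounded (ke_summable hh hh1 he he1).hasSum (fun ρ => ?_)⟩
  rw [norm_mul, norm_cexp_I, mul_one]

lemma PP_integrable {h ε : ℝ} (hh : 0 < h) (hh1 : h ≤ 1) (he : 0 < ε) (he1 : ε ≤ 1) (Y : ℝ) :
    Integrable (fun y => rexp (-(2 * |y - Y|)) * ‖PP h ε y‖^2) := by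
  obtain ⟨C, hC⟩ := PP_bounded hh hh1 he he1
  have hi := (exp_abs_integrable (a := 2) (by norm_num)).comp_sub_right Y
  refine (hi.mul_const (C^2)).mono' ?_ (Eventually.of_forall fun y => ?_)
  · have := PP_continuous hh hh1 he he1
    exact Continuous.aestronglyMeasurable (by fun_prop)
  · rw [Real.norm_of_nonneg (by positivity)]
    gcongr
    exact hC y

lemma parseval_shift {h ε : ℝ} (hh : 0 < h) (hh1 : h ≤ 1) (he : 0 < ε) (he1 : ε ≤ 1) (Y : ℝ) :
    ∫ y, rexp (-(2 * |y - Y|)) * ‖PP h ε y‖^2 = JE Y h ε := by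
  have h1 := parseval (fun ρ : Zt => ((mm ρ : ℂ) * ke h ε (gg ρ)) * cexp (I * gg ρ * Y)) gg
    (by
      have := ke_summable hh hh1 he he1
      refine this.congr fun ρ => ?_
      rw [norm_mul _ (cexp _), norm_cexp_I, mul_one])
  have h2 := integral_sub_right_eq_self (μ := volume) (fun y : ℝ => rexp (-(2 * |y|)) * ‖PP h ε (y + Y)‖^2) Y
  simp only [sub_add_cancel] at h2
  rw [h2]
  unfold JE W
  refine Eq.trans ?_ h1
  refine integral_congr_ae (Eventually.of_forall fun y => ?_)
  simp only [PP]
  congr 3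
  refine tsum_congr fun ρ => ?_
  rw [mul_assoc _ (cexp _), ← Complex.exp_add]
  congr 2
  push_cast; ring

end
end GM

open Complex Filter MeasureTheory Real Set
open scoped Topology
namespace GM
noncomputable section

/-- difference quotient of psi1 -/
def dps (ε y : ℝ) : ℝ := (psi1 (y + ε) - psi1 y) / ε

/-- smoothed prime side -/
def HE (h ε y : ℝ) : ℝ :=
  rexp (-(y/2)) * (dps ε (y + h) - dps ε y - rexp y * (rexp h - 1) * ((rexp ε - 1) / ε))

lemma ee_sd (hRH : RiemannHypothesis) {y h ε : ℝ} (hy : 0 ≤ y) (hh : 0 < h) (he : 0 < ε) :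
    HasSum (fun ρ : Zt => (mu ρ : ℂ) * (cexp (ρ * y) * ((cexp (ρ * h) - 1) / ρ) * ((cexp (ρ * ε) - 1) / ρ)))
      (-((psi1 (y + h + ε) - psi1 (y + h) - (psi1 (y + ε) - psi1 y)
        - rexp y * (rexp h - 1) * (rexp ε - 1) : ℝ) : ℂ)) := by
  have a1 := (explicit_formula hRH (y := y + h + ε) (by linarith)).2
  have a2 := (explicit_formula hRH (y := y + h) (by linarith)).2
  have a3 := (explicit_formula hRH (y := y + ε) (by linarith)).2
  have a4 := (explicit_formula hRH (y := y) (by linarith)).2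
  have a5 := ((a1.sub a2).sub (a3.sub a4)).neg
  have a6 := hasSum_congr_value a5 (b := (-((psi1 (y + h + ε) - psi1 (y + h) - (psi1 (y + ε) - psi1 y)
        - rexp y * (rexp h - 1) * (rexp ε - 1) : ℝ) : ℂ))) (by
      push_cast
      simp only [Complex.exp_add]
      ring)
  refine a6.congr_fun ?_ |> id
  intro ρ
  have hρ : (ρ:ℂ) ≠ 0 := by
    have := Zt_norm hRH ρ
    intro h0; rw [h0] at this; norm_num at this
  simp only [qf]
  push_cast
  simp only [mul_add, Complex.exp_add]
  field_simp
  ring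

lemma norm_exp_sub_one_le {x : ℝ} (hx : x ≤ 0) : |rexp x - 1| ≤ |x| := by
  rw [abs_of_nonpos hx, abs_of_nonpos (by linarith [Real.exp_le_one_iff.mpr hx])]
  linarith [Real.add_one_le_exp x]

lemma exists_trivial_bound (hRH : RiemannHypothesis) : ∃ C : ℝ, 0 ≤ C ∧ ∀ h ε y : ℝ, 0 < h → h ≤ 1 → 0 < ε → ε ≤ 1 →
    1 ≤ y → ‖PP h ε y + (HE h ε y : ℂ)‖ ≤ C * h * rexp (-(2*y)) := by
  have hs := summable_inv_sq hRH
  refine ⟨2 * rexp 2 * ∑' ρ : Zt, (mu ρ:ℝ)/‖(ρ:ℂ)‖^2, by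
    have : 0 ≤ ∑' ρ : Zt, (mu ρ:ℝ)/‖(ρ:ℂ)‖^2 := tsum_nonneg fun _ => by positivity
    positivity, ?_⟩
  intro h ε y hh hh1 he he1 hy
  have h1 := (ee_sd hRH (y := y) (by linarith) hh he).mul_left ((rexp (-(y/2)) / ε : ℝ) : ℂ)
  have h2 : HasSum (fun ρ : Zt => ((mm ρ : ℂ) * ke h ε (gg ρ)) * cexp (I * gg ρ * y)) (PP h ε y) := by
    refine Summable.hasSum (Summable.of_norm ?_)
    refine (ke_summable hh hh1 he he1).congr fun ρ => ?_
    rw [norm_mul _ (cexp _), norm_cexp_I, mul_one]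
  have h3 := h2.sub h1
  have h4 := hs.hasSum.mul_left (2 * rexp 2 * h * rexp (-(2*y)))
  have h5 := h3.norm_le_of_bounded h4 ?_
  · refine le_trans (le_of_eq ?_) (h5.trans (le_of_eq (by ring)))
    congr 1
    unfold HE dps
    have : (ε:ℂ) ≠ 0 := by exact_mod_cast he.ne'
    push_cast
    field_simp
    ring_nf
  · intro ρ
    have hρ : (ρ:ℂ) ≠ 0 := by
      have := Zt_norm hRH ρ
      intro h0; rw [h0] at this; norm_num at this
    by_cases hc : (ρ:ℂ).re = 1/2
    · have e0 : (ρ:ℂ) = ((1/2:ℝ):ℂ) + (gg ρ : ℂ) * I := by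
        apply Complex.ext <;> simp [gg, hc]
      have hz := hρ
      rw [e0] at hz
      have em : mm ρ = mu ρ := by unfold mm; rw [if_pos hc]
      have : ((mm ρ : ℂ) * ke h ε (gg ρ)) * cexp (I * gg ρ * y) - ((rexp (-(y/2)) / ε : ℝ) : ℂ) * ((mu ρ : ℂ) * (cexp (ρ * y) * ((cexp (ρ * h) - 1) / ρ) * ((cexp (ρ * ε) - 1) / ρ))) = 0 := by
        rw [em, Complex.ofReal_natCast]
        generalize (mu ρ : ℂ) = m
        rw [e0]
        unfold ke
        rw [avs_eq hz, avs_eq hz]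
        have e1 : cexp (I * gg ρ * y) = ((rexp (-(y/2)) : ℝ) : ℂ) * cexp ((((1/2:ℝ):ℂ) + (gg ρ : ℂ) * I) * y) := by
          rw [Complex.ofReal_exp, ← Complex.exp_add]; congr 1; push_cast; ring
        rw [e1]
        push_cast
        ring
      rw [this, norm_zero]
      positivity
    · obtain ⟨n, hn⟩ : ∃ n : ℕ, (ρ:ℂ) = -2 * (n + 1) := (xf_zero_RH hRH ρ.2).resolve_right hc
      have em : mm ρ = 0 := by unfold mm; rw [if_neg hc]
      set r : ℝ := 2 * (n + 1) with hr
      have hr2 : 2 ≤ r := by have : (0:ℝ) ≤ n := n.cast_nonneg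
                             rw [hr]; linarith
      have er : (ρ:ℂ) = ((-r : ℝ) : ℂ) := by rw [hn, hr]; push_cast; ring
      have enr : ‖(ρ:ℂ)‖ = r := by rw [er, Complex.norm_real, norm_neg, Real.norm_of_nonneg (by linarith)]
      rw [em, Complex.ofReal_zero, zero_mul, zero_mul, zero_sub, norm_neg, enr]
      have b1 : ∀ u : ℝ, 0 < u → ‖(cexp (ρ * u) - 1) / (ρ:ℂ)‖ ≤ u := by
        intro u hu
        rw [norm_div, enr, div_le_iff₀ (by linarith), er]
        have : cexp (((-r:ℝ):ℂ) * u) - 1 = ((rexp (-r * u) - 1 : ℝ) : ℂ) := by push_cast; ring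
        rw [this, Complex.norm_real, Real.norm_eq_abs]
        refine (norm_exp_sub_one_le (by nlinarith)).trans (le_of_eq ?_)
        rw [abs_of_nonpos (by nlinarith)]; ring
      have b2 : ‖cexp ((ρ:ℂ) * y)‖ = rexp (-r * y) := by
        rw [er, ← Complex.ofReal_mul, ← Complex.ofReal_exp, Complex.norm_real, Real.norm_of_nonneg (Real.exp_nonneg _)]
      rw [norm_mul, norm_mul, norm_mul, norm_mul, Complex.norm_real, Complex.norm_natCast, b2,
        Real.norm_of_nonneg (by positivity)]
      have b3 : rexp (-r * y) ≤ rexp 2 * rexp (-(2*y)) * (2 / r^2) := by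
        have c1 : rexp (-r*y) ≤ rexp 2 * rexp (-(2*y)) * rexp (-r) := by
          rw [← Real.exp_add, ← Real.exp_add]
          apply Real.exp_le_exp.mpr; nlinarith
        refine c1.trans ?_
        gcongr
        have := Real.quadratic_le_exp_of_nonneg (show 0 ≤ r by linarith)
        rw [Real.exp_neg, inv_eq_one_div, div_le_div_iff₀ (Real.exp_pos _) (by positivity)]
        nlinarith
      have b4 : rexp (-(y/2)) ≤ 1 := Real.exp_le_one_iff.mpr (by linarith)
      calc rexp (-(y/2)) / ε * ((mu ρ:ℝ) * (rexp (-r * y) * ‖(cexp (ρ * h) - 1) / (ρ:ℂ)‖ * ‖(cexp (ρ * ε) - 1) / (ρ:ℂ)‖))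
          ≤ 1 / ε * ((mu ρ:ℝ) * ((rexp 2 * rexp (-(2*y)) * (2 / r^2)) * h * ε)) := by
            gcongr
            · exact b1 h hh
            · exact b1 ε he
        _ = _ := by field_simp

end
end GM

open Complex Filter MeasureTheory Real Set
open scoped Topology ArithmeticFunction.vonMangoldt
namespace GM
noncomputable section

lemma psi1_eq {y : ℝ} {N : ℕ} (hN : ⌊rexp y⌋₊ ≤ N) :
    psi1 y = ∑ n ∈ Finset.Iic N, Λ n * max (y - Real.log n) 0 := by
  unfold psi1
  refine tsum_eq_sum fun n hn => ?_
  simp only [Finset.mem_Iic, not_le] at hn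
  have h1 : rexp y < n := by
    have := Nat.lt_of_floor_lt (lt_of_le_of_lt hN hn)
    exact this
  have h2 : y < Real.log n := by rwa [Real.lt_log_iff_exp_lt (lt_trans (Real.exp_pos _) h1)]
  rw [max_eq_right (by linarith), mul_zero]

lemma psi_eq {y : ℝ} {N : ℕ} (hN : ⌊rexp y⌋₊ ≤ N) :
    chebyshevPsi (rexp y) = ∑ n ∈ Finset.Iic N, Λ n * (if Real.log n ≤ y then 1 else 0) := by
  unfold chebyshevPsi
  refine Finset.sum_subset_zero_on_sdiff (Finset.Iic_subset_Iic.mpr hN) ?_ ?_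
  · intro n hn
    simp only [Finset.mem_sdiff, Finset.mem_Iic, not_le] at hn
    have h1 : rexp y < n := Nat.lt_of_floor_lt hn.2
    have h2 : y < Real.log n := by rwa [Real.lt_log_iff_exp_lt (lt_trans (Real.exp_pos _) h1)]
    rw [if_neg (by linarith), mul_zero]
  · intro n hn
    rw [Finset.mem_Iic] at hn
    rcases Nat.eq_zero_or_pos n with rfl | h0
    · simp
    have h1 : (n:ℝ) ≤ rexp y := (Nat.le_floor_iff (Real.exp_nonneg _)).mp hn
    have h2 : Real.log n ≤ y := by rwa [Real.log_le_iff_le_exp (by exact_mod_cast h0)]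
    rw [if_pos h2, mul_one]

lemma dps_eq {y ε : ℝ} (he : 0 ≤ ε) {N : ℕ} (hN : ⌊rexp (y + ε)⌋₊ ≤ N) :
    dps ε y = ∑ n ∈ Finset.Iic N, Λ n * ((max (y + ε - Real.log n) 0 - max (y - Real.log n) 0) / ε) := by
  unfold dps
  rw [psi1_eq hN, psi1_eq (y := y) (le_trans (Nat.floor_le_floor (Real.exp_le_exp.mpr (by linarith))) hN),
    ← Finset.sum_sub_distrib, Finset.sum_div]
  refine Finset.sum_congr rfl fun n _ => ?_
  ring

lemma dps_nonneg {y ε : ℝ} (he : 0 < ε) : 0 ≤ dps ε y := by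
  rw [dps_eq he.le le_rfl]
  refine Finset.sum_nonneg fun n _ => mul_nonneg ArithmeticFunction.vonMangoldt_nonneg (div_nonneg ?_ he.le)
  have : max (y - Real.log n) 0 ≤ max (y + ε - Real.log n) 0 := max_le_max (by linarith) le_rfl
  linarith

lemma dps_le {y ε : ℝ} (he : 0 < ε) : dps ε y ≤ chebyshevPsi (rexp (y + ε)) := by
  rw [dps_eq he.le le_rfl, psi_eq le_rfl]
  refine Finset.sum_le_sum fun n _ => mul_le_mul_of_nonneg_left ?_ ArithmeticFunction.vonMangoldt_nonneg
  split_ifs with hc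
  · rw [div_le_one he, max_eq_left (by linarith)]
    have := le_max_left (y - Real.log n) 0
    linarith
  · rw [max_eq_right (by linarith), max_eq_right (by linarith)]; simp

lemma dps_tendsto (y : ℝ) : Tendsto (fun ε => dps ε y) (𝓝[>] 0) (𝓝 (chebyshevPsi (rexp y))) := by
  set N := ⌊rexp (y + 1)⌋₊ with hN
  have h1 : ∀ᶠ ε in 𝓝[>] (0:ℝ), ∑ n ∈ Finset.Iic N, Λ n * ((max (y + ε - Real.log n) 0 - max (y - Real.log n) 0) / ε) = dps ε y := by
    filter_upwards [Ioc_mem_nhdsGT (show (0:ℝ) < 1 by norm_num)] with ε he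
    rw [dps_eq he.1.le (N := N) (Nat.floor_le_floor (Real.exp_le_exp.mpr (by linarith [he.2])))]
  refine Tendsto.congr' h1 ?_
  rw [psi_eq (N := N) (Nat.floor_le_floor (Real.exp_le_exp.mpr (by linarith)))]
  refine tendsto_finsetSum _ fun n _ => Tendsto.const_mul _ ?_
  split_ifs with hc
  · refine tendsto_const_nhds.congr' ?_
    filter_upwards [self_mem_nhdsWithin] with ε (he : 0 < ε)
    rw [max_eq_left (by linarith), max_eq_left (by linarith)]
    field_simp; ring
  · push Not at hc
    refine tendsto_const_nhds.congr' ?_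
    filter_upwards [Ioc_mem_nhdsGT (show (0:ℝ) < Real.log n - y by linarith)] with ε he
    rw [max_eq_right (by linarith [he.2]), max_eq_right (by linarith)]
    simp

lemma cheb_eq (x : ℝ) : chebyshevPsi x = Chebyshev.psi x := by
  unfold chebyshevPsi Chebyshev.psi
  symm
  refine Finset.sum_subset (fun n hn => by simp at hn ⊢; exact hn.2) (fun n hn hn2 => ?_)
  simp at hn hn2
  have : n = 0 := by by_contra h; have := hn2 (Nat.pos_of_ne_zero h); omega
  simp [this]

lemma cheb_le {x : ℝ} (hx : 0 ≤ x) : chebyshevPsi x ≤ 6 * x := by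
  rw [cheb_eq]
  refine (Chebyshev.psi_le_const_mul_self hx).trans ?_
  have : Real.log 4 ≤ 2 := by
    rw [show (4:ℝ) = 2^2 by norm_num, Real.log_pow]
    have := Real.log_two_lt_d9
    push_cast; linarith
  gcongr; linarith

lemma cheb_nonneg (x : ℝ) : 0 ≤ chebyshevPsi x :=
  Finset.sum_nonneg fun n _ => ArithmeticFunction.vonMangoldt_nonneg

lemma cheb_mono : Monotone chebyshevPsi := by
  intro a b hab
  rw [cheb_eq, cheb_eq]; exact Chebyshev.psi_mono hab

lemma cheb_meas : Measurable chebyshevPsi := cheb_mono.measurable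

lemma psi1_meas : Measurable psi1 := by
  unfold psi1
  refine Measurable.tsum fun n => ?_
  fun_prop

lemma HE_meas (h ε : ℝ) : Measurable (HE h ε) := by
  unfold HE dps
  have := psi1_meas
  fun_prop

/-- prime side -/
def HH (h y : ℝ) : ℝ :=
  rexp (-(y/2)) * (chebyshevPsi (rexp (y + h)) - chebyshevPsi (rexp y) - rexp y * (rexp h - 1))

lemma HH_meas (h : ℝ) : Measurable (HH h) := by
  unfold HH
  have := cheb_meas
  fun_prop

lemma HE_tendsto (h y : ℝ) : Tendsto (fun ε => HE h ε y) (𝓝[>] 0) (𝓝 (HH h y)) := by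
  unfold HE HH
  have h1 : Tendsto (fun ε : ℝ => (rexp ε - 1) / ε) (𝓝[>] 0) (𝓝 1) := by
    have := (Real.hasDerivAt_exp 0).tendsto_slope_zero_right
    simp only [zero_add, Real.exp_zero, smul_eq_mul] at this
    refine this.congr fun ε => ?_
    ring
  have h2 := (((dps_tendsto (y + h)).sub (dps_tendsto y)).sub (h1.const_mul (rexp y * (rexp h - 1)))).const_mul (rexp (-(y/2)))
  simpa using h2

lemma exp_one_lt3 : rexp 1 < 3 := by linarith [Real.exp_one_lt_d9]

lemma exp_sub_le_two {u : ℝ} (hu : 0 ≤ u) (hu1 : u ≤ 1) : rexp u - 1 ≤ 2 * u := by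
  have := (Real.abs_exp_sub_one_le (x := u) (by rw [abs_of_nonneg hu]; exact hu1))
  rw [abs_of_nonneg hu] at this
  exact (le_abs_self _).trans this

lemma HE_bound {h ε : ℝ} (hh : 0 < h) (hh1 : h ≤ 1) (he : 0 < ε) (he1 : ε ≤ 1) (y : ℝ) :
    |HE h ε y| ≤ 76 * rexp (y/2) := by
  have c1 : rexp (y + h + ε) ≤ 9 * rexp y := by
    rw [add_assoc, Real.exp_add, mul_comm]
    gcongr
    calc rexp (h + ε) ≤ rexp (1 + 1) := Real.exp_le_exp.mpr (by linarith)
      _ = rexp 1 * rexp 1 := Real.exp_add 1 1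
      _ ≤ 3 * 3 := by gcongr <;> exact exp_one_lt3.le
      _ = 9 := by norm_num
  have a1 := dps_nonneg (y := y + h) he
  have a2 := (dps_le (y := y + h) he).trans (cheb_le (Real.exp_nonneg _))
  have a3 := dps_nonneg (y := y) he
  have a4 := (dps_le (y := y) he).trans (cheb_le (Real.exp_nonneg _))
  have c2 : rexp (y + ε) ≤ rexp (y + h + ε) := Real.exp_le_exp.mpr (by linarith)
  have a5 : 0 ≤ rexp h - 1 := by linarith [Real.add_one_le_exp h]
  have a6 := exp_sub_le_two hh.le hh1
  have a7 : 0 ≤ (rexp ε - 1)/ε := div_nonneg (by linarith [Real.add_one_le_exp ε]) he.le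
  have a8 : (rexp ε - 1)/ε ≤ 2 := by rw [div_le_iff₀ he]; exact exp_sub_le_two he.le he1
  have ey := Real.exp_pos y
  have a9 : rexp y * (rexp h - 1) * ((rexp ε - 1) / ε) ≤ rexp y * 2 * 2 := by
    gcongr; linarith
  have a10 : 0 ≤ rexp y * (rexp h - 1) * ((rexp ε - 1) / ε) := by positivity
  unfold HE
  rw [abs_mul, abs_of_pos (Real.exp_pos _)]
  have a11 : |dps ε (y + h) - dps ε y - rexp y * (rexp h - 1) * ((rexp ε - 1) / ε)| ≤ 76 * rexp y := by
    rw [abs_le]; constructor <;> linarith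
  calc _ ≤ rexp (-(y/2)) * (76 * rexp y) := by gcongr
    _ = 76 * (rexp (-(y/2)) * rexp y) := by ring
    _ = _ := by rw [← Real.exp_add]; ring_nf

lemma HH_bound {h : ℝ} (hh : 0 < h) (hh1 : h ≤ 1) (y : ℝ) : |HH h y| ≤ 76 * rexp (y/2) := by
  refine le_of_tendsto (HE_tendsto h y).abs ?_
  filter_upwards [Ioc_mem_nhdsGT (show (0:ℝ) < 1 by norm_num)] with ε he
  exact HE_bound hh hh1 he.1 he.2 y

lemma expw_le (y Y : ℝ) : rexp (-(2 * |y - Y|)) ≤ rexp (2*Y) * rexp (-(2*y)) := by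
  rw [← Real.exp_add]; apply Real.exp_le_exp.mpr; linarith [le_abs_self (y - Y)]

lemma expw_le' (y Y : ℝ) : rexp (-(2 * |y - Y|)) ≤ rexp (-(2*Y)) * rexp (2*y) := by
  rw [← Real.exp_add]; apply Real.exp_le_exp.mpr; linarith [neg_abs_le (y - Y)]

lemma dom_pt (y Y z : ℝ) (hz : |z| ≤ 76 * rexp (y/2)) :
    ‖rexp (-(2 * |y - Y|)) * z^2‖ ≤ 76^2 * rexp (2*Y) * rexp (-y) := by
  rw [Real.norm_of_nonneg (by positivity), ← sq_abs]
  calc _ ≤ (rexp (2*Y) * rexp (-(2*y))) * (76 * rexp (y/2))^2 := by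
        gcongr; exact expw_le y Y
    _ = 76^2 * rexp (2*Y) * (rexp (-(2*y)) * rexp (y/2) * rexp (y/2)) := by ring
    _ = _ := by rw [← Real.exp_add, ← Real.exp_add]; ring_nf

lemma dom_integrable (c Y : ℝ) : IntegrableOn (fun y => 76^2 * rexp (2*Y) * rexp (-y)) (Ioi c) :=
  (integrableOn_exp_neg_Ioi c).const_mul _

lemma HH_integrable {h : ℝ} (hh : 0 < h) (hh1 : h ≤ 1) (c Y : ℝ) :
    IntegrableOn (fun y => rexp (-(2 * |y - Y|)) * HH h y ^2) (Ioi c) := by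
  refine (dom_integrable c Y).mono' (by have := HH_meas h; fun_prop) (Eventually.of_forall fun y => ?_)
  exact dom_pt y Y _ (HH_bound hh hh1 y)

lemma HE_integrable {h ε : ℝ} (hh : 0 < h) (hh1 : h ≤ 1) (he : 0 < ε) (he1 : ε ≤ 1) (c Y : ℝ) :
    IntegrableOn (fun y => rexp (-(2 * |y - Y|)) * HE h ε y ^2) (Ioi c) := by
  refine (dom_integrable c Y).mono' (by have := HE_meas h ε; fun_prop) (Eventually.of_forall fun y => ?_)
  exact dom_pt y Y _ (HE_bound hh hh1 he he1 y)

lemma HEint_tendsto {h : ℝ} (hh : 0 < h) (hh1 : h ≤ 1) (c Y : ℝ) :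
    Tendsto (fun ε => ∫ y in Ioi c, rexp (-(2 * |y - Y|)) * HE h ε y ^2) (𝓝[>] 0)
      (𝓝 (∫ y in Ioi c, rexp (-(2 * |y - Y|)) * HH h y ^2)) := by
  refine tendsto_integral_filter_of_dominated_convergence _ ?_ ?_ (dom_integrable c Y) ?_
  · refine Eventually.of_forall fun ε => ?_
    have := HE_meas h ε
    fun_prop
  · filter_upwards [Ioc_mem_nhdsGT (show (0:ℝ) < 1 by norm_num)] with ε he
    exact Eventually.of_forall fun y => dom_pt y Y _ (HE_bound hh hh1 he.1 he.2 y)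
  · exact Eventually.of_forall fun y => ((HE_tendsto h y).pow 2).const_mul _

/-- elementary inequality -/
lemma sq_compare {a b c η : ℝ} (hη : 0 < η) (ha : 0 ≤ a) (h : |a - b| ≤ c) :
    |a^2 - b^2| ≤ η * a^2 + (1 + 1/η) * c^2 := by
  have hc : 0 ≤ c := (abs_nonneg _).trans h
  have h1 : |a^2 - b^2| ≤ c * (2 * a + c) := by
    rw [sq_sub_sq, abs_mul, mul_comm]
    have : |a + b| ≤ 2 * a + c := by
      have : a + b = 2 * a - (a - b) := by ring
      rw [this]
      refine (abs_sub _ _).trans ?_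
      rw [abs_of_nonneg (by linarith)]; linarith
    gcongr
  refine h1.trans ?_
  have : 2 * a * c ≤ η * a^2 + 1/η * c^2 := by
    have e : η * a^2 + 1/η * c^2 - 2 * a * c = (η * a - c)^2 / η := by field_simp; ring
    have : 0 ≤ (η * a - c)^2 / η := by positivity
    linarith
  nlinarith

end
end GM

open Complex Filter MeasureTheory Real Set
open scoped Topology
namespace GM
noncomputable section

lemma compare_eps {C h ε Y : ℝ} (hh : 0 < h) (hh1 : h ≤ 1) (he : 0 < ε) (he1 : ε ≤ 1)
    (hY : 1 ≤ Y) (hC : ∀ y, 1 ≤ y → ‖PP h ε y + (HE h ε y : ℂ)‖ ≤ C * h * rexp (-(2*y))) :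
    |(∫ y in Ioi 1, rexp (-(2 * |y - Y|)) * HE h ε y ^2) - JE Y h ε| ≤
      rexp (-Y) * (JE Y h ε + 2 * (C*h)^2) + rexp (4 - 2*Y) * JE 0 h ε := by
  have hP := PP_integrable hh hh1 he he1 Y
  have hP0 := PP_integrable hh hh1 he he1 0
  have e1 : JE Y h ε = (∫ y in Iic 1, rexp (-(2 * |y - Y|)) * ‖PP h ε y‖^2) +
      ∫ y in Ioi 1, rexp (-(2 * |y - Y|)) * ‖PP h ε y‖^2 := by
    rw [← parseval_shift hh hh1 he he1 Y, ← integral_add_compl (measurableSet_Iic (a := (1:ℝ))) hP, compl_Iic]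
  have e2 : (∫ y in Iic 1, rexp (-(2 * |y - Y|)) * ‖PP h ε y‖^2) ≤ rexp (4 - 2*Y) * JE 0 h ε := by
    rw [← parseval_shift hh hh1 he he1 0, ← integral_const_mul]
    calc (∫ y in Iic 1, rexp (-(2 * |y - Y|)) * ‖PP h ε y‖^2)
        ≤ ∫ y in Iic 1, rexp (4 - 2*Y) * (rexp (-(2 * |y - 0|)) * ‖PP h ε y‖^2) := by
          refine setIntegral_mono_on hP.integrableOn (hP0.const_mul _).integrableOn measurableSet_Iic ?_
          intro y hy
          rw [← mul_assoc, ← Real.exp_add]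
          gcongr
          rw [sub_zero, abs_of_nonpos (by linarith [mem_Iic.mp hy] : y - Y ≤ 0)]
          have hy1 : y ≤ 1 := hy
          rcases abs_cases y with h | h <;> linarith
      _ ≤ _ := by
          refine setIntegral_le_integral (hP0.const_mul _) (Eventually.of_forall fun y => ?_)
          simp only [Pi.zero_apply]; positivity
  have e3 : 0 ≤ ∫ y in Iic 1, rexp (-(2 * |y - Y|)) * ‖PP h ε y‖^2 :=
    integral_nonneg fun y => by positivity
  set a := ∫ y in Ioi 1, rexp (-(2 * |y - Y|)) * ‖PP h ε y‖^2 with ha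
  set b := ∫ y in Ioi 1, rexp (-(2 * |y - Y|)) * HE h ε y ^2 with hb
  have i2 : IntegrableOn (fun y : ℝ => rexp (-(2*y))) (Ioi 1) := by
    have := integrableOn_exp_mul_Ioi (a := -2) (by norm_num) 1
    simpa using this
  have v2 : ∫ y in Ioi (1:ℝ), rexp (-(2*y)) ≤ 1 := by
    have := integral_exp_mul_Ioi (a := -2) (by norm_num) 1
    have e : ∫ y in Ioi (1:ℝ), rexp (-(2*y)) = ∫ y in Ioi (1:ℝ), rexp (-2*y) := by simp
    rw [e, this]
    have : rexp (-2*1) ≤ 1 := Real.exp_le_one_iff.mpr (by norm_num)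
    rw [neg_div_neg_eq, div_le_one (by norm_num)]; exact this.trans (by norm_num)
  have key : |b - a| ≤ rexp (-Y) * a + rexp (-Y) * (2 * (C*h)^2) := by
    have hi := HE_integrable hh hh1 he he1 1 Y
    rw [hb, ha, ← integral_sub hi hP.integrableOn, ← Real.norm_eq_abs]
    have := norm_integral_le_of_norm_le (μ := volume.restrict (Ioi 1))
      (f := fun y => rexp (-(2 * |y - Y|)) * HE h ε y ^2 - rexp (-(2 * |y - Y|)) * ‖PP h ε y‖^2)
      (g := fun y => rexp (-Y) * (rexp (-(2 * |y - Y|)) * ‖PP h ε y‖^2) + rexp (-Y) * (2 * (C*h)^2) * rexp (-(2*y)))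
      (((hP.integrableOn).const_mul _).add (i2.const_mul _)) ?_
    · refine this.trans ?_
      rw [integral_add ((hP.integrableOn).const_mul _) (i2.const_mul _), integral_const_mul, integral_const_mul]
      exact add_le_add le_rfl (mul_le_of_le_one_right (by positivity) v2)
    · refine (ae_restrict_mem measurableSet_Ioi).mono fun y hy => ?_
      have hy1 : (1:ℝ) ≤ y := le_of_lt hy
      have h1 := hC y hy1
      have h2 : abs (‖PP h ε y‖ - abs (HE h ε y)) ≤ C * h * rexp (-(2*y)) := by
        have := abs_norm_sub_norm_le (PP h ε y) (-(HE h ε y : ℂ))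
        rw [norm_neg, Complex.norm_real, Real.norm_eq_abs, sub_neg_eq_add] at this
        exact this.trans h1
      have h3 := sq_compare (Real.exp_pos (-Y)) (norm_nonneg _) h2
      rw [← mul_sub, norm_mul, Real.norm_of_nonneg (Real.exp_nonneg _), Real.norm_eq_abs, abs_sub_comm (HE h ε y ^ 2)]
      rw [sq_abs] at h3
      have h4 : 1 + 1 / rexp (-Y) ≤ 2 * rexp Y := by
        rw [one_div, Real.exp_neg, inv_inv]
        linarith [Real.one_le_exp (show 0 ≤ Y by linarith)]
      calc _ ≤ rexp (-(2 * |y - Y|)) * (rexp (-Y) * ‖PP h ε y‖^2 + (2 * rexp Y) * (C * h * rexp (-(2*y)))^2) := by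
            gcongr
            refine h3.trans ?_
            gcongr
        _ = rexp (-Y) * (rexp (-(2 * |y - Y|)) * ‖PP h ε y‖^2) + rexp (-(2 * |y - Y|)) * ((2 * rexp Y) * (C * h * rexp (-(2*y)))^2) := by ring
        _ ≤ rexp (-Y) * (rexp (-(2 * |y - Y|)) * ‖PP h ε y‖^2) + (rexp (-(2*Y)) * rexp (2*y)) * ((2 * rexp Y) * (C * h * rexp (-(2*y)))^2) := by
            gcongr
            exact expw_le' y Y
        _ = _ := by
            congr 1
            have : rexp (-(2*Y)) * rexp (2*y) * (rexp Y * (rexp (-(2*y)) * rexp (-(2*y)))) = rexp (-Y) * rexp (-(2*y)) := by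
              simp only [← Real.exp_add]; congr 1; ring
            linear_combination (2 * (C*h)^2) * this
  have hale : a ≤ JE Y h ε := by rw [e1]; linarith
  have : b - JE Y h ε = (b - a) - ∫ y in Iic 1, rexp (-(2 * |y - Y|)) * ‖PP h ε y‖^2 := by rw [e1]; ring
  rw [this]
  refine (abs_sub _ _).trans ?_
  rw [abs_of_nonneg e3, mul_add]
  have := mul_le_mul_of_nonneg_left hale (Real.exp_nonneg (-Y))
  linarith

/-- the prime integral over `y > c` -/
def BI (c Y h : ℝ) : ℝ := ∫ y in Ioi c, rexp (-(2 * |y - Y|)) * HH h y ^2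

lemma exists_compare (hRH : RiemannHypothesis) : ∃ C : ℝ, 0 ≤ C ∧ ∀ h Y : ℝ, 0 < h → h ≤ 1 → 1 ≤ Y →
    |BI 1 Y h - JJ Y h| ≤ C * rexp (-Y) * (h * LL h ^ 2) := by
  obtain ⟨C1, hC1, hb⟩ := exists_trivial_bound hRH
  obtain ⟨C2, hC2, hJ⟩ := exists_JJ_bound
  refine ⟨C2 + 2 * C1^2 + rexp 4 * C2, by positivity, ?_⟩
  intro h Y hh hh1 hY
  have t1 := (HEint_tendsto hh hh1 1 Y)
  have t2 := JE_tendsto hh hh1 Y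
  have t3 := JE_tendsto hh hh1 0
  have l1 := (t1.sub t2).abs
  have l2 := ((t2.add_const (2 * (C1*h)^2)).const_mul (rexp (-Y))).add (t3.const_mul (rexp (4 - 2*Y)))
  have key := le_of_tendsto_of_tendsto l1 l2 (by
    filter_upwards [Ioc_mem_nhdsGT (show (0:ℝ) < 1 by norm_num)] with ε he
    exact compare_eps hh hh1 he.1 he.2 hY (fun y hy => hb h ε y hh hh1 he.1 he.2 hy))
  refine key.trans ?_
  have hL := LL_ge hh hh1
  have b1 := hJ h hh hh1 Y
  have b2 := hJ h hh hh1 0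
  have b3 : h^2 ≤ h * LL h ^ 2 := by
    rw [sq]; exact mul_le_mul_of_nonneg_left (hh1.trans (by nlinarith)) hh.le
  have b4 : rexp (4 - 2*Y) ≤ rexp (-Y) * rexp 4 := by
    rw [← Real.exp_add]; apply Real.exp_le_exp.mpr; linarith
  calc _ ≤ rexp (-Y) * (C2 * (h * LL h ^ 2) + 2 * (C1^2 * (h * LL h ^ 2))) + rexp (-Y) * rexp 4 * (C2 * (h * LL h ^ 2)) := by
        have := JJ_nonneg 0 h
        rw [mul_pow]
        gcongr
    _ = _ := by ring

/-- Comparison from `y > 0`. -/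
lemma exists_compare0 (hRH : RiemannHypothesis) : ∃ C : ℝ, 0 ≤ C ∧ ∀ h Y : ℝ, 0 < h → h ≤ 1 → 1 ≤ Y →
    |BI 0 Y h - JJ Y h| ≤ C * rexp (-Y) * (h * LL h ^ 2) + C * rexp (-(2*Y)) := by
  obtain ⟨C, hC, hb⟩ := exists_compare hRH
  refine ⟨C + 76^2 * rexp 3, by positivity, ?_⟩
  intro h Y hh hh1 hY
  have h1 := hb h Y hh hh1 hY
  have hi := HH_integrable hh hh1 0 Y
  have e : BI 0 Y h = (∫ y in Ioc (0:ℝ) 1, rexp (-(2 * |y - Y|)) * HH h y ^2) + BI 1 Y h := by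
    unfold BI
    rw [← setIntegral_union (Ioc_disjoint_Ioi le_rfl) measurableSet_Ioi
      (hi.mono_set Ioc_subset_Ioi_self) (hi.mono_set (Ioi_subset_Ioi zero_le_one)),
      Ioc_union_Ioi_eq_Ioi zero_le_one]
  have h2 : |∫ y in Ioc (0:ℝ) 1, rexp (-(2 * |y - Y|)) * HH h y ^2| ≤ 76^2 * rexp 3 * rexp (-(2*Y)) := by
    have := norm_setIntegral_le_of_norm_le_const (μ := volume) (s := Ioc (0:ℝ) 1)
      (f := fun y => rexp (-(2 * |y - Y|)) * HH h y ^2) (C := 76^2 * rexp 3 * rexp (-(2*Y))) (by simp) (by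
        intro y hy
        rw [Real.norm_of_nonneg (by positivity), ← sq_abs]
        have := HH_bound hh hh1 y
        calc _ ≤ (rexp (-(2*Y)) * rexp (2*y)) * (76 * rexp (y/2))^2 := by
              gcongr; exact expw_le' y Y
          _ = 76^2 * rexp (3 * y) * rexp (-(2*Y)) := by
              have : rexp (3*y) = rexp (2*y) * (rexp (y/2) * rexp (y/2)) := by
                simp only [← Real.exp_add]; congr 1; ring
              rw [this]; ring
          _ ≤ _ := by gcongr; linarith [hy.2])
    rw [Real.norm_eq_abs] at this
    simpa using this
  rw [e, add_sub_assoc]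
  refine (abs_add_le _ _).trans ?_
  have hL := LL_ge hh hh1
  have p1 : 0 ≤ 76^2 * rexp 3 * rexp (-Y) * (h * LL h ^ 2) := by positivity
  have p2 : 0 ≤ C * rexp (-(2*Y)) := by positivity
  linarith

end
end GM

open Complex Filter MeasureTheory Real Set
open scoped Topology
namespace GM
noncomputable section

/-- squared discrepancy -/
def gd (δ x : ℝ) : ℝ := (chebyshevPsi ((1 + δ) * x) - chebyshevPsi x - δ * x)^2

lemma gd_meas (δ : ℝ) : Measurable (gd δ) := by
  unfold gd
  have := cheb_meas
  fun_prop

lemma gd_nonneg (δ x : ℝ) : 0 ≤ gd δ x := sq_nonneg _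

lemma HH_sq (h y : ℝ) : HH h y ^2 = rexp (-y) * gd (rexp h - 1) (rexp y) := by
  unfold HH gd
  rw [mul_pow, ← Real.exp_nat_mul, show (1 + (rexp h - 1)) * rexp y = rexp (y + h) by rw [Real.exp_add]; ring]
  congr 1
  · congr 1; push_cast; ring
  · ring

lemma weight_eq (y Y : ℝ) : rexp (-(2 * |y - Y|)) * rexp (-y) = rexp y * (rexp Y ^ 2 * max (rexp y) (rexp Y) ^ (-4:ℝ)) := by
  have : max (rexp y) (rexp Y) = rexp (max y Y) := (Real.exp_monotone.map_max).symm
  rw [this, ← Real.exp_mul, ← Real.exp_nat_mul, ← Real.exp_add, ← Real.exp_add, ← Real.exp_add]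
  congr 1
  push_cast
  rcases le_total y Y with h | h
  · rw [max_eq_right h, abs_of_nonpos (by linarith)]; ring
  · rw [max_eq_left h, abs_of_nonneg (by linarith)]; ring

lemma exp_image : rexp '' (Ioi 0) = Ioi 1 := by
  ext x
  simp only [mem_image, mem_Ioi]
  constructor
  · rintro ⟨y, hy, rfl⟩; exact Real.one_lt_exp_iff.mpr hy
  · intro hx; exact ⟨Real.log x, Real.log_pos hx, Real.exp_log (by linarith)⟩

def GG (Y δ x : ℝ) : ℝ := rexp Y ^ 2 * max x (rexp Y) ^ (-4:ℝ) * gd δ x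

lemma GG_comp (h Y : ℝ) : (fun y => |rexp y| • GG Y (rexp h - 1) (rexp y)) =
    fun y => rexp (-(2 * |y - Y|)) * HH h y ^2 := by
  funext y
  rw [HH_sq, ← mul_assoc, weight_eq, abs_of_pos (Real.exp_pos _), smul_eq_mul, GG]; ring

lemma GG_integral (h Y : ℝ) : BI 0 Y h = ∫ x in Ioi 1, GG Y (rexp h - 1) x := by
  rw [← exp_image, integral_image_eq_integral_abs_deriv_smul measurableSet_Ioi
    (fun x _ => (Real.hasDerivAt_exp x).hasDerivWithinAt) Real.exp_injective.injOn, GG_comp]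
  rfl

lemma GG_integrable {h : ℝ} (hh : 0 < h) (hh1 : h ≤ 1) (Y : ℝ) : IntegrableOn (GG Y (rexp h - 1)) (Ioi 1) := by
  rw [← exp_image, integrableOn_image_iff_integrableOn_abs_deriv_smul measurableSet_Ioi
    (fun x _ => (Real.hasDerivAt_exp x).hasDerivWithinAt) Real.exp_injective.injOn, GG_comp]
  exact HH_integrable hh hh1 0 Y

/-- Fubini kernel -/
def fk (Y δ : ℝ) (x v : ℝ) : ℝ := (Ioi x).indicator (fun v => 4 * rexp Y ^ 2 * gd δ x * v ^ (-5:ℝ)) v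

lemma fk_int_v (Y δ x : ℝ) : IntegrableOn (fk Y δ x) (Ioi (rexp Y)) ∧
    ∫ v in Ioi (rexp Y), fk Y δ x v = GG Y δ x := by
  have hm : 0 < max x (rexp Y) := lt_max_of_lt_right (Real.exp_pos _)
  have h1 := (integrableOn_Ioi_rpow_of_lt (show (-5:ℝ) < -1 by norm_num) hm).const_mul (4 * rexp Y ^ 2 * gd δ x)
  constructor
  · unfold fk
    rw [integrableOn_indicator_iff measurableSet_Ioi, Ioi_inter_Ioi]
    exact h1
  · unfold fk
    rw [setIntegral_indicator measurableSet_Ioi, Ioi_inter_Ioi, integral_const_mul, max_comm,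
      integral_Ioi_rpow_of_lt (by norm_num) hm, GG]
    norm_num
    ring

lemma fk_nonneg (Y δ x : ℝ) {v : ℝ} (hv : 0 ≤ v) : 0 ≤ fk Y δ x v := by
  unfold fk
  refine indicator_apply_nonneg fun _ => ?_
  have := gd_nonneg δ x
  positivity

lemma fk_meas (Y δ : ℝ) : Measurable (Function.uncurry (fk Y δ)) := by
  have : Function.uncurry (fk Y δ) = Set.indicator {p : ℝ × ℝ | p.1 < p.2} (fun p => 4 * rexp Y ^ 2 * gd δ p.1 * p.2 ^ (-5:ℝ)) := by
    funext p
    simp only [Function.uncurry, fk, indicator, mem_Ioi, mem_setOf_eq]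
  rw [this]
  refine Measurable.indicator ?_ (measurableSet_lt measurable_fst measurable_snd)
  have := gd_meas δ
  fun_prop

lemma fk_integrable {h : ℝ} (hh : 0 < h) (hh1 : h ≤ 1) (Y : ℝ) :
    Integrable (Function.uncurry (fk Y (rexp h - 1))) ((volume.restrict (Ioi 1)).prod (volume.restrict (Ioi (rexp Y)))) := by
  rw [integrable_prod_iff (fk_meas _ _).aestronglyMeasurable]
  constructor
  · exact Eventually.of_forall fun x => (fk_int_v Y _ x).1
  · refine (GG_integrable hh hh1 Y).congr (Eventually.of_forall fun x => ?_)
    simp only [Function.uncurry]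
    rw [← (fk_int_v Y _ x).2]
    refine setIntegral_congr_fun measurableSet_Ioi fun v hv => ?_
    rw [Real.norm_of_nonneg (fk_nonneg _ _ _ ((Real.exp_pos Y).trans hv).le)]

lemma fk_int_x (Y δ : ℝ) {v : ℝ} (hv : 1 ≤ v) : ∫ x in Ioi 1, fk Y δ x v = 4 * rexp Y ^2 * (v ^ (-5:ℝ) * Imoment v δ) := by
  have : ∀ x, fk Y δ x v = (Iio v).indicator (fun x => 4 * rexp Y ^ 2 * gd δ x * v ^ (-5:ℝ)) x := by
    intro x; simp only [fk, indicator, mem_Ioi, mem_Iio]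
  simp only [this]
  rw [setIntegral_indicator measurableSet_Iio, Ioi_inter_Iio, ← integral_Ioc_eq_integral_Ioo,
    ← intervalIntegral.integral_of_le hv]
  unfold Imoment
  rw [← intervalIntegral.integral_const_mul, ← intervalIntegral.integral_const_mul]
  refine intervalIntegral.integral_congr fun x _ => ?_
  simp only [gd]; ring

/-- The Fubini identity. -/
lemma BI_eq {h : ℝ} (hh : 0 < h) (hh1 : h ≤ 1) {Y : ℝ} (hY : 0 ≤ Y) :
    IntegrableOn (fun v => v ^ (-5:ℝ) * Imoment v (rexp h - 1)) (Ioi (rexp Y)) ∧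
    BI 0 Y h = 4 * rexp Y ^2 * ∫ v in Ioi (rexp Y), v ^ (-5:ℝ) * Imoment v (rexp h - 1) := by
  have hX : 1 ≤ rexp Y := Real.one_le_exp hY
  have e : ∀ v ∈ Ioi (rexp Y), ∫ x in Ioi 1, fk Y (rexp h - 1) x v = 4 * rexp Y ^2 * (v ^ (-5:ℝ) * Imoment v (rexp h - 1)) :=
    fun v hv => fk_int_x Y _ (hX.trans (le_of_lt hv))
  have hi := fk_integrable hh hh1 Y
  constructor
  · have h1 : IntegrableOn (fun v => ∫ x in Ioi 1, fk Y (rexp h - 1) x v) (Ioi (rexp Y)) := hi.integral_prod_right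
    have h2 := (h1.congr_fun e measurableSet_Ioi).const_mul (4 * rexp Y^2)⁻¹
    refine IntegrableOn.congr_fun h2 (fun v _ => ?_) measurableSet_Ioi
    have := Real.exp_pos Y
    field_simp
  · rw [GG_integral, ← integral_const_mul, ← setIntegral_congr_fun measurableSet_Ioi e,
      ← integral_integral_swap hi]
    refine setIntegral_congr_fun measurableSet_Ioi fun x _ => ?_
    exact (fk_int_v Y _ x).2.symm

lemma Imoment_nonneg {v δ : ℝ} (hv : 1 ≤ v) : 0 ≤ Imoment v δ :=
  intervalIntegral.integral_nonneg hv fun x _ => sq_nonneg _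

/-- Crude bound for `I` in terms of the weighted integral. -/
lemma Imoment_le_BI {h : ℝ} (hh : 0 < h) (hh1 : h ≤ 1) {Y : ℝ} (hY : 0 ≤ Y) :
    Imoment (rexp Y) (rexp h - 1) ≤ rexp Y ^2 * BI 0 Y h := by
  have hX : 1 ≤ rexp Y := Real.one_le_exp hY
  have hi := GG_integrable hh hh1 Y
  have h0 := Real.exp_pos Y
  have h1 : ∫ x in Ioc 1 (rexp Y), GG Y (rexp h - 1) x ≤ BI 0 Y h := by
    rw [GG_integral]
    refine setIntegral_mono_set hi ?_ (Ioc_subset_Ioi_self.eventuallyLE)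
    refine (ae_restrict_mem measurableSet_Ioi).mono fun x hx => ?_
    have := gd_nonneg (rexp h - 1) x
    simp only [Pi.zero_apply, GG]
    positivity
  have h2 : ∫ x in Ioc 1 (rexp Y), GG Y (rexp h - 1) x = (rexp Y ^2)⁻¹ * Imoment (rexp Y) (rexp h - 1) := by
    unfold Imoment
    rw [intervalIntegral.integral_of_le hX, ← integral_const_mul]
    refine setIntegral_congr_fun measurableSet_Ioc fun x hx => ?_
    simp only [GG, gd]
    rw [max_eq_right hx.2]
    congr 1
    rw [Real.rpow_neg h0.le, show (4:ℝ) = ((4:ℕ):ℝ) by norm_num, Real.rpow_natCast]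
    field_simp
  rw [h2, inv_mul_eq_div, div_le_iff₀ (by positivity)] at h1
  linarith

end
end GM

open Complex Filter MeasureTheory Real Set
open scoped Topology
namespace GM
noncomputable section

lemma BI_main {h Y ε K D : ℝ} (hh : 0 < h) (hh1 : h ≤ 1) (hY : 1 ≤ Y) (hD : 0 ≤ D) (hε : 0 ≤ ε) 
    (h1 : ∀ v, rexp Y ≤ v → v ≤ rexp Y * Y → |Imoment v (rexp h - 1) - 1/2 * v^2 * D| ≤ ε * (1/2 * v^2 * D))
    (h2 : ∀ v, rexp Y ≤ v → Imoment v (rexp h - 1) ≤ K * v^2) :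
    |BI 0 Y h - D| ≤ (ε + (Y^2)⁻¹) * D + 2 * K * (Y^2)⁻¹ := by
  obtain ⟨hi, he⟩ := BI_eq hh hh1 (show 0 ≤ Y by linarith)
  set X := rexp Y with hX
  have hX0 : 0 < X := Real.exp_pos _
  have hX1 : 1 ≤ X := Real.one_le_exp (by linarith)
  have hXY : X ≤ X * Y := le_mul_of_one_le_right hX0.le hY
  have hXY0 : 0 < X * Y := by positivity
  set f : ℝ → ℝ := fun v => v ^ (-5:ℝ) * Imoment v (rexp h - 1) with hf
  have i3 : ∀ c : ℝ, 0 < c → IntegrableOn (fun v : ℝ => v ^ (-3:ℝ)) (Ioi c) := fun c hc =>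
    integrableOn_Ioi_rpow_of_lt (by norm_num) hc
  have v3 : ∀ c : ℝ, 0 < c → ∫ v in Ioi c, v ^ (-3:ℝ) = (c^2)⁻¹ / 2 := by
    intro c hc
    rw [integral_Ioi_rpow_of_lt (by norm_num) hc, show (-3:ℝ) + 1 = -(2:ℝ) by norm_num, Real.rpow_neg hc.le, Real.rpow_two]
    ring
  have p3 : ∀ v : ℝ, 0 < v → v ^ (-5:ℝ) * v^2 = v ^ (-3:ℝ) := by
    intro v hv
    rw [← Real.rpow_two, ← Real.rpow_add hv]; norm_num
  have split : ∀ g : ℝ → ℝ, IntegrableOn g (Ioi X) → ∫ v in Ioi X, g v = (∫ v in Ioc X (X*Y), g v) + ∫ v in Ioi (X*Y), g v := by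
    intro g hg
    rw [← setIntegral_union (Ioc_disjoint_Ioi le_rfl) measurableSet_Ioi
      (hg.mono_set Ioc_subset_Ioi_self) (hg.mono_set (Ioi_subset_Ioi hXY)), Ioc_union_Ioi_eq_Ioi hXY]
  have s1 := split f hi
  have s2 := split _ (i3 X hX0)
  rw [v3 _ hX0, v3 _ hXY0] at s2
  set Q := ∫ v in Ioc X (X*Y), v ^ (-3:ℝ) with hQ
  have i3c : IntegrableOn (fun v : ℝ => v ^ (-3:ℝ)) (Ioc X (X*Y)) := (i3 X hX0).mono_set Ioc_subset_Ioi_self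
  have a1 : |(∫ v in Ioc X (X*Y), f v) - 1/2 * D * Q| ≤ ε * (1/2 * D) * Q := by
    rw [hQ, ← integral_const_mul, ← integral_const_mul, ← integral_sub (hi.mono_set Ioc_subset_Ioi_self) (i3c.const_mul _), ← Real.norm_eq_abs]
    refine norm_integral_le_of_norm_le (i3c.const_mul _) ?_
    refine (ae_restrict_mem measurableSet_Ioc).mono fun v hv => ?_
    have hv0 : 0 < v := hX0.trans hv.1
    have := h1 v hv.1.le hv.2
    have e : f v - 1/2 * D * v ^ (-3:ℝ) = v ^ (-5:ℝ) * (Imoment v (rexp h - 1) - 1/2 * v^2 * D) := by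
      rw [← p3 v hv0, hf]; ring
    rw [e, norm_mul, Real.norm_of_nonneg (by positivity), Real.norm_eq_abs]
    calc _ ≤ v ^ (-5:ℝ) * (ε * (1/2 * v^2 * D)) := by gcongr
      _ = _ := by rw [← p3 v hv0]; ring
  have a2 : ∫ v in Ioi (X*Y), f v ≤ K * (((X*Y)^2)⁻¹/2) := by
    rw [← v3 _ hXY0, ← integral_const_mul]
    refine setIntegral_mono_on (hi.mono_set (Ioi_subset_Ioi hXY)) ((i3 _ hXY0).const_mul _) measurableSet_Ioi ?_
    intro v hv
    have hv0 : 0 < v := hXY0.trans hv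
    rw [← p3 v hv0, hf]
    have := h2 v (hXY.trans (le_of_lt hv))
    calc _ ≤ v ^ (-5:ℝ) * (K * v^2) := mul_le_mul_of_nonneg_left this (by positivity)
      _ = _ := by ring
  have a3 : 0 ≤ ∫ v in Ioi (X*Y), f v := by
    refine setIntegral_nonneg measurableSet_Ioi fun v hv => ?_
    have hv1 : 1 ≤ v := (hX1.trans hXY).trans (le_of_lt hv)
    exact mul_nonneg (by positivity) (Imoment_nonneg hv1)
  rw [he, s1]
  have eQ : 4 * X^2 * (1/2 * Q) = 1 - (Y^2)⁻¹ := by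
    have : Q = (X^2)⁻¹/2 - ((X*Y)^2)⁻¹/2 := by linarith
    rw [this]; field_simp; ring
  have hYi : 0 ≤ (Y^2)⁻¹ := by positivity
  have eK : 4 * X^2 * (K * (((X*Y)^2)⁻¹/2)) = 2 * K * (Y^2)⁻¹ := by field_simp; ring
  have b1 := mul_le_mul_of_nonneg_left a1 (show 0 ≤ 4 * X^2 by positivity)
  rw [← abs_of_nonneg (show 0 ≤ 4 * X^2 by positivity), ← abs_mul, abs_of_nonneg (show 0 ≤ 4 * X^2 by positivity)] at b1
  have b2 := mul_le_mul_of_nonneg_left a2 (show 0 ≤ 4 * X^2 by positivity)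
  have b3 := mul_nonneg (show 0 ≤ 4 * X^2 by positivity) a3
  rw [eK] at b2
  have e4 : 4 * X^2 * ((∫ v in Ioc X (X*Y), f v) - 1/2 * D * Q) = 4 * X^2 * (∫ v in Ioc X (X*Y), f v) - D * (1 - (Y^2)⁻¹) := by
    rw [← eQ]; ring
  have e5 : 4 * X^2 * (ε * (1/2 * D) * Q) = ε * D * (1 - (Y^2)⁻¹) := by rw [← eQ]; ring
  rw [e4, e5] at b1
  have b4 : ε * D * (1 - (Y^2)⁻¹) ≤ ε * D := mul_le_of_le_one_right (by positivity) (by linarith)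
  have b5 : 0 ≤ D * (Y^2)⁻¹ := by positivity
  rw [abs_le] at b1 ⊢
  constructor <;> nlinarith [b1.1, b1.2]

/-- Uniform crude bound. -/
lemma exists_crude (hRH : RiemannHypothesis) : ∃ C : ℝ, 0 ≤ C ∧ ∀ h v : ℝ, 0 < h → h ≤ 1 → rexp 1 ≤ v → v⁻¹ ^ 2 ≤ h →
    Imoment v (rexp h - 1) ≤ C * (h * LL h ^ 2) * v^2 := by
  obtain ⟨C1, hC1, hb⟩ := exists_compare0 hRH
  obtain ⟨C2, hC2, hJ⟩ := exists_JJ_bound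
  refine ⟨2 * C1 + C2, by positivity, ?_⟩
  intro h v hh hh1 hv hvh
  have hv0 : 0 < v := (Real.exp_pos _).trans_le hv
  have hY : 1 ≤ Real.log v := (Real.le_log_iff_exp_le hv0).mpr hv
  have h1 := Imoment_le_BI hh hh1 (show 0 ≤ Real.log v by linarith)
  rw [Real.exp_log hv0] at h1
  have h2 := hb h (Real.log v) hh hh1 hY
  have h3 := hJ h hh hh1 (Real.log v)
  have hL := LL_ge hh hh1
  have h4 : rexp (-(Real.log v)) ≤ 1 := Real.exp_le_one_iff.mpr (by linarith)
  have h5 : rexp (-(2 * Real.log v)) = v⁻¹^2 := by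
    rw [show -(2 * Real.log v) = -Real.log v + -Real.log v by ring, Real.exp_add, Real.exp_neg, Real.exp_log hv0]; ring
  have h6 : h ≤ h * LL h ^2 := le_mul_of_one_le_right hh.le (by nlinarith)
  have h7 : C1 * rexp (-(Real.log v)) * (h * LL h ^2) ≤ C1 * 1 * (h * LL h ^2) := by gcongr
  have h8 : C1 * rexp (-(2 * Real.log v)) ≤ C1 * (h * LL h ^2) := by
    rw [h5]; gcongr; linarith
  have h9 := (abs_le.mp h2).2
  refine h1.trans ?_
  rw [mul_comm]
  gcongr
  linarith

end
end GM

open Complex Filter MeasureTheory Real Set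
open scoped Topology
namespace GM
noncomputable section

/-- The hypothesis on the second moment. -/
def HypI (A₁ A₂ : ℝ) : Prop := ∀ ε : ℝ, 0 < ε → ∃ X₀ : ℝ, ∀ X : ℝ, X₀ ≤ X → ∀ δ : ℝ,
      X ^ (-(1 / A₁)) * (Real.log X)⁻¹ ^ 3 ≤ δ → δ ≤ X ^ (-(1 / A₂)) * (Real.log X) ^ 3 →
        |Imoment X δ - 1 / 2 * δ * X ^ 2 * Real.log (1 / δ)|
          ≤ ε * (1 / 2 * δ * X ^ 2 * Real.log (1 / δ))

lemma range_low {A₁ κ T v δ : ℝ} (hA : 1 ≤ A₁) (hκ : 0 < κ) (hT : 1 < T) (hv : T ^ A₁ ≤ v)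
    (hδ : κ / T ≤ δ) (hl : κ⁻¹ ≤ (Real.log T)^3) :
    v ^ (-(1 / A₁)) * (Real.log v)⁻¹ ^ 3 ≤ δ := by
  have hT0 : 0 < T := by linarith
  have hTv : T ≤ v := le_trans (by simpa using Real.rpow_le_rpow_of_exponent_le hT.le hA) hv
  have hLT : 0 < Real.log T := Real.log_pos hT
  have hlv : Real.log T ≤ Real.log v := Real.log_le_log hT0 hTv
  have h1 : v ^ (-(1 / A₁)) ≤ T⁻¹ := by
    calc v ^ (-(1 / A₁)) ≤ (T ^ A₁) ^ (-(1/A₁)) :=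
          Real.rpow_le_rpow_of_nonpos (by positivity) hv (by have : 0 ≤ 1/A₁ := by positivity
                                                             linarith)
      _ = T⁻¹ := by
          rw [← Real.rpow_mul hT0.le, show A₁ * (-(1/A₁)) = -1 by field_simp, Real.rpow_neg_one]
  have h2 : (Real.log v)⁻¹ ^ 3 ≤ κ := by
    rw [inv_pow]
    refine inv_le_of_inv_le₀ hκ (hl.trans ?_)
    gcongr
  calc _ ≤ T⁻¹ * κ := by
        have : 0 < (Real.log v)⁻¹ := by have := hLT.trans_le hlv; positivity
        gcongr
    _ = κ / T := by ring
    _ ≤ δ := hδ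

lemma range_up {A₂ κ T X v δ : ℝ} (hA : 1 ≤ A₂) (hT : 1 < T) (hTX : T ≤ X) (hXT : X ≤ T ^ A₂)
    (hXv : X ≤ v) (hv : v ≤ X * Real.log X)
    (hδ : δ ≤ 2 * κ / T) (hl1 : 1 ≤ Real.log T) (hl : 2 * κ * A₂ ≤ (Real.log T)^2) :
    δ ≤ v ^ (-(1 / A₂)) * (Real.log v) ^ 3 := by
  have hT0 : 0 < T := by linarith
  have hX0 : 0 < X := by linarith
  have hv0 : 0 < v := by linarith
  have hLT : 0 < Real.log T := Real.log_pos hT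
  have hlv : Real.log T ≤ Real.log v := Real.log_le_log hT0 (hTX.trans hXv)
  have hlX : Real.log X ≤ A₂ * Real.log T := by
    rw [← Real.log_rpow hT0]; exact Real.log_le_log hX0 hXT
  have hlX0 : 0 ≤ Real.log X := Real.log_nonneg (by linarith)
  have hAL : 1 ≤ A₂ * Real.log T := by nlinarith
  have hv2 : v ≤ T ^ A₂ * (A₂ * Real.log T) := hv.trans (by gcongr)
  have hi : -1 ≤ -(1/A₂) := by
    have : 1 / A₂ ≤ 1 := by rw [div_le_one (by linarith)]; exact hA
    linarith
  have h1 : T⁻¹ * (A₂ * Real.log T)⁻¹ ≤ v ^ (-(1 / A₂)) := by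
    calc T⁻¹ * (A₂ * Real.log T)⁻¹ ≤ T⁻¹ * (A₂ * Real.log T) ^ (-(1/A₂)) := by
          rw [← Real.rpow_neg_one (A₂ * Real.log T)]
          gcongr
      _ = (T ^ A₂ * (A₂ * Real.log T)) ^ (-(1/A₂)) := by
          rw [Real.mul_rpow (x := T ^ A₂) (by positivity) (by positivity), ← Real.rpow_mul hT0.le, show A₂ * (-(1/A₂)) = -1 by field_simp, Real.rpow_neg_one]
      _ ≤ v ^ (-(1/A₂)) := Real.rpow_le_rpow_of_nonpos hv0 hv2 (by have : 0 ≤ 1/A₂ := by positivity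
                                                                   linarith)
  calc δ ≤ 2 * κ / T := hδ
    _ ≤ T⁻¹ * (A₂ * Real.log T)⁻¹ * (Real.log T)^3 := by
        rw [show T⁻¹ * (A₂ * Real.log T)⁻¹ * (Real.log T)^3 = ((Real.log T)^2 / A₂) / T by field_simp]
        gcongr
        rw [le_div_iff₀ (by linarith)]; exact hl
    _ ≤ _ := by gcongr

/-- Main error estimate, uniform in `X`. -/
lemma BI_error (hRH : RiemannHypothesis) {A₁ A₂ : ℝ} (hA₁ : 1 ≤ A₁) (hA₁₂ : A₁ ≤ A₂) (hI : HypI A₁ A₂) :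
    ∃ C : ℝ, 0 ≤ C ∧ ∀ κ : ℝ, 0 < κ → ∀ ε : ℝ, 0 < ε → ∀ᶠ T in atTop, ∀ X : ℝ, T ^ A₁ ≤ X → X ≤ T ^ A₂ →
      |BI 0 (Real.log X) (κ / T) - (rexp (κ/T) - 1) * Real.log (1 / (rexp (κ/T) - 1))| ≤
        (ε + (Real.log T ^ 2)⁻¹) * ((rexp (κ/T) - 1) * Real.log (1 / (rexp (κ/T) - 1)))
          + C * (κ / T * LL (κ / T)^2) * (Real.log T ^ 2)⁻¹ := by
  obtain ⟨C, hC, hcr⟩ := exists_crude hRH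
  refine ⟨2 * C, by positivity, ?_⟩
  intro κ hκ ε hε
  obtain ⟨X₀, hX₀⟩ := hI ε hε
  have hA₂ : 1 ≤ A₂ := hA₁.trans hA₁₂
  have hlog := Real.tendsto_log_atTop
  filter_upwards [eventually_ge_atTop X₀, eventually_ge_atTop (rexp 1), eventually_ge_atTop (2 * κ), eventually_ge_atTop κ⁻¹,
    (tendsto_pow_atTop (two_ne_zero)).comp hlog |>.eventually_ge_atTop (2 * κ * A₂),
    (tendsto_pow_atTop (three_ne_zero)).comp hlog |>.eventually_ge_atTop κ⁻¹] with T t1 t2 t3 t4 t5 t6 X hX1 hX2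
  simp only [Function.comp] at t5 t6
  have hT1 : 1 < T := lt_of_lt_of_le (by simp) t2
  have hT0 : 0 < T := by linarith
  have hL1 : 1 ≤ Real.log T := (Real.le_log_iff_exp_le hT0).mpr t2
  have hTX : T ≤ X := le_trans (by simpa using Real.rpow_le_rpow_of_exponent_le hT1.le hA₁) hX1
  have hX0 : 0 < X := by linarith
  have hLX : Real.log T ≤ Real.log X := Real.log_le_log hT0 hTX
  have hh : 0 < κ / T := by positivity
  have hh2 : κ / T ≤ 1/2 := by rw [div_le_iff₀ hT0]; linarith
  have hδ1 : κ / T ≤ rexp (κ/T) - 1 := by linarith [Real.add_one_le_exp (κ/T)]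
  have hδ2 : rexp (κ/T) - 1 ≤ 2 * κ / T := by
    have := exp_sub_le_two hh.le (by linarith : κ / T ≤ 1)
    rwa [← mul_div_assoc] at this
  have hδ3 : rexp (κ/T) - 1 ≤ 1 := by
    have : 2 * κ / T ≤ 1 := by rw [div_le_iff₀ hT0]; linarith
    linarith
  have hδ0 : 0 < rexp (κ/T) - 1 := by linarith
  set δ := rexp (κ/T) - 1 with hδ
  have hD : 0 ≤ δ * Real.log (1/δ) := by
    refine mul_nonneg hδ0.le (Real.log_nonneg ?_)
    rw [le_div_iff₀ hδ0]; linarith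
  have key := BI_main (h := κ/T) (Y := Real.log X) (ε := ε) (K := C * (κ/T * LL (κ/T)^2)) (D := δ * Real.log (1/δ)) hh (by linarith) (by linarith) hD hε.le
    (by
      rw [Real.exp_log hX0]
      intro v hv1 hv2
      have := hX₀ v (by linarith) δ (range_low hA₁ hκ hT1 (hX1.trans hv1) hδ1 t6)
        (range_up hA₂ hT1 hTX hX2 hv1 hv2 hδ2 hL1 t5)
      rw [show 1/2 * v^2 * (δ * Real.log (1/δ)) = 1/2 * δ * v^2 * Real.log (1/δ) by ring]
      exact this)
    (by
      rw [Real.exp_log hX0]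
      intro v hv
      have hvT : T ≤ v := hTX.trans hv
      have hv0 : 0 < v := by linarith
      refine hcr (κ/T) v hh (by linarith) (t2.trans hvT) ?_
      have e1 : v⁻¹ ≤ T⁻¹ := by gcongr
      have e2 : T⁻¹ ≤ κ := inv_le_of_inv_le₀ hκ t4
      calc v⁻¹^2 = v⁻¹ * v⁻¹ := by ring
        _ ≤ κ * T⁻¹ := by
            have : 0 ≤ v⁻¹ := by positivity
            exact mul_le_mul (e1.trans e2) e1 this hκ.le
        _ = κ / T := by ring)
  have hY : (Real.log X ^ 2)⁻¹ ≤ (Real.log T ^ 2)⁻¹ := by gcongr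
  refine key.trans ?_
  have hhL : 0 ≤ κ / T * LL (κ/T)^2 := by positivity
  calc _ ≤ (ε + (Real.log T ^ 2)⁻¹) * (δ * Real.log (1/δ)) + 2 * (C * (κ/T * LL (κ/T)^2)) * (Real.log T ^ 2)⁻¹ := by
        gcongr
    _ = _ := by ring

end
end GM

open Complex Filter MeasureTheory Real Set
open scoped Topology
namespace GM
noncomputable section

lemma tendsto_h (κ : ℝ) : Tendsto (fun T : ℝ => κ / T) atTop (𝓝 0) := tendsto_const_nhds.div_atTop tendsto_id

lemma tendsto_invlog : Tendsto (fun T : ℝ => (Real.log T)⁻¹) atTop (𝓝 0) := Real.tendsto_log_atTop.inv_tendsto_atTop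

lemma tendsto_LL {κ : ℝ} (hκ : 0 < κ) : Tendsto (fun T : ℝ => LL (κ / T) * (Real.log T)⁻¹) atTop (𝓝 1) := by
  have h : Tendsto (fun T : ℝ => (1 - Real.log κ) * (Real.log T)⁻¹ + 1) atTop (𝓝 ((1 - Real.log κ) * 0 + 1)) :=
    (tendsto_invlog.const_mul _).add_const _
  rw [mul_zero, zero_add] at h
  refine h.congr' ?_
  filter_upwards [eventually_gt_atTop 1] with T hT
  have : 0 < Real.log T := Real.log_pos hT
  unfold LL
  rw [Real.log_div hκ.ne' (by linarith)]
  field_simp; ring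

lemma tendsto_ratio {κ : ℝ} (hκ : 0 < κ) : Tendsto (fun T : ℝ => (rexp (κ/T) - 1) / (κ/T)) atTop (𝓝 1) := by
  have h1 : Tendsto (fun h : ℝ => (rexp h - 1) / h) (𝓝[≠] 0) (𝓝 1) := by
    have := (Real.hasDerivAt_exp 0).tendsto_slope_zero
    simp only [zero_add, Real.exp_zero, smul_eq_mul] at this
    exact this.congr fun x => by ring
  refine h1.comp ?_
  rw [tendsto_nhdsWithin_iff]
  refine ⟨tendsto_h κ, ?_⟩
  filter_upwards [eventually_gt_atTop 0] with T hT
  simp; constructor <;> linarith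

lemma tendsto_main {κ : ℝ} (hκ : 0 < κ) :
    Tendsto (fun T : ℝ => T / Real.log T * ((rexp (κ/T) - 1) * Real.log (1 / (rexp (κ/T) - 1)))) atTop (𝓝 κ) := by
  have hr := tendsto_ratio hκ
  have hlr : Tendsto (fun T : ℝ => Real.log ((rexp (κ/T) - 1) / (κ/T))) atTop (𝓝 0) := by
    have := (Real.continuousAt_log (one_ne_zero)).tendsto.comp hr
    rwa [Real.log_one] at this
  have h : Tendsto (fun T : ℝ => (rexp (κ/T) - 1) / (κ/T) * κ * (1 + (-Real.log ((rexp (κ/T) - 1) / (κ/T)) - Real.log κ) * (Real.log T)⁻¹)) atTop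
      (𝓝 (1 * κ * (1 + (-0 - Real.log κ) * 0))) :=
    (hr.mul_const _).mul (((hlr.neg.sub_const _).mul tendsto_invlog).const_add _)
  rw [mul_zero, add_zero, one_mul, mul_one] at h
  refine h.congr' ?_
  filter_upwards [eventually_gt_atTop 1] with T hT
  have hL : 0 < Real.log T := Real.log_pos hT
  have hT0 : 0 < T := by linarith
  have hh : 0 < κ / T := by positivity
  have hδ : 0 < rexp (κ/T) - 1 := by linarith [Real.add_one_le_exp (κ/T)]
  rw [Real.log_div hδ.ne' hh.ne', Real.log_div hκ.ne' hT0.ne', one_div, Real.log_inv]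
  field_simp
  ring

lemma tendsto_e1 {κ : ℝ} (hκ : 0 < κ) :
    Tendsto (fun T : ℝ => T / Real.log T * ((κ / T * LL (κ / T)^2) * (Real.log T ^ 2)⁻¹)) atTop (𝓝 0) := by
  have h := ((tendsto_LL hκ).pow 2).mul (tendsto_invlog.const_mul κ)
  rw [mul_zero, mul_zero] at h
  refine h.congr' ?_
  filter_upwards [eventually_gt_atTop 1] with T hT
  have hL : 0 < Real.log T := Real.log_pos hT
  have hT0 : 0 < T := by linarith
  field_simp

lemma tendsto_logpow {s : ℝ} (hs : 0 < s) : Tendsto (fun T : ℝ => Real.log T * T ^ (-s)) atTop (𝓝 0) := by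
  have := (isLittleO_log_rpow_atTop hs).tendsto_div_nhds_zero
  refine this.congr' ?_
  filter_upwards [eventually_gt_atTop 0] with T hT
  rw [Real.rpow_neg hT.le]; rfl

lemma tendsto_e2 {κ : ℝ} (hκ : 0 < κ) :
    Tendsto (fun T : ℝ => T / Real.log T * (T⁻¹ * (κ / T * LL (κ / T)^2))) atTop (𝓝 0) := by
  have h := ((tendsto_LL hκ).pow 2).mul ((tendsto_logpow one_pos).const_mul κ)
  rw [mul_zero, mul_zero] at h
  refine h.congr' ?_
  filter_upwards [eventually_gt_atTop 1] with T hT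
  have hL : 0 < Real.log T := Real.log_pos hT
  have hT0 : 0 < T := by linarith
  rw [Real.rpow_neg_one]
  field_simp

lemma tendsto_e3 : Tendsto (fun T : ℝ => T / Real.log T * (T⁻¹^2)) atTop (𝓝 0) := by
  have h := tendsto_invlog.mul (tendsto_inv_atTop_zero (𝕜 := ℝ))
  rw [mul_zero] at h
  refine h.congr' ?_
  filter_upwards [eventually_gt_atTop 1] with T hT
  have hL : 0 < Real.log T := Real.log_pos hT
  have hT0 : 0 < T := by linarith
  field_simp

lemma tendsto_e4 {κ : ℝ} (hκ : 0 < κ) :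
    Tendsto (fun T : ℝ => T / Real.log T * ((κ / T)^(5/4:ℝ) * LL (κ / T)^2)) atTop (𝓝 0) := by
  have h := ((tendsto_LL hκ).pow 2).mul ((tendsto_logpow (show (0:ℝ) < 1/4 by norm_num)).const_mul (κ^(5/4:ℝ)))
  rw [mul_zero, mul_zero] at h
  refine h.congr' ?_
  filter_upwards [eventually_gt_atTop 1] with T hT
  have hL : 0 < Real.log T := Real.log_pos hT
  have hT0 : 0 < T := by linarith
  have e : T ^ (-(1/4):ℝ) = T / T ^ (5/4:ℝ) := by
    rw [show (-(1/4):ℝ) = 1 - 5/4 by norm_num, Real.rpow_sub hT0, Real.rpow_one]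
  rw [e, Real.div_rpow hκ.le hT0.le]
  have : 0 < T ^ (5/4:ℝ) := by positivity
  field_simp

/-- Main asymptotic: smoothed mean value. -/
lemma main_conv (hRH : RiemannHypothesis) {A₁ A₂ : ℝ} (hA₁ : 1 ≤ A₁) (hA₁₂ : A₁ ≤ A₂) (hI : HypI A₁ A₂)
    {κ : ℝ} (hκ : 0 < κ) {η : ℝ} (hη : 0 < η) : ∀ᶠ T in atTop, ∀ X : ℝ, T ^ A₁ ≤ X → X ≤ T ^ A₂ →
      |T / Real.log T * (2/π * ∫ t, ‖avs 0 (κ / T) t * W S1 (Real.log X) t‖^2) - κ| ≤ η := by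
  obtain ⟨C1, hC1, H1⟩ := BI_error hRH hA₁ hA₁₂ hI
  obtain ⟨C2, hC2, H2⟩ := exists_compare0 hRH
  obtain ⟨C3, hC3, H3⟩ := exists_JJ_approx
  set ε := η / (4 * (κ + 1)) with hε
  have hε0 : 0 < ε := by positivity
  have lim1 := tendsto_main hκ
  have lim2 : Tendsto (fun T : ℝ => (ε + (Real.log T ^ 2)⁻¹) * (T / Real.log T * ((rexp (κ/T) - 1) * Real.log (1 / (rexp (κ/T) - 1))))
      + C1 * (T / Real.log T * ((κ / T * LL (κ / T)^2) * (Real.log T ^ 2)⁻¹))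
      + C2 * (T / Real.log T * (T⁻¹ * (κ / T * LL (κ / T)^2))) + C2 * (T / Real.log T * (T⁻¹^2))
      + C3 * (T / Real.log T * ((κ / T)^(5/4:ℝ) * LL (κ / T)^2))) atTop
      (𝓝 ((ε + 0) * κ + C1 * 0 + C2 * 0 + C2 * 0 + C3 * 0)) := by
    have h0 : Tendsto (fun T : ℝ => (Real.log T ^ 2)⁻¹) atTop (𝓝 0) := by
      have := tendsto_invlog.pow 2
      simpa [inv_pow] using this
    exact (((((h0.const_add ε).mul lim1).add ((tendsto_e1 hκ).const_mul C1)).add ((tendsto_e2 hκ).const_mul C2)).add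
      (tendsto_e3.const_mul C2)).add ((tendsto_e4 hκ).const_mul C3)
  have hlt : (ε + 0) * κ + C1 * 0 + C2 * 0 + C2 * 0 + C3 * 0 < η / 2 := by
    simp only [mul_zero, add_zero, hε]
    rw [div_mul_eq_mul_div, div_lt_div_iff₀ (by positivity) (by norm_num)]
    nlinarith
  have ev1 : ∀ᶠ T in atTop, |T / Real.log T * ((rexp (κ/T) - 1) * Real.log (1 / (rexp (κ/T) - 1))) - κ| < η / 2 := by
    have := (Metric.tendsto_nhds.mp lim1) (η/2) (by positivity)
    simpa [Real.dist_eq] using this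
  filter_upwards [H1 κ hκ ε hε0, lim2.eventually_lt_const hlt, ev1, eventually_ge_atTop (rexp 1), eventually_ge_atTop κ] with T g1 g2 g3 t1 t2 X hX1 hX2
  have hT1 : 1 < T := lt_of_lt_of_le (by simp) t1
  have hT0 : 0 < T := by linarith
  have hL1 : 1 ≤ Real.log T := (Real.le_log_iff_exp_le hT0).mpr t1
  have hTX : T ≤ X := le_trans (by simpa using Real.rpow_le_rpow_of_exponent_le hT1.le hA₁) hX1
  have hX0 : 0 < X := by linarith
  have hLX : Real.log T ≤ Real.log X := Real.log_le_log hT0 hTX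
  have hh : 0 < κ / T := by positivity
  have hh1 : κ / T ≤ 1 := by rw [div_le_iff₀ hT0]; linarith
  have k1 := g1 X hX1 hX2
  have k2 := H2 (κ/T) (Real.log X) hh hh1 (by linarith)
  have k3 := H3 (κ/T) hh hh1 (Real.log X)
  have x1 : rexp (-(Real.log X)) ≤ T⁻¹ := by
    rw [Real.exp_neg, Real.exp_log hX0]; gcongr
  have x2 : rexp (-(2 * Real.log X)) ≤ T⁻¹^2 := by
    rw [show -(2 * Real.log X) = -Real.log X + -Real.log X by ring, Real.exp_add, ← sq]; gcongr
  have hhL : 0 ≤ κ / T * LL (κ/T)^2 := by positivity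
  have k2' : |BI 0 (Real.log X) (κ/T) - JJ (Real.log X) (κ/T)| ≤ C2 * T⁻¹ * (κ / T * LL (κ/T)^2) + C2 * T⁻¹^2 :=
    k2.trans (by gcongr)
  set D := (rexp (κ/T) - 1) * Real.log (1 / (rexp (κ/T) - 1)) with hD
  set Z := 2/π * ∫ t, ‖avs 0 (κ / T) t * W S1 (Real.log X) t‖^2 with hZ
  have tot : |Z - D| ≤ (ε + (Real.log T ^ 2)⁻¹) * D + C1 * (κ / T * LL (κ / T)^2) * (Real.log T ^ 2)⁻¹ +
      (C2 * T⁻¹ * (κ / T * LL (κ/T)^2) + C2 * T⁻¹^2) + C3 * ((κ/T)^(5/4:ℝ) * LL (κ/T)^2) := by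
    rw [abs_le] at *
    constructor <;> linarith [k1.1, k1.2, k2'.1, k2'.2, k3.1, k3.2]
  have hq : 0 ≤ T / Real.log T := by positivity
  have tot2 := mul_le_mul_of_nonneg_left tot hq
  rw [show T / Real.log T * |Z - D| = |T / Real.log T * Z - T / Real.log T * D| by
    rw [← mul_sub, abs_mul, abs_of_nonneg hq]] at tot2
  have tri := abs_sub_le (T / Real.log T * Z) (T / Real.log T * D) κ
  refine tri.trans ?_
  have : |T / Real.log T * Z - T / Real.log T * D| ≤ η / 2 := by
    refine tot2.trans (le_trans (le_of_eq ?_) g2.le)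
    ring
  linarith

end
end GM

open Complex Filter MeasureTheory Real Set
open scoped Topology
namespace GM
noncomputable section

/-- Fejer type kernel -/
def KK (c u : ℝ) : ℝ := 2 * (1 - Real.cos (c * u)) / u^2

lemma KK_nonneg (c u : ℝ) : 0 ≤ KK c u := by
  unfold KK
  have := Real.cos_le_one (c * u)
  exact div_nonneg (by linarith) (by positivity)

lemma KK_meas (c : ℝ) : Measurable (KK c) := by unfold KK; fun_prop

lemma KK_le (c u : ℝ) : KK c u ≤ (c^2 + 4) * (1 + u^2)⁻¹ := by
  rw [← div_eq_mul_inv, le_div_iff₀ (by positivity)]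
  have h1 : KK c u * u^2 ≤ 4 := by
    unfold KK
    by_cases hu : u = 0
    · simp [hu]
    · rw [div_mul_cancel₀ _ (by positivity)]; linarith [Real.neg_one_le_cos (c * u)]
  have h2 : KK c u ≤ c^2 := by
    unfold KK
    by_cases hu : u = 0
    · simp [hu]; positivity
    · rw [div_le_iff₀ (by positivity)]
      have := Real.one_sub_sq_div_two_le_cos (x := c * u)
      nlinarith
  linarith

lemma KK_int (c : ℝ) : Integrable (KK c) := by
  refine (integrable_inv_one_add_sq.const_mul (c^2 + 4)).mono' (KK_meas c).aestronglyMeasurable ?_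
  refine Eventually.of_forall fun u => ?_
  rw [Real.norm_of_nonneg (KK_nonneg c u)]
  exact KK_le c u

lemma KK_neg_left (c u : ℝ) : KK (-c) u = KK c u := by
  unfold KK; rw [neg_mul, Real.cos_neg]

lemma KK_abs_left (c u : ℝ) : KK |c| u = KK c u := by
  rcases abs_choice c with h | h <;> rw [h]
  exact KK_neg_left c u

lemma KK_even (c u : ℝ) : KK c (-u) = KK c u := by
  unfold KK; rw [mul_neg, Real.cos_neg, neg_sq]

lemma KK_shift (c u : ℝ) : Real.cos (c * u) * KK 1 u = 1/2 * (KK (c+1) u + KK (c-1) u - 2 * KK c u) := by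
  unfold KK
  rw [add_mul, sub_mul, one_mul, Real.cos_add, Real.cos_sub]
  ring

def tri (y : ℝ) : ℝ := max 0 (1 - |y|)

lemma tri_cont : Continuous tri := by unfold tri; fun_prop

lemma tri_eq (x : ℝ) : tri x = 1/2 * (|x+1| + |x-1| - 2 * |x|) := by
  unfold tri
  rcases le_total 0 x with h | h <;> rcases le_total 0 (x+1) with h1 | h1 <;> rcases le_total 0 (x-1) with h2 | h2 <;>
   simp only [abs_of_nonneg, abs_of_nonpos, h, h1, h2] <;>
   first
   | (rw [max_eq_left (by linarith)]; linarith)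
   | (rw [max_eq_right (by linarith)]; linarith)

lemma tri_int_half {z : ℂ} (hz : z ≠ 0) : ∫ y in (0:ℝ)..1, ((1 - y : ℝ) : ℂ) * cexp (z * y) = cexp z / z^2 - 1/z - 1/z^2 := by
  have hd : ∀ y ∈ uIcc (0:ℝ) 1, HasDerivAt (fun y : ℝ => ((1:ℂ) - y) * cexp (z * y) / z + cexp (z * y) / z^2)
      (((1 - y : ℝ) : ℂ) * cexp (z * y)) y := by
    intro y _
    have h0 : HasDerivAt (fun y : ℝ => (y:ℂ)) 1 y := Complex.ofRealCLM.hasDerivAt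
    have h1 : HasDerivAt (fun y : ℝ => cexp (z * y)) (cexp (z * y) * (z * 1)) y := (h0.const_mul z).cexp
    have h2 := (((h0.const_sub 1).mul h1).div_const z).add (h1.div_const (z^2))
    have e : ((1 - y : ℝ) : ℂ) * cexp (z * y) = (-1 * cexp (z * y) + ((1:ℂ) - y) * (cexp (z * y) * (z * 1))) / z + cexp (z * y) * (z * 1) / z^2 := by
      push_cast
      field_simp
      ring
    rw [e]
    exact h2
  rw [intervalIntegral.integral_eq_sub_of_hasDerivAt hd (by
    apply Continuous.intervalIntegrable; fun_prop)]
  simp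
  ring

lemma ft_tri {u : ℝ} (hu : u ≠ 0) : ∫ y : ℝ, (tri y : ℂ) * cexp (I * u * y) = (KK 1 u : ℂ) := by
  have hz : (I * u : ℂ) ≠ 0 := by simp [hu]
  have e0 : ∫ y : ℝ, (tri y : ℂ) * cexp (I * u * y) = ∫ y in (-1:ℝ)..1, (tri y : ℂ) * cexp (I * u * y) := by
    rw [intervalIntegral.integral_of_le (by norm_num)]
    refine (setIntegral_eq_integral_of_forall_compl_eq_zero fun y hy => ?_).symm
    have : tri y = 0 := by
      unfold tri
      refine max_eq_left ?_
      simp only [mem_Ioc, not_and_or, not_lt, not_le] at hy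
      rcases hy with h | h
      · have := neg_le_abs y; linarith
      · have := le_abs_self y; linarith
    simp [this]
  have hc : Continuous (fun y : ℝ => (tri y : ℂ) * cexp (I * u * y)) := by
    have := tri_cont
    fun_prop
  have e1 : ∫ y in (0:ℝ)..1, (tri y : ℂ) * cexp (I * u * y) = ∫ y in (0:ℝ)..1, ((1 - y : ℝ) : ℂ) * cexp ((I * u) * y) := by
    refine intervalIntegral.integral_congr fun y hy => ?_
    rw [uIcc_of_le (by norm_num)] at hy
    simp only [tri, abs_of_nonneg hy.1, max_eq_right (show 0 ≤ 1 - y by linarith [hy.2])]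
  have e2 : ∫ y in (-1:ℝ)..0, (tri y : ℂ) * cexp (I * u * y) = ∫ y in (0:ℝ)..1, ((1 - y : ℝ) : ℂ) * cexp (-(I * u) * y) := by
    have := intervalIntegral.integral_comp_neg (a := 0) (b := 1) (fun y : ℝ => (tri y : ℂ) * cexp (I * u * y))
    rw [neg_zero] at this
    rw [← this]
    refine intervalIntegral.integral_congr fun y hy => ?_
    rw [uIcc_of_le (by norm_num)] at hy
    simp only [tri, abs_neg, abs_of_nonneg hy.1, max_eq_right (show 0 ≤ 1 - y by linarith [hy.2])]
    congr 2; push_cast; ring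
  rw [e0, ← intervalIntegral.integral_add_adjacent_intervals (b := 0) (hc.intervalIntegrable _ _) (hc.intervalIntegrable _ _), e1, e2,
    tri_int_half hz, tri_int_half (neg_ne_zero.mpr hz)]
  have hu' : (u:ℂ) ≠ 0 := by exact_mod_cast hu
  have hc2 : Complex.cos u = (cexp (I * u) + cexp (-(I * u))) / 2 := by
    rw [Complex.cos, mul_comm (u:ℂ) I, show -(u:ℂ) * I = -(I * u) by ring]
  unfold KK
  push_cast
  rw [one_mul, hc2, neg_sq, mul_pow, I_sq]
  field_simp
  ring

lemma inv_tri (x : ℝ) : ∫ u : ℝ, (KK 1 u : ℂ) * cexp (I * x * u) = ((2 * π * tri x : ℝ) : ℂ) := by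
  set f : ℝ → ℂ := fun y => (tri y : ℂ) with hf
  have hfc : Continuous f := by have := tri_cont; fun_prop
  have hfs : HasCompactSupport f := by
    refine HasCompactSupport.intro (isCompact_Icc (a := (-1:ℝ)) (b := 1)) fun y hy => ?_
    have : tri y = 0 := by
      unfold tri
      refine max_eq_left ?_
      simp only [mem_Icc, not_and_or, not_le] at hy
      rcases hy with h | h
      · have := neg_le_abs y; linarith
      · have := le_abs_self y; linarith
    simp [hf, this]
  have hfi : Integrable f := hfc.integrable_of_hasCompactSupport hfs
  have hF : ∀ w : ℝ, w ≠ 0 → FourierTransform.fourier f w = (KK 1 (2 * π * w) : ℂ) := by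
    intro w hw
    rw [Real.fourier_real_eq_integral_exp_smul, ← KK_even, ← ft_tri (u := -(2*π*w)) (by
      have := Real.pi_pos; simp; exact hw)]
    congr 1; ext y
    rw [smul_eq_mul, mul_comm]
    congr 2; push_cast; ring
  have hae : (fun w : ℝ => FourierTransform.fourier f w) =ᵐ[volume] fun w : ℝ => (KK 1 (2 * π * w) : ℂ) := by
    have : ∀ᵐ w : ℝ, w ≠ 0 := by simp [ae_iff]
    filter_upwards [this] with w hw using hF w hw
  have hFi : Integrable (FourierTransform.fourier f) := by
    refine Integrable.congr ?_ hae.symm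
    exact (((KK_int 1).comp_mul_left' (show 2 * π ≠ 0 by positivity))).ofReal
  have inv := congrFun (hfc.fourierInv_fourier_eq hfi hFi) x
  rw [Real.fourierInv_eq'] at inv
  have e1 : ∫ v : ℝ, cexp (((2 * π * inner ℝ v x : ℝ) : ℂ) * I) • FourierTransform.fourier f v =
      ∫ v : ℝ, (fun u : ℝ => (KK 1 u : ℂ) * cexp (I * x * u)) (2 * π * v) := by
    refine integral_congr_ae ?_
    filter_upwards [hae] with w hw
    rw [hw, smul_eq_mul, mul_comm]
    congr 2
    simp
    ring
  rw [e1, Measure.integral_comp_mul_left (fun u : ℝ => (KK 1 u : ℂ) * cexp (I * x * u)), abs_of_pos (by positivity)] at inv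
  have hp : (π:ℂ) ≠ 0 := by exact_mod_cast Real.pi_ne_zero
  rw [real_smul] at inv
  push_cast at inv ⊢
  have e2 : (tri x : ℂ) = f x := rfl
  rw [e2, ← inv]
  field_simp
end
end GM

open Complex Filter MeasureTheory Real Set
open scoped Topology
namespace GM
noncomputable section

/-- measure with real density -/
def dm (d : ℝ → ℝ) : Measure ℝ := volume.withDensity (fun u => ENNReal.ofReal (d u))

lemma dm_int {E : Type*} [NormedAddCommGroup E] [NormedSpace ℝ E] {d : ℝ → ℝ} (h0 : ∀ u, 0 ≤ d u) (hm : Measurable d) (g : ℝ → E) :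
    ∫ u, g u ∂(dm d) = ∫ u, d u • g u := by
  unfold dm
  rw [integral_withDensity_eq_integral_toReal_smul (by fun_prop) (by simp)]
  congr 1; ext u
  rw [ENNReal.toReal_ofReal (h0 u)]

lemma dm_prob {d : ℝ → ℝ} (h0 : ∀ u, 0 ≤ d u) (hi : Integrable d) (h1 : ∫ u, d u = 1) :
    IsProbabilityMeasure (dm d) := by
  constructor
  unfold dm
  rw [withDensity_apply _ MeasurableSet.univ, Measure.restrict_univ, ← ofReal_integral_eq_lintegral_ofReal hi (Eventually.of_forall h0), h1]
  simp

lemma levy_dens {d : ℕ → ℝ → ℝ} {e : ℝ → ℝ} (h0 : ∀ n u, 0 ≤ d n u) (hm : ∀ n, Measurable (d n)) (hi : ∀ n, Integrable (d n))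
    (h1 : ∀ n, ∫ u, d n u = 1) (e0 : ∀ u, 0 ≤ e u) (em : Measurable e) (ei : Integrable e) (e1 : ∫ u, e u = 1)
    (hl : ∀ t : ℝ, Tendsto (fun n => ∫ u, (d n u : ℂ) * cexp (I * t * u)) atTop (𝓝 (∫ u, (e u : ℂ) * cexp (I * t * u))))
    {g : ℝ → ℝ} (hg : Continuous g) {C : ℝ} (hC : ∀ u, ‖g u‖ ≤ C) :
    Tendsto (fun n => ∫ u, d n u * g u) atTop (𝓝 (∫ u, e u * g u)) := by
  let P : ℕ → ProbabilityMeasure ℝ := fun n => ⟨dm (d n), dm_prob (h0 n) (hi n) (h1 n)⟩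
  let Q : ProbabilityMeasure ℝ := ⟨dm e, dm_prob e0 ei e1⟩
  have hPQ : Tendsto P atTop (𝓝 Q) := by
    refine ProbabilityMeasure.tendsto_of_tendsto_charFun fun t => ?_
    have a : ∀ n, charFun (P n : Measure ℝ) t = ∫ u, (d n u : ℂ) * cexp (I * t * u) := by
      intro n
      rw [charFun_apply_real]
      change ∫ x, cexp (t * x * I) ∂(dm (d n)) = _
      rw [dm_int (h0 n) (hm n)]
      congr 1; ext u
      rw [real_smul, show (t:ℂ) * u * I = I * t * u by ring]
    have b : charFun (Q : Measure ℝ) t = ∫ u, (e u : ℂ) * cexp (I * t * u) := by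
      rw [charFun_apply_real]
      change ∫ x, cexp (t * x * I) ∂(dm e) = _
      rw [dm_int e0 em]
      congr 1; ext u
      rw [real_smul, show (t:ℂ) * u * I = I * t * u by ring]
    rw [b]
    simp_rw [a]
    exact hl t
  have := (ProbabilityMeasure.tendsto_iff_forall_integral_tendsto.mp hPQ) (BoundedContinuousFunction.ofNormedAddCommGroup g hg C hC)
  have a : ∀ n, ∫ u, d n u * g u = ∫ u, (BoundedContinuousFunction.ofNormedAddCommGroup g hg C hC) u ∂(P n : Measure ℝ) := by
    intro n
    change _ = ∫ u, g u ∂(dm (d n))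
    rw [dm_int (h0 n) (hm n)]; rfl
  have b : ∫ u, e u * g u = ∫ u, (BoundedContinuousFunction.ofNormedAddCommGroup g hg C hC) u ∂(Q : Measure ℝ) := by
    change _ = ∫ u, g u ∂(dm e)
    rw [dm_int e0 em]; rfl
  simp_rw [a, b]
  exact this

/-- odd part vanishes -/
lemma even_cexp {d : ℝ → ℝ} (hd : Integrable d) (he : ∀ u, d (-u) = d u) (t : ℝ) :
    ∫ u, (d u : ℂ) * cexp (I * t * u) = ((∫ u, Real.cos (t * u) * d u : ℝ) : ℂ) := by
  have hi : Integrable (fun u : ℝ => (d u : ℂ) * cexp (I * t * u)) := by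
    refine Integrable.mul_bdd (c := 1) hd.ofReal ?_ ?_
    · exact (by fun_prop : Continuous (fun y : ℝ => cexp (I * t * y))).aestronglyMeasurable
    · refine Eventually.of_forall fun y => ?_
      rw [show (I * t * y : ℂ) = ((t*y : ℝ) : ℂ) * I by push_cast; ring]
      exact (Complex.norm_exp_ofReal_mul_I _).le
  have h1 : ∫ u, (d u : ℂ) * cexp (I * t * u) = ∫ u : ℝ, (d u : ℂ) * cexp (-(I * t * u)) := by
    rw [← integral_neg_eq_self (fun u : ℝ => (d u : ℂ) * cexp (I * t * u))]
    congr 1; ext u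
    rw [he]; congr 2; push_cast; ring
  have hi2 : Integrable (fun u : ℝ => (d u : ℂ) * cexp (-(I * t * u))) := by
    have := hi.comp_neg
    refine this.congr (Eventually.of_forall fun u => ?_)
    simp only
    rw [he]; congr 2; push_cast; ring
  have h2 : 2 * ∫ u, (d u : ℂ) * cexp (I * t * u) = 2 * ((∫ u, Real.cos (t * u) * d u : ℝ) : ℂ) := by
    rw [two_mul]
    nth_rewrite 2 [h1]
    rw [← integral_add hi hi2, ← integral_complex_ofReal, ← integral_const_mul]
    congr 1; ext u
    push_cast
    rw [Complex.cos, show (t:ℂ) * u * I = I * t * u by ring, show -((t:ℂ) * u) * I = -(I * t * u) by ring]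
    ring
  exact mul_left_cancel₀ two_ne_zero h2

lemma KK_cos_int {f : ℝ → ℝ} (hi : ∀ c, Integrable (fun u => KK c u * f u)) (c : ℝ) :
    ∫ u, Real.cos (c * u) * (KK 1 u * f u) = 1/2 * ((∫ u, KK |c+1| u * f u) + (∫ u, KK |c-1| u * f u) - 2 * ∫ u, KK |c| u * f u) := by
  simp_rw [KK_abs_left]
  have hab : Integrable (fun u => KK (c+1) u * f u + KK (c-1) u * f u) := (hi _).add (hi _)
  rw [← integral_const_mul, ← integral_add (hi _) (hi _), ← integral_sub hab ((hi _).const_mul _), ← integral_const_mul]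
  congr 1; ext u
  rw [← mul_assoc, KK_shift]; ring

lemma KK_zero (u : ℝ) : KK 0 u = 0 := by simp [KK]

/-- continuous version of `KK 1` -/
def kern (u : ℝ) : ℝ := (Real.sinc (u/2))^2

lemma kern_eq {u : ℝ} (hu : u ≠ 0) : KK 1 u = kern u := by
  unfold KK kern
  rw [Real.sinc_of_ne_zero (by simp [hu]), one_mul, div_pow]
  have : Real.cos u = 1 - 2 * Real.sin (u/2)^2 := by
    have := Real.cos_two_mul (u/2)
    rw [show 2 * (u/2) = u by ring] at this
    rw [this, Real.cos_sq']; ring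
  rw [this]; field_simp; ring

lemma kern_cont : Continuous kern := by
  unfold kern
  have := Real.continuous_sinc
  fun_prop

lemma kern_ge {u : ℝ} (hu : |u| ≤ 2) : 1/4 ≤ kern u := by
  have key : ∀ x : ℝ, 0 ≤ x → x ≤ 1 → 1/2 ≤ Real.sinc x := by
    intro x h0 h1
    rcases h0.eq_or_lt with h | h
    · rw [← h, Real.sinc_zero]; norm_num
    · rw [Real.sinc_of_ne_zero h.ne', le_div_iff₀ h]
      have h3 := Real.mul_le_sin h0 (by linarith [Real.two_le_pi])
      have h4 : 1/2 ≤ 2/π := by rw [div_le_div_iff₀ (by norm_num) Real.pi_pos]; linarith [Real.pi_le_four]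
      nlinarith
  have : Real.sinc (u/2) = Real.sinc (|u|/2) := by
    rcases abs_choice u with h | h <;> rw [h]
    rw [neg_div, Real.sinc_neg]
  unfold kern
  rw [this]
  have := key (|u|/2) (by positivity) (by linarith)
  nlinarith

/-- trapezoid -/
def trap (a b u : ℝ) : ℝ := max 0 (min 1 ((b - |u|) / (b - a)))

lemma trap_cont (a b : ℝ) : Continuous (trap a b) := by unfold trap; fun_prop

lemma trap_le {a b : ℝ} (hab : a < b) (u : ℝ) : trap a b u ≤ (Icc (-b) b).indicator 1 u := by
  unfold trap
  by_cases h : u ∈ Icc (-b) b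
  · rw [indicator_of_mem h]; simp
  · rw [indicator_of_notMem h]
    have : b < |u| := by
      rw [mem_Icc, ← abs_le] at h; linarith
    refine max_le le_rfl ((min_le_right _ _).trans ?_)
    exact div_nonpos_of_nonpos_of_nonneg (by linarith) (by linarith)

lemma le_trap {a b : ℝ} (hab : a < b) (u : ℝ) : (Icc (-a) a).indicator 1 u ≤ trap a b u := by
  unfold trap
  by_cases h : u ∈ Icc (-a) a
  · rw [indicator_of_mem h]
    rw [mem_Icc, ← abs_le] at h
    refine le_max_of_le_right (le_min le_rfl ?_)
    rw [Pi.one_apply, le_div_iff₀ (by linarith)]; linarith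
  · rw [indicator_of_notMem h]; exact le_max_left _ _

lemma trap_nonneg (a b u : ℝ) : 0 ≤ trap a b u := le_max_left _ _

lemma taub_trap {f : ℕ → ℝ → ℝ} (f0 : ∀ n u, 0 ≤ f n u) (fm : ∀ n, Measurable (f n)) (fe : ∀ n u, f n (-u) = f n u)
    (fi : ∀ n c, Integrable (fun u => KK c u * f n u))
    (fp : ∀ n, 0 < ∫ u, KK 1 u * f n u)
    (fl : ∀ c : ℝ, 0 < c → Tendsto (fun n => ∫ u, KK c u * f n u) atTop (𝓝 c))
    {a b : ℝ} (hab : a < b) (hb : b ≤ 2) :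
    Tendsto (fun n => ∫ u, trap a b u * f n u) atTop (𝓝 (1 / (2 * π) * ∫ u, trap a b u)) := by
  have fl' : ∀ c : ℝ, 0 ≤ c → Tendsto (fun n => ∫ u, KK c u * f n u) atTop (𝓝 c) := by
    intro c hc
    rcases hc.eq_or_lt with h | h
    · rw [← h]; simp [KK_zero]
    · exact fl c h
  set m : ℕ → ℝ := fun n => ∫ u, KK 1 u * f n u with hm
  have ml : Tendsto m atTop (𝓝 1) := fl 1 one_pos
  have hpi := Real.pi_pos
  have KKint : ∫ u, KK 1 u = 2 * π := by
    have := inv_tri 0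
    simp only [ofReal_zero, mul_zero, zero_mul, Complex.exp_zero, mul_one] at this
    rw [integral_complex_ofReal] at this
    have := Complex.ofReal_injective this
    rw [this]; simp [tri]
  have L := levy_dens (d := fun n u => (m n)⁻¹ * (KK 1 u * f n u)) (e := fun u => (2*π)⁻¹ * KK 1 u)
    (fun n u => mul_nonneg (inv_nonneg.mpr (fp n).le) (mul_nonneg (KK_nonneg _ _) (f0 n u)))
    (fun n => ((KK_meas 1).mul (fm n)).const_mul _)
    (fun n => (fi n 1).const_mul _)
    (fun n => by rw [integral_const_mul]; exact inv_mul_cancel₀ (fp n).ne')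
    (fun u => mul_nonneg (by positivity) (KK_nonneg _ _))
    ((KK_meas 1).const_mul _) ((KK_int 1).const_mul _)
    (by rw [integral_const_mul, KKint]; field_simp)
    (by
      intro t
      have e1 : ∫ u : ℝ, (((2*π)⁻¹ * KK 1 u : ℝ) : ℂ) * cexp (I * t * u) = (tri t : ℂ) := by
        push_cast
        simp_rw [mul_assoc]
        rw [integral_const_mul]
        have := inv_tri t
        simp_rw [mul_assoc] at this
        rw [this]
        have hp : (π:ℂ) ≠ 0 := by exact_mod_cast Real.pi_ne_zero
        push_cast
        field_simp
      rw [e1]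
      have e2 : ∀ n, ∫ u : ℝ, (((m n)⁻¹ * (KK 1 u * f n u) : ℝ) : ℂ) * cexp (I * t * u) =
          (((m n)⁻¹ * (1/2 * ((∫ u, KK |t+1| u * f n u) + (∫ u, KK |t-1| u * f n u) - 2 * ∫ u, KK |t| u * f n u)) : ℝ) : ℂ) := by
        intro n
        rw [even_cexp ((fi n 1).const_mul _) (fun u => by rw [KK_even, fe])]
        congr 1
        rw [← KK_cos_int (fi n), ← integral_const_mul]
        congr 1; ext u; ring
      simp_rw [e2]
      refine (Complex.continuous_ofReal.tendsto _).comp ?_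
      have := (ml.inv₀ one_ne_zero).mul ((((fl' |t+1| (abs_nonneg _)).add (fl' |t-1| (abs_nonneg _))).sub ((fl' |t| (abs_nonneg _)).const_mul 2)).const_mul (1/2))
      rw [inv_one, one_mul, ← tri_eq] at this
      exact this)
    (g := fun u => trap a b u / max (kern u) (1/4))
    (by
      refine (trap_cont a b).div₀ (kern_cont.max continuous_const) fun u => ?_
      have : (1/4:ℝ) ≤ max (kern u) (1/4) := le_max_right _ _
      linarith)
    (C := 4)
    (by
      intro u
      have h1 : (1/4:ℝ) ≤ max (kern u) (1/4) := le_max_right _ _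
      have h2 : trap a b u ≤ 1 := by unfold trap; simp
      rw [Real.norm_of_nonneg (div_nonneg (trap_nonneg _ _ _) (by linarith)), div_le_iff₀ (by linarith)]
      linarith)
  have key : ∀ u, u ≠ 0 → KK 1 u * (trap a b u / max (kern u) (1/4)) = trap a b u := by
    intro u hu
    rw [kern_eq hu]
    by_cases h : |u| ≤ 2
    · have := kern_ge h
      rw [max_eq_left this]; field_simp
    · have : trap a b u = 0 := by
        refine le_antisymm ((trap_le hab u).trans ?_) (trap_nonneg _ _ _)
        rw [indicator_of_notMem]
        rw [mem_Icc, ← abs_le]; linarith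
      simp [this]
  have nz : ∀ᵐ u : ℝ, u ≠ 0 := by simp [ae_iff]
  have r1 : ∫ u, (2*π)⁻¹ * KK 1 u * (trap a b u / max (kern u) (1/4)) = 1 / (2*π) * ∫ u, trap a b u := by
    rw [← integral_const_mul]
    refine integral_congr_ae ?_
    filter_upwards [nz] with u hu
    rw [mul_assoc, key u hu]; ring
  have r2 : ∀ n, ∫ u, (m n)⁻¹ * (KK 1 u * f n u) * (trap a b u / max (kern u) (1/4)) = (m n)⁻¹ * ∫ u, trap a b u * f n u := by
    intro n
    rw [← integral_const_mul]
    refine integral_congr_ae ?_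
    filter_upwards [nz] with u hu
    nth_rewrite 2 [← key u hu]
    ring
  simp_rw [r2] at L
  rw [r1] at L
  have := ml.mul L
  rw [one_mul] at this
  refine this.congr fun n => ?_
  rw [← mul_assoc, mul_inv_cancel₀ (fp n).ne', one_mul]

/-- Tauberian theorem. -/
lemma taub {f : ℕ → ℝ → ℝ} (f0 : ∀ n u, 0 ≤ f n u) (fm : ∀ n, Measurable (f n)) (fe : ∀ n u, f n (-u) = f n u)
    (fi : ∀ n c, Integrable (fun u => KK c u * f n u)) (fli : ∀ n a b, IntervalIntegrable (f n) volume a b)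
    (fp : ∀ n, 0 < ∫ u, KK 1 u * f n u)
    (fl : ∀ c : ℝ, 0 < c → Tendsto (fun n => ∫ u, KK c u * f n u) atTop (𝓝 c)) :
    Tendsto (fun n => ∫ u in (0:ℝ)..1, f n u) atTop (𝓝 (1 / (2 * π))) := by
  have hpi := Real.pi_pos
  have iio : ∀ n c, 0 ≤ c → IntegrableOn (f n) (Icc (-c) c) := by
    intro n c hc
    have := fli n (-c) c
    rw [intervalIntegrable_iff_integrableOn_Icc_of_le (by linarith)] at this
    exact this
  have ind : ∀ n c, 0 ≤ c → Integrable (fun u => (Icc (-c) c).indicator 1 u * f n u) := by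
    intro n c hc
    have := (iio n c hc).integrable_indicator measurableSet_Icc
    refine this.congr (Eventually.of_forall fun u => ?_)
    by_cases h : u ∈ Icc (-c) c <;> simp [h]
  have inde : ∀ n c, 0 ≤ c → ∫ u, (Icc (-c) c).indicator 1 u * f n u = ∫ u in Icc (-c) c, f n u := by
    intro n c hc
    rw [← integral_indicator measurableSet_Icc]
    congr 1; ext u
    by_cases h : u ∈ Icc (-c) c <;> simp [h]
  have trap_i : ∀ n a b, 0 ≤ a → a < b → Integrable (fun u => trap a b u * f n u) := by
    intro n a b ha hab
    refine (ind n b (by linarith)).mono' ((trap_cont a b).measurable.mul (fm n)).aestronglyMeasurable (Eventually.of_forall fun u => ?_)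
    rw [Real.norm_of_nonneg (mul_nonneg (trap_nonneg _ _ _) (f0 n u))]
    exact mul_le_mul_of_nonneg_right (trap_le hab u) (f0 n u)
  have up : ∀ n a b, 0 ≤ a → a < b → ∫ u, trap a b u * f n u ≤ ∫ u in Icc (-b) b, f n u := by
    intro n a b ha hab
    rw [← inde n b (by linarith)]
    exact integral_mono (trap_i n a b ha hab) (ind n b (by linarith)) fun u => mul_le_mul_of_nonneg_right (trap_le hab u) (f0 n u)
  have lo : ∀ n a b, 0 ≤ a → a < b → ∫ u in Icc (-a) a, f n u ≤ ∫ u, trap a b u * f n u := by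
    intro n a b ha hab
    rw [← inde n a (by linarith)]
    exact integral_mono (ind n a ha) (trap_i n a b ha hab) fun u => mul_le_mul_of_nonneg_right (le_trap hab u) (f0 n u)
  have i1 : ∀ c : ℝ, Integrable ((Icc (-c) c).indicator (1 : ℝ → ℝ)) := fun c =>
    (integrable_indicator_iff measurableSet_Icc).mpr (by
      rw [show (1 : ℝ → ℝ) = fun _ => (1:ℝ) from rfl]
      exact integrableOn_const (by simp))
  have v1 : ∀ c : ℝ, 0 ≤ c → ∫ u, (Icc (-c) c).indicator (1 : ℝ → ℝ) u = 2 * c := by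
    intro c hc
    rw [integral_indicator_one measurableSet_Icc, measureReal_def, Real.volume_Icc, ENNReal.toReal_ofReal (by linarith)]; ring
  have trap_i1 : ∀ a b, a < b → Integrable (trap a b) := by
    intro a b hab
    refine (i1 b).mono' (trap_cont a b).measurable.aestronglyMeasurable (Eventually.of_forall fun u => ?_)
    rw [Real.norm_of_nonneg (trap_nonneg _ _ _)]
    exact trap_le hab u
  have tup : ∀ a b, 0 ≤ a → a < b → ∫ u, trap a b u ≤ 2 * b := by
    intro a b ha hab
    rw [← v1 b (by linarith)]
    exact integral_mono (trap_i1 a b hab) (i1 b) (trap_le hab)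
  have tlo : ∀ a b, 0 ≤ a → a < b → 2 * a ≤ ∫ u, trap a b u := by
    intro a b ha hab
    rw [← v1 a ha]
    exact integral_mono (i1 a) (trap_i1 a b hab) (le_trap hab)
  have main : Tendsto (fun n => ∫ u in Icc (-1:ℝ) 1, f n u) atTop (𝓝 (1 / π)) := by
    rw [Metric.tendsto_atTop]
    intro ε hε
    set η := min (1/2) (ε / 2) with hη
    have hη0 : 0 < η := by positivity
    have hη1 : η ≤ 1/2 := min_le_left _ _
    have hη2 : η ≤ ε / 2 := min_le_right _ _
    have T1 := taub_trap f0 fm fe fi fp fl (a := 1 - η) (b := 1) (by linarith) (by norm_num)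
    have T2 := taub_trap f0 fm fe fi fp fl (a := 1) (b := 1 + η) (by linarith) (by linarith)
    rw [Metric.tendsto_atTop] at T1 T2
    obtain ⟨N1, h1⟩ := T1 (ε/2) (by positivity)
    obtain ⟨N2, h2⟩ := T2 (ε/2) (by positivity)
    refine ⟨max N1 N2, fun n hn => ?_⟩
    have g1 := h1 n (le_trans (le_max_left _ _) hn)
    have g2 := h2 n (le_trans (le_max_right _ _) hn)
    have b1 := up n (1-η) 1 (by linarith) (by linarith)
    have b2 := lo n 1 (1+η) (by linarith) (by linarith)
    have b3 := tlo (1-η) 1 (by linarith) (by linarith)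
    have b4 := tup 1 (1+η) (by linarith) (by linarith)
    have hpi1 : 1 / π ≤ 1 := by rw [div_le_one hpi]; linarith [Real.two_le_pi]
    have hpi0 : 0 < 1/π := by positivity
    have e1 : 1 / π - ε/2 ≤ 1 / (2*π) * ∫ u, trap (1-η) 1 u := by
      calc 1/π - ε/2 ≤ 1/π * (1 - η) := by nlinarith
        _ = 1 / (2*π) * (2 * (1 - η)) := by field_simp
        _ ≤ _ := by gcongr
    have e2 : 1 / (2*π) * ∫ u, trap 1 (1+η) u ≤ 1/π + ε/2 := by
      calc _ ≤ 1 / (2*π) * (2 * (1 + η)) := by gcongr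
        _ = 1/π * (1 + η) := by field_simp
        _ ≤ _ := by nlinarith
    rw [Real.dist_eq, abs_lt] at *
    constructor <;> linarith [g1.1, g1.2, g2.1, g2.2]
  have half : ∀ n, ∫ u in (0:ℝ)..1, f n u = 1/2 * ∫ u in Icc (-1:ℝ) 1, f n u := by
    intro n
    rw [integral_Icc_eq_integral_Ioc, ← intervalIntegral.integral_of_le (by norm_num),
      ← intervalIntegral.integral_add_adjacent_intervals (fli n (-1) 0) (fli n 0 1)]
    have := intervalIntegral.integral_comp_neg (a := 0) (b := 1) (f n)
    simp_rw [fe] at this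
    rw [neg_zero] at this
    rw [← this]; ring
  simp_rw [half]
  have := main.const_mul (1/2)
  rw [show 1/2 * (1/π) = 1 / (2*π) by field_simp] at this
  exact this

end
end GM

open Complex Filter MeasureTheory Real Set
open scoped Topology ComplexConjugate
namespace GM
noncomputable section

lemma xf_conj (s : ℂ) : xf (conj s) = conj (xf s) := by
  by_cases h : s = 1
  · subst h; simp [xf_one]
  · have h' : conj s ≠ 1 := by
      intro e; apply h
      have := congrArg conj e
      simpa using this
    rw [xf_of_ne h, xf_of_ne h', riemannZeta_conj]; simp

lemma iter_xf_conj (n : ℕ) (s : ℂ) : iteratedDeriv n xf (conj s) = conj (iteratedDeriv n xf s) := by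
  induction n generalizing s with
  | zero => simpa using xf_conj s
  | succ n ih =>
    rw [iteratedDeriv_succ]
    have e : (conj ∘ iteratedDeriv n xf ∘ conj) = iteratedDeriv n xf := by
      funext z; simp [ih]
    have := congrFun (deriv_conj_conj (f := iteratedDeriv n xf)) (conj s)
    rw [e] at this
    simpa using this

lemma mu_conj (s : ℂ) : mu (conj s) = mu s := by
  have h := (analyticOrderAt_eq_nat_iff_iteratedDeriv_eq_zero (differentiable_xf.analyticAt s)).mp (mu_cast s).symm
  have h2 : analyticOrderAt xf (conj s) = (mu s : ℕ∞) := by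
    refine (analyticOrderAt_eq_nat_iff_iteratedDeriv_eq_zero (differentiable_xf.analyticAt (conj s))).mpr ⟨fun k hk => ?_, ?_⟩
    · rw [iter_xf_conj, h.1 k hk, map_zero]
    · rw [iter_xf_conj]; simpa using h.2
  rw [← mu_cast] at h2
  exact_mod_cast h2

lemma zetaMult_eq {s : ℂ} (hs : s ≠ 1) : zetaMult s = mu s := by
  have hd : AnalyticAt ℂ riemannZeta s := by
    have : DifferentiableOn ℂ riemannZeta {1}ᶜ := fun z hz => (differentiableAt_riemannZeta hz).differentiableWithinAt
    exact this.analyticAt (isOpen_compl_singleton.mem_nhds hs)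
  have hl : AnalyticAt ℂ (fun z : ℂ => z - 1) s := by fun_prop
  have e : xf =ᶠ[𝓝 s] (fun z : ℂ => z - 1) * riemannZeta := by
    filter_upwards [isOpen_compl_singleton.mem_nhds hs] with z hz
    rw [xf_of_ne hz]; rfl
  have ho : analyticOrderAt riemannZeta s = (mu s : ℕ∞) := by
    rw [mu_cast, analyticOrderAt_congr e, analyticOrderAt_mul hl hd, hl.analyticOrderAt_eq_zero.mpr (sub_ne_zero.mpr hs), zero_add]
  have h := (analyticOrderAt_eq_nat_iff_iteratedDeriv_eq_zero hd).mp ho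
  unfold zetaMult
  refine le_antisymm (Nat.sInf_le h.2) ?_
  refine le_csInf ⟨_, h.2⟩ fun k hk => ?_
  by_contra hlt
  exact hk (h.1 k (not_le.mp hlt))

/-- conjugation on zeros -/
def cz : Zt ≃ Zt where
  toFun ρ := ⟨conj (ρ:ℂ), by rw [xf_conj, ρ.2, map_zero]⟩
  invFun ρ := ⟨conj (ρ:ℂ), by rw [xf_conj, ρ.2, map_zero]⟩
  left_inv ρ := by ext; simp
  right_inv ρ := by ext; simp

lemma mm_cz (ρ : Zt) : mm (cz ρ) = mm ρ := by
  unfold mm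
  simp [cz, mu_conj]

lemma gg_cz (ρ : Zt) : gg (cz ρ) = - gg ρ := by
  unfold gg
  simp [cz]

lemma W_neg (Y t : ℝ) : ‖W S1 Y (-t)‖ = ‖W S1 Y t‖ := by
  have : W S1 Y (-t) = conj (W S1 Y t) := by
    unfold W
    rw [Complex.conj_tsum, ← cz.tsum_eq]
    refine tsum_congr fun ρ => ?_
    unfold Wt S1
    rw [mm_cz, gg_cz]
    simp only [map_div₀, map_mul, conj_ofReal, map_one, ← Complex.exp_conj, conj_I]
    congr 2
    · congr 1; push_cast; ring
    · ring
  rw [this, Complex.norm_conj]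

lemma avs_norm_sq {h t : ℝ} (ht : t ≠ 0) : ‖avs 0 h t‖^2 = 2 * (1 - Real.cos (t * h)) / t^2 := by
  have hz : (((0:ℝ):ℂ) + t * I) ≠ 0 := by simp [ht]
  rw [avs_eq hz, norm_div, div_pow]
  have e1 : ‖((0:ℝ):ℂ) + t * I‖^2 = t^2 := by
    rw [Complex.sq_norm, normSq_apply]; simp; ring
  rw [e1, show (((0:ℝ):ℂ) + t * I) * h = ((t * h : ℝ) : ℂ) * I by push_cast; ring, Complex.sq_norm, normSq_apply, sub_re, sub_im,
    exp_ofReal_mul_I_re, exp_ofReal_mul_I_im]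
  congr 1
  simp
  nlinarith [Real.sin_sq_add_cos_sq (t * h)]

/-- rescaled density -/
def fd (T X u : ℝ) : ℝ := 2 / π / Real.log T * ‖W S1 (Real.log X) (u * T)‖^2

lemma fd_nonneg {T : ℝ} (hT : 1 < T) (X u : ℝ) : 0 ≤ fd T X u := by
  have := Real.log_pos hT
  unfold fd; positivity

lemma fd_meas (T X : ℝ) : Measurable (fd T X) := by
  unfold fd
  have := (W_measurable S1 (Real.log X)).comp (measurable_id.mul_const T)
  exact (this.norm.pow_const 2).const_mul _

lemma fd_even (T X u : ℝ) : fd T X (-u) = fd T X u := by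
  unfold fd; rw [neg_mul, W_neg]

lemma DD_nonneg' : 0 ≤ DD := DD_nonneg

lemma fd_bound {T : ℝ} (hT : 1 < T) (X : ℝ) : ∃ B : ℝ, 0 ≤ B ∧ ∀ u, fd T X u ≤ B * (1 + |u|) ^ (1/2:ℝ) := by
  have hl := Real.log_pos hT
  have hD := DD_nonneg
  refine ⟨2 / π / Real.log T * ((8 * DD)^2 * (T + 2) ^ (1/2:ℝ)), by positivity, fun u => ?_⟩
  have hx : 0 < 1 + |u| := by positivity
  have h1 := S_bound (Real.log X) (u * T)
  have h2 : Real.log (|u * T| + 2) ≤ ((T + 2) * (1 + |u|)) ^ (1/4:ℝ) / (1/4) := by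
    refine (Real.log_le_log (by positivity) ?_).trans (Real.log_le_rpow_div (by positivity) (by norm_num))
    rw [abs_mul, abs_of_pos (by linarith : 0 < T)]
    nlinarith [abs_nonneg u]
  have h3 : ‖W S1 (Real.log X) (u * T)‖ ≤ 8 * DD * ((T + 2) * (1 + |u|)) ^ (1/4:ℝ) := by
    calc _ ≤ _ := h1
      _ ≤ 2 * DD * (((T + 2) * (1 + |u|)) ^ (1/4:ℝ) / (1/4)) := by gcongr
      _ = _ := by ring
  unfold fd
  rw [mul_assoc]
  gcongr
  calc _ ≤ (8 * DD * ((T + 2) * (1 + |u|)) ^ (1/4:ℝ))^2 := by gcongr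
    _ = (8*DD)^2 * (((T + 2) * (1 + |u|)) ^ (1/4:ℝ))^2 := by ring
    _ = _ := by
      rw [← Real.rpow_natCast (((T + 2) * (1 + |u|)) ^ (1/4:ℝ)) 2, ← Real.rpow_mul (by positivity), Real.mul_rpow (by positivity) (by positivity)]
      norm_num
      ring

lemma fd_ii {T : ℝ} (hT : 1 < T) (X a b : ℝ) : IntervalIntegrable (fd T X) volume a b := by
  obtain ⟨B, hB, h⟩ := fd_bound hT X
  have hc : Continuous (fun u : ℝ => B * (1 + |u|) ^ (1/2:ℝ)) := by
    refine continuous_const.mul (Continuous.rpow_const (by fun_prop) fun u => Or.inr (by norm_num))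
  refine (hc.intervalIntegrable a b).mono_fun' (fd_meas T X).aestronglyMeasurable (Eventually.of_forall fun u => ?_)
  simp only
  rw [Real.norm_of_nonneg (fd_nonneg hT X u)]
  exact h u

lemma fd_int {T : ℝ} (hT : 1 < T) (X c : ℝ) : Integrable (fun u => KK c u * fd T X u) := by
  obtain ⟨B, hB, h⟩ := fd_bound hT X
  have hi := integrable_one_add_norm (E := ℝ) (μ := volume) (r := 3/2) (by simp; norm_num)
  refine (hi.const_mul (2 * (c^2+4) * B)).mono' ((KK_meas c).mul (fd_meas T X)).aestronglyMeasurable (Eventually.of_forall fun u => ?_)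
  rw [Real.norm_of_nonneg (mul_nonneg (KK_nonneg c u) (fd_nonneg hT X u)), Real.norm_eq_abs]
  have hx : 0 < 1 + |u| := by positivity
  have h1 : (1 + u^2)⁻¹ ≤ 2 * (1 + |u|) ^ (-2:ℝ) := by
    rw [Real.rpow_neg hx.le, Real.rpow_two, ← div_eq_mul_inv, inv_eq_one_div, div_le_div_iff₀ (by positivity) (by positivity)]
    nlinarith [sq_nonneg (1 - |u|), sq_abs u]
  have e : (1 + |u|) ^ (-(3/2):ℝ) = (1 + |u|) ^ (-2:ℝ) * (1 + |u|) ^ (1/2:ℝ) := by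
    rw [← Real.rpow_add hx]; norm_num
  rw [e]
  calc _ ≤ ((c^2 + 4) * (1 + u^2)⁻¹) * (B * (1 + |u|) ^ (1/2:ℝ)) := mul_le_mul (KK_le c u) (h u) (fd_nonneg hT X u) (by positivity)
    _ ≤ ((c^2 + 4) * (2 * (1 + |u|) ^ (-2:ℝ))) * (B * (1 + |u|) ^ (1/2:ℝ)) := by gcongr
    _ = _ := by ring

lemma fd_KK {T : ℝ} (hT : 1 < T) (X κ : ℝ) :
    ∫ u, KK κ u * fd T X u = T / Real.log T * (2/π * ∫ t, ‖avs 0 (κ / T) t * W S1 (Real.log X) t‖^2) := by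
  have hl := Real.log_pos hT
  have hT0 : 0 < T := by linarith
  have nz : ∀ᵐ u : ℝ, u ≠ 0 := by simp [ae_iff]
  have e : ∫ u, KK κ u * fd T X u = ∫ u : ℝ, (2 / π / Real.log T * T^2) * (fun t => ‖avs 0 (κ / T) t * W S1 (Real.log X) t‖^2) (u * T) := by
    refine integral_congr_ae ?_
    filter_upwards [nz] with u hu
    have hu' : u * T ≠ 0 := mul_ne_zero hu hT0.ne'
    rw [norm_mul, mul_pow, avs_norm_sq hu', KK, fd, show u * T * (κ / T) = κ * u by field_simp]
    field_simp
  rw [e, integral_const_mul, Measure.integral_comp_mul_right (fun t => ‖avs 0 (κ / T) t * W S1 (Real.log X) t‖^2), abs_of_pos (by positivity), smul_eq_mul]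
  field_simp

/-- Mean value of the zero sum, along sequences. -/
lemma mean_seq (hRH : RiemannHypothesis) {A₁ A₂ : ℝ} (hA₁ : 1 ≤ A₁) (hA₁₂ : A₁ ≤ A₂) (hI : HypI A₁ A₂)
    {T X : ℕ → ℝ} (hT1 : ∀ n, 1 < T n) (hT : Tendsto T atTop atTop) (hX1 : ∀ n, T n ^ A₁ ≤ X n) (hX2 : ∀ n, X n ≤ T n ^ A₂) :
    Tendsto (fun n => ∫ u in (0:ℝ)..1, fd (T n) (X n) u) atTop (𝓝 (1 / (2 * π))) := by
  have lim : ∀ c : ℝ, 0 < c → Tendsto (fun n => ∫ u, KK c u * fd (T n) (X n) u) atTop (𝓝 c) := by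
    intro c hc
    rw [Metric.tendsto_nhds]
    intro ε hε
    filter_upwards [hT.eventually (main_conv hRH hA₁ hA₁₂ hI hc (show 0 < ε/2 by positivity))] with n hn
    rw [fd_KK (hT1 n), Real.dist_eq]
    exact lt_of_le_of_lt (hn _ (hX1 n) (hX2 n)) (by linarith)
  have pos := (lim 1 one_pos).eventually_const_lt one_pos
  obtain ⟨N, hN⟩ := eventually_atTop.mp pos
  rw [← tendsto_add_atTop_iff_nat N]
  refine taub (f := fun n => fd (T (n+N)) (X (n+N))) (fun n u => fd_nonneg (hT1 _) _ _) (fun n => fd_meas _ _) (fun n u => fd_even _ _ _)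
    (fun n c => fd_int (hT1 _) _ _) (fun n a b => fd_ii (hT1 _) _ _ _) (fun n => hN _ (by omega)) ?_
  intro c hc
  exact (tendsto_add_atTop_iff_nat N).mpr (lim c hc)

end
end GM

open Complex Filter MeasureTheory Real Set
open scoped Topology ComplexConjugate
namespace GM
noncomputable section

open Classical in
/-- indicator of the ordinates in `(0,T]` -/
def kT (T g : ℝ) : ℂ := if 0 < g ∧ g ≤ T then 1 else 0

lemma kT_norm_le (T g : ℝ) : ‖kT T g‖ ≤ 1 := by
  unfold kT; split_ifs <;> simp

lemma kT_diff (T t s : ℝ) :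
    ‖kT T s - kT T t * S1 s‖ ≤ (1 + min |t| |t - T|) ^ (-(3/4):ℝ) * (1 + |t - s|) ^ (3/4:ℝ) := by
  have hd : 0 ≤ min |t| |t - T| := le_min (abs_nonneg _) (abs_nonneg _)
  have key : min |t| |t - T| ≤ |t - s| → 1 ≤ (1 + min |t| |t - T|) ^ (-(3/4):ℝ) * (1 + |t - s|) ^ (3/4:ℝ) := by
    intro h
    rw [Real.rpow_neg (by positivity), ← div_eq_inv_mul, one_le_div (by positivity)]
    gcongr
  have p : 0 ≤ (1 + min |t| |t - T|) ^ (-(3/4):ℝ) * (1 + |t - s|) ^ (3/4:ℝ) := by positivity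
  unfold kT S1
  by_cases h1 : 0 < s ∧ s ≤ T <;> by_cases h2 : 0 < t ∧ t ≤ T
  · simpa [h1, h2] using p
  · simp only [h1, h2]
    simp only [and_self, if_true, if_false, zero_mul, sub_zero, norm_one]
    apply key
    rcases le_or_gt t 0 with h | h
    · refine (min_le_left _ _).trans ?_
      rw [abs_of_nonpos h, abs_of_nonpos (by linarith)]; linarith
    · have h3 : T < t := by
        by_contra h4; exact h2 ⟨h, not_lt.mp h4⟩
      refine (min_le_right _ _).trans ?_
      rw [abs_of_nonneg (by linarith), abs_of_nonneg (by linarith)]; linarith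
  · simp only [h1, h2]
    simp only [and_self, if_true, if_false, zero_sub, mul_one, norm_neg, norm_one]
    apply key
    rcases le_or_gt s 0 with h | h
    · refine (min_le_left _ _).trans ?_
      rw [abs_of_nonneg h2.1.le, abs_of_nonneg (by linarith)]; linarith
    · have h3 : T < s := by
        by_contra h4; exact h1 ⟨h, not_lt.mp h4⟩
      refine (min_le_right _ _).trans ?_
      rw [abs_of_nonpos (by linarith), abs_of_nonpos (by linarith)]; linarith
  · simpa [h1, h2] using p

lemma kT_summable (T Y t : ℝ) : Summable (Wt (kT T) Y t) :=
  Wt_summable (K := 1) (fun ρ => by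
    rw [one_mul]; exact (kT_norm_le _ _).trans (one_le_pw _))

/-- error envelope -/
def ce (T t : ℝ) : ℝ := 16 * DD * (T + 2) ^ (1/8:ℝ) * (1 + min |t| |t - T|) ^ (-(5/8):ℝ)

lemma ce_nonneg {T : ℝ} (hT : 0 ≤ T) (t : ℝ) : 0 ≤ ce T t := by
  have hd : 0 ≤ min |t| |t - T| := le_min (abs_nonneg _) (abs_nonneg _)
  have := DD_nonneg
  unfold ce; positivity

lemma cmp {T : ℝ} (hT : 0 ≤ T) (Y t : ℝ) :
    ‖W (kT T) Y t - kT T t * W S1 Y t‖ ≤ ce T t := by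
  have hd : 0 ≤ min |t| |t - T| := le_min (abs_nonneg _) (abs_nonneg _)
  have hD := DD_nonneg
  rw [W_sub_smul _ (kT_summable T Y t) (S_summable Y t)]
  have hb := W_bound (k := fun s => kT T s - kT T t * S1 s) (Y := Y) (t := t)
    (K := (1 + min |t| |t - T|) ^ (-(3/4):ℝ)) (by positivity) (fun ρ => kT_diff T t _)
  refine hb.trans ?_
  have hl : Real.log (|t| + 2) ≤ ((T + 2) * (1 + min |t| |t - T|)) ^ (1/8:ℝ) / (1/8) := by
    refine (Real.log_le_log (by positivity) ?_).trans (Real.log_le_rpow_div (by positivity) (by norm_num))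
    rcases min_choice |t| |t - T| with h | h
    · rw [h]; nlinarith [abs_nonneg t]
    · rw [h]
      have : |t| ≤ |t - T| + T := by
        have := abs_add_le (t - T) T
        rwa [sub_add_cancel, abs_of_nonneg hT] at this
      nlinarith [abs_nonneg (t - T)]
  have e : (1 + min |t| |t - T|) ^ (-(5/8):ℝ) = (1 + min |t| |t - T|) ^ (-(3/4):ℝ) * (1 + min |t| |t - T|) ^ (1/8:ℝ) := by
    rw [← Real.rpow_add (by positivity)]; norm_num
  unfold ce
  rw [e]
  calc _ ≤ 2 * (1 + min |t| |t - T|) ^ (-(3/4):ℝ) * (DD * (((T + 2) * (1 + min |t| |t - T|)) ^ (1/8:ℝ) / (1/8))) := by gcongr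
    _ = _ := by rw [Real.mul_rpow (by positivity) (by positivity)]; ring

lemma jc_integrable : Integrable (fun t : ℝ => (1 + |t|) ^ (-(5/4):ℝ)) := by
  have hi := integrable_one_add_norm (E := ℝ) (μ := volume) (r := 5/4) (by simp; norm_num)
  simpa using hi

/-- absolute constant -/
def CC : ℝ := 512 * DD^2 * ∫ t : ℝ, (1 + |t|) ^ (-(5/4):ℝ)

lemma ce_sq_le {T : ℝ} (hT : 0 ≤ T) (t : ℝ) :
    ce T t ^ 2 ≤ 256 * DD^2 * (T+2) ^ (1/4:ℝ) * ((1 + |t|) ^ (-(5/4):ℝ) + (1 + |t - T|) ^ (-(5/4):ℝ)) := by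
  have hd : 0 ≤ min |t| |t - T| := le_min (abs_nonneg _) (abs_nonneg _)
  have e1 : ((T+2) ^ (1/8:ℝ))^2 = (T+2) ^ (1/4:ℝ) := by
    rw [← Real.rpow_natCast, ← Real.rpow_mul (by positivity)]; norm_num
  have e2 : ((1 + min |t| |t - T|) ^ (-(5/8):ℝ))^2 = (1 + min |t| |t - T|) ^ (-(5/4):ℝ) := by
    rw [← Real.rpow_natCast, ← Real.rpow_mul (by positivity)]; norm_num
  unfold ce
  rw [mul_pow, mul_pow, mul_pow, e1, e2]
  have p1 : 0 ≤ (1 + |t|) ^ (-(5/4):ℝ) := by positivity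
  have p2 : 0 ≤ (1 + |t - T|) ^ (-(5/4):ℝ) := by positivity
  have : (1 + min |t| |t - T|) ^ (-(5/4):ℝ) ≤ (1 + |t|) ^ (-(5/4):ℝ) + (1 + |t - T|) ^ (-(5/4):ℝ) := by
    rcases min_choice |t| |t - T| with h | h <;> rw [h] <;> linarith
  calc _ = 256 * DD^2 * (T+2) ^ (1/4:ℝ) * (1 + min |t| |t - T|) ^ (-(5/4):ℝ) := by ring
    _ ≤ _ := by gcongr

lemma ce_dom_int (T : ℝ) : Integrable (fun t : ℝ => 256 * DD^2 * (T+2) ^ (1/4:ℝ) * ((1 + |t|) ^ (-(5/4):ℝ) + (1 + |t - T|) ^ (-(5/4):ℝ))) :=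
  (jc_integrable.add (jc_integrable.comp_sub_right T)).const_mul _

lemma ce_meas (T : ℝ) : Measurable (ce T) := by unfold ce; fun_prop

lemma ce_int {T : ℝ} (hT : 0 ≤ T) : Integrable (fun t => ce T t ^ 2) := by
  refine (ce_dom_int T).mono' ((ce_meas T).pow_const 2).aestronglyMeasurable (Eventually.of_forall fun t => ?_)
  rw [Real.norm_of_nonneg (by positivity)]
  exact ce_sq_le hT t

lemma ce_integral {T : ℝ} (hT : 0 ≤ T) : ∫ t, ce T t ^ 2 ≤ CC * (T+2) ^ (1/4:ℝ) := by
  refine (integral_mono (ce_int hT) (ce_dom_int T) (ce_sq_le hT)).trans (le_of_eq ?_)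
  have h : ∫ t : ℝ, ((1 + |t|) ^ (-(5/4):ℝ) + (1 + |t - T|) ^ (-(5/4):ℝ)) =
     (∫ t : ℝ, (1 + |t|) ^ (-(5/4):ℝ)) + ∫ t : ℝ, (1 + |t - T|) ^ (-(5/4):ℝ) :=
    integral_add jc_integrable (jc_integrable.comp_sub_right T)
  rw [integral_const_mul, h, integral_sub_right_eq_self (fun t : ℝ => (1 + |t|) ^ (-(5/4):ℝ)) T]
  unfold CC; ring

/-- the smoothed square sum -/
def Fsq (X T : ℝ) : ℝ := 2 / π * ∫ t, ‖W (kT T) (Real.log X) t‖^2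

lemma kT_meas (T : ℝ) : Measurable (kT T) := by
  unfold kT
  exact Measurable.ite (measurableSet_Ioc (a := (0:ℝ)) (b := T)) measurable_const measurable_const

lemma b_eq (X T : ℝ) : (fun t => ‖kT T t * W S1 (Real.log X) t‖^2) =
    (Ioc (0:ℝ) T).indicator (fun t => ‖W S1 (Real.log X) t‖^2) := by
  funext t
  unfold kT indicator
  simp only [mem_Ioc]
  split_ifs <;> simp

lemma main_part {T : ℝ} (hT : 1 < T) (X : ℝ) :
    Integrable (fun t => ‖kT T t * W S1 (Real.log X) t‖^2) ∧
    2 / π * ∫ t, ‖kT T t * W S1 (Real.log X) t‖^2 = T * Real.log T * ∫ u in (0:ℝ)..1, fd T X u := by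
  have hl := Real.log_pos hT
  have hT0 : 0 < T := by linarith
  have hW : ∀ u, ‖W S1 (Real.log X) u‖^2 = (π / 2 * Real.log T) * fd T X (u / T) := by
    intro u; unfold fd; rw [div_mul_cancel₀ _ hT0.ne']
    field_simp
  rw [b_eq]
  constructor
  · rw [integrable_indicator_iff measurableSet_Ioc]
    rw [← intervalIntegrable_iff_integrableOn_Ioc_of_le hT0.le]
    have h := ((fd_ii hT X 0 1).comp_mul_right (c := T⁻¹)).const_mul (π / 2 * Real.log T)
    have h2 : IntervalIntegrable (fun u => (π / 2 * Real.log T) * fd T X (u / T)) volume 0 T := by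
      simpa [div_eq_mul_inv] using h
    refine h2.congr ?_
    intro u _
    exact (hW u).symm
  · rw [integral_indicator measurableSet_Ioc, ← intervalIntegral.integral_of_le hT0.le]
    simp_rw [hW]
    rw [intervalIntegral.integral_const_mul, intervalIntegral.integral_comp_div _ hT0.ne', zero_div, div_self hT0.ne', smul_eq_mul]
    field_simp

lemma Fsq_near {T : ℝ} (hT : 1 < T) (X : ℝ) {η : ℝ} (hη : 0 < η) :
    |Fsq X T - T * Real.log T * ∫ u in (0:ℝ)..1, fd T X u| ≤
      η * (T * Real.log T * ∫ u in (0:ℝ)..1, fd T X u) + (1 + 1/η) * (CC * (T+2) ^ (1/4:ℝ)) := by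
  have hT0 : 0 ≤ T := by linarith
  obtain ⟨hb, he⟩ := main_part hT X
  have hpt : ∀ t, |‖kT T t * W S1 (Real.log X) t‖^2 - ‖W (kT T) (Real.log X) t‖^2| ≤
      η * ‖kT T t * W S1 (Real.log X) t‖^2 + (1 + 1/η) * ce T t ^ 2 := by
    intro t
    refine sq_compare hη (norm_nonneg _) ?_
    rw [abs_sub_comm]
    exact (abs_norm_sub_norm_le _ _).trans (cmp hT0 _ _)
  have hdom : Integrable (fun t => η * ‖kT T t * W S1 (Real.log X) t‖^2 + (1 + 1/η) * ce T t ^ 2) :=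
    (hb.const_mul η).add ((ce_int hT0).const_mul _)
  have hdiff : Integrable (fun t => ‖kT T t * W S1 (Real.log X) t‖^2 - ‖W (kT T) (Real.log X) t‖^2) := by
    refine hdom.mono' ?_ (Eventually.of_forall fun t => by rw [Real.norm_eq_abs]; exact hpt t)
    exact (hb.aestronglyMeasurable.sub ((W_measurable _ _).norm.pow_const 2).aestronglyMeasurable)
  have ha : Integrable (fun t => ‖W (kT T) (Real.log X) t‖^2) := by
    have := hb.sub hdiff
    refine this.congr (Eventually.of_forall fun t => ?_)
    simp
  rw [← he]
  unfold Fsq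
  rw [abs_sub_comm, ← mul_sub, ← integral_sub hb ha, abs_mul, abs_of_pos (by positivity : 0 < 2/π)]
  have h1 : |∫ t, (‖kT T t * W S1 (Real.log X) t‖^2 - ‖W (kT T) (Real.log X) t‖^2)| ≤
      η * (∫ t, ‖kT T t * W S1 (Real.log X) t‖^2) + (1 + 1/η) * ∫ t, ce T t ^ 2 := by
    rw [← integral_const_mul, ← integral_const_mul, ← integral_add (hb.const_mul η) ((ce_int hT0).const_mul _)]
    rw [← Real.norm_eq_abs]
    exact norm_integral_le_of_norm_le hdom (Eventually.of_forall fun t => by rw [Real.norm_eq_abs]; exact hpt t)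
  have h2 := ce_integral hT0
  have h3 : 0 ≤ ∫ t, ce T t ^ 2 := integral_nonneg fun t => by positivity
  have h4 : 2/π * ∫ t, ce T t ^ 2 ≤ CC * (T+2) ^ (1/4:ℝ) := by
    have := two_div_pi_le
    nlinarith
  calc _ ≤ 2/π * (η * (∫ t, ‖kT T t * W S1 (Real.log X) t‖^2) + (1 + 1/η) * ∫ t, ce T t ^ 2) := by gcongr
    _ = η * (2/π * ∫ t, ‖kT T t * W S1 (Real.log X) t‖^2) + (1 + 1/η) * (2/π * ∫ t, ce T t ^ 2) := by ring
    _ ≤ _ := by gcongr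

end
end GM

open Complex Filter MeasureTheory Real Set
open scoped Topology ComplexConjugate
namespace GM
noncomputable section

lemma zut_xf {T : ℝ} (c : zerosUpTo T) : xf (c:ℂ) = 0 := by
  obtain ⟨⟨h1, h2, h3⟩, -, -⟩ := c.2
  refine xf_zero_iff.mpr ⟨?_, h1⟩
  intro h; rw [h] at h3; simp at h3

/-- inclusion of the zeros up to height `T` -/
def emb {T : ℝ} (c : zerosUpTo T) : Zt := ⟨c, zut_xf c⟩

lemma emb_inj {T : ℝ} : Function.Injective (emb (T := T)) := by
  intro a b h
  have := congrArg (Subtype.val) h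
  exact Subtype.ext this

lemma zut_finite (T : ℝ) : Finite (zerosUpTo T) := by
  have hf := finite_near (2 + |T|)
  have : Finite {ρ : Zt | ‖(ρ:ℂ) - 2‖ ≤ 2 + |T|} := hf
  refine Finite.of_injective (β := {ρ : Zt | ‖(ρ:ℂ) - 2‖ ≤ 2 + |T|}) (fun c => ⟨emb c, ?_⟩) ?_
  · obtain ⟨⟨h1, h2, h3⟩, h4, h5⟩ := c.2
    simp only [mem_ofPred_eq]
    change ‖(c:ℂ) - 2‖ ≤ 2 + |T|
    refine (Complex.norm_le_abs_re_add_abs_im _).trans ?_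
    have e1 : ((c:ℂ) - 2).re = (c:ℂ).re - 2 := by simp
    have e2 : ((c:ℂ) - 2).im = (c:ℂ).im := by simp
    rw [e1, e2, abs_of_nonpos (by linarith), abs_of_pos h4]
    have := le_abs_self T
    linarith
  · intro a b h
    simp only [Subtype.mk.injEq] at h
    exact emb_inj h

lemma mm_emb (hRH : RiemannHypothesis) {T : ℝ} (c : zerosUpTo T) : mm (emb c) = zetaMult (c:ℂ) := by
  obtain ⟨⟨h1, h2, h3⟩, h4, h5⟩ := c.2
  have hne : (c:ℂ) ≠ 1 := by intro h; rw [h] at h3; simp at h3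
  have hre : (c:ℂ).re = 1/2 := by
    rcases xf_zero_RH hRH (zut_xf c) with ⟨n, hn⟩ | h
    · exfalso
      rw [hn] at h2
      have : ((-2 * ((n:ℂ) + 1))).re = -2 * ((n:ℝ) + 1) := by simp
      rw [this] at h2
      have : (0:ℝ) ≤ n := n.cast_nonneg
      linarith
    · exact h
  unfold mm emb
  rw [if_pos hre, zetaMult_eq hne]

/-- coefficients -/
def co (X : ℝ) {T : ℝ} (i : zerosUpTo T) : ℂ := (zetaMult (i:ℂ) : ℂ) * cexp (I * ((i:ℂ).im : ℝ) * (Real.log X : ℝ))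

lemma W_kT (hRH : RiemannHypothesis) (X T t : ℝ) :
    W (kT T) (Real.log X) t = ∑' i : zerosUpTo T, co X i / ((1 + (t - (i:ℂ).im)^2 : ℝ) : ℂ) := by
  unfold W
  rw [← (emb_inj (T := T)).tsum_eq (f := Wt (kT T) (Real.log X) t)]
  · refine tsum_congr fun i => ?_
    unfold Wt co
    rw [mm_emb hRH]
    have h : kT T (gg (emb i)) = 1 := by
      unfold kT; rw [if_pos]; exact i.2.2
    rw [h, mul_one, Complex.ofReal_natCast]
    rfl
  · intro ρ hρ
    rw [Function.mem_support] at hρ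
    have h1 : mm ρ ≠ 0 := by
      intro h; apply hρ; unfold Wt; rw [h]; simp
    have h2 : kT T (gg ρ) ≠ 0 := by
      intro h; apply hρ; unfold Wt; rw [h]; simp
    have h3 : (ρ:ℂ).re = 1/2 := by
      by_contra h; apply h1; unfold mm; rw [if_neg h]
    have h4 : 0 < gg ρ ∧ gg ρ ≤ T := by
      by_contra h; apply h2; unfold kT; rw [if_neg h]
    refine ⟨⟨ρ, ⟨(xf_zero_iff.mp ρ.2).2, ?_, ?_⟩, h4⟩, rfl⟩ <;> rw [h3] <;> norm_num

lemma Fxt_eq (hRH : RiemannHypothesis) (X T : ℝ) : Fxt X T = ((Fsq X T : ℝ) : ℂ) := by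
  have := zut_finite T
  have : Fintype (zerosUpTo T) := Fintype.ofFinite _
  unfold Fsq
  simp_rw [W_kT hRH]
  rw [← parseval (fun i : zerosUpTo T => co X i) (fun i => (i:ℂ).im) (Summable.of_finite), ← integral_complex_ofReal]
  have hpt : ∀ y : ℝ, ((rexp (-(2 * |y|)) * ‖∑' i : zerosUpTo T, co X i * cexp (I * ((i:ℂ).im:ℝ) * y)‖ ^ 2 : ℝ) : ℂ) =
      ∑ i : zerosUpTo T, ∑ j : zerosUpTo T, (co X i * conj (co X j)) *
        ((rexp (-(2 * |y|)) : ℂ) * cexp (I * (((i:ℂ).im - (j:ℂ).im : ℝ) : ℂ) * y)) := by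
    intro y
    rw [tsum_fintype, Complex.ofReal_mul, Complex.ofReal_pow, ← Complex.mul_conj', map_sum, Finset.sum_mul_sum, Finset.mul_sum]
    refine Finset.sum_congr rfl fun i _ => ?_
    rw [Finset.mul_sum]
    refine Finset.sum_congr rfl fun j _ => ?_
    rw [map_mul, ← Complex.exp_conj]
    have e : cexp (I * (((i:ℂ).im - (j:ℂ).im : ℝ) : ℂ) * y) = cexp (I * ((i:ℂ).im:ℝ) * y) * cexp (conj (I * (((j:ℂ).im:ℝ):ℂ) * (y:ℂ))) := by
      rw [← Complex.exp_add]
      congr 1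
      simp only [map_mul, Complex.conj_I, Complex.conj_ofReal]
      push_cast; ring
    rw [e]; ring
  simp_rw [hpt]
  have hitg : ∀ i j : zerosUpTo T, Integrable (fun y : ℝ => (co X i * conj (co X j)) *
        ((rexp (-(2 * |y|)) : ℂ) * cexp (I * (((i:ℂ).im - (j:ℂ).im : ℝ) : ℂ) * y))) := by
    intro i j
    refine Integrable.const_mul ?_ _
    refine (exp_abs_integrable (a := 2) (by norm_num)).mono' (by fun_prop) (Eventually.of_forall fun y => ?_)
    rw [norm_mul, norm_cexp_I, mul_one, Complex.norm_real, Real.norm_of_nonneg (Real.exp_pos _).le]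
  rw [integral_finsetSum _ (fun i _ => integrable_finsetSum _ (fun j _ => hitg i j))]
  unfold Fxt
  rw [tsum_fintype, Fintype.sum_prod_type]
  refine Finset.sum_congr rfl fun i _ => ?_
  rw [integral_finsetSum _ (fun j _ => hitg i j)]
  refine Finset.sum_congr rfl fun j _ => ?_
  rw [integral_const_mul, ft_exp_abs (by norm_num : (0:ℝ) < 2)]
  have e : cexp (I * (((i:ℂ).im - (j:ℂ).im : ℝ) : ℂ) * (Real.log X : ℂ)) =
      cexp (I * ((i:ℂ).im:ℝ) * (Real.log X : ℝ)) * cexp (conj (I * (((j:ℂ).im:ℝ):ℂ) * ((Real.log X : ℝ):ℂ))) := by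
    rw [← Complex.exp_add]
    congr 1
    simp only [map_mul, Complex.conj_I, Complex.conj_ofReal]
    push_cast; ring
  unfold co
  rw [map_mul, ← Complex.exp_conj, Complex.conj_natCast, e,
    show (2 * 2 / (2^2 + ((i:ℂ).im - (j:ℂ).im)^2) : ℝ) = 4 / (4 + ((i:ℂ).im - (j:ℂ).im)^2) by norm_num]
  ring

lemma final (hRH : RiemannHypothesis) {A₁ A₂ : ℝ} (hA₁ : 1 ≤ A₁) (hA₁₂ : A₁ ≤ A₂) (hI : HypI A₁ A₂) :
    ∀ ε : ℝ, 0 < ε → ∃ T₀ : ℝ, ∀ T : ℝ, T₀ ≤ T → ∀ X : ℝ,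
      T ^ A₁ ≤ X → X ≤ T ^ A₂ →
        ‖Fxt X T - ((T / (2 * π) * Real.log T : ℝ) : ℂ)‖
          ≤ ε * (T / (2 * π) * Real.log T) := by
  intro ε hε
  by_contra! hcon
  choose T hT1 X hX1 hX2 hbad using fun n : ℕ => hcon (n + 3)
  have hT3 : ∀ n, 3 ≤ T n := fun n => by
    have := hT1 n
    have : (0:ℝ) ≤ n := n.cast_nonneg
    linarith
  have hTt : Tendsto T atTop atTop := by
    refine tendsto_atTop_mono (f := fun n : ℕ => (n:ℝ)) (fun n => by linarith [hT1 n]) tendsto_natCast_atTop_atTop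
  have hm := mean_seq hRH hA₁ hA₁₂ hI (fun n => by linarith [hT3 n]) hTt hX1 hX2
  have hpi := Real.pi_pos
  -- error term tends to zero
  obtain ⟨η, hη0, hη⟩ : ∃ η : ℝ, 0 < η ∧ η * (2 * (1 / (2*π))) = ε / 4 * (1 / (2*π)) :=
    ⟨ε / 8, by positivity, by ring⟩
  have herr : Tendsto (fun n => (1 + 1/η) * (CC * (T n + 2) ^ (1/4:ℝ)) / (T n)) atTop (𝓝 0) := by
    have h0 : Tendsto (fun n => (1 + 1/η) * |CC| * 2 * (T n) ^ (-(3/4):ℝ)) atTop (𝓝 0) := by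
      have := ((tendsto_rpow_neg_atTop (by norm_num : (0:ℝ) < 3/4)).comp hTt).const_mul ((1 + 1/η) * |CC| * 2)
      simpa using this
    refine squeeze_zero_norm (fun n => ?_) h0
    have h3 := hT3 n
    have p : 0 < T n := by linarith
    have h1 : (T n + 2) ^ (1/4:ℝ) ≤ 2 * (T n) ^ (1/4:ℝ) := by
      calc (T n + 2) ^ (1/4:ℝ) ≤ (16 * T n) ^ (1/4:ℝ) := by gcongr; linarith
        _ = _ := by
          rw [Real.mul_rpow (by norm_num) p.le, show (16:ℝ) = 2 ^ (4:ℝ) by norm_num, ← Real.rpow_mul (by norm_num)]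
          norm_num
    have h2 : (T n) ^ (-(3/4):ℝ) = (T n) ^ (1/4:ℝ) / T n := by
      rw [← Real.rpow_sub_one p.ne']; norm_num
    rw [h2, norm_div, norm_mul, norm_mul, Real.norm_of_nonneg (by positivity : 0 ≤ 1 + 1/η), Real.norm_of_nonneg p.le,
      Real.norm_of_nonneg (by positivity : 0 ≤ (T n + 2) ^ (1/4:ℝ)), Real.norm_eq_abs]
    calc _ ≤ (1 + 1/η) * (|CC| * (2 * (T n) ^ (1/4:ℝ))) / T n := by gcongr
      _ = _ := by ring
  have ev1 := hm.eventually_lt_const (show 1/(2*π) < 2 * (1/(2*π)) by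
    have : 0 < 1/(2*π) := by positivity
    linarith)
  have ev2 := (Metric.tendsto_nhds.mp hm) (ε / 4 * (1/(2*π))) (by positivity)
  have ev3 := herr.eventually_lt_const (show 0 < ε / 4 * (1/(2*π)) by positivity)
  obtain ⟨n, h1, h2, h3⟩ := (ev1.and (ev2.and ev3)).exists
  have hT := hT3 n
  have p : 0 < T n := by linarith
  have hl : 1 ≤ Real.log (T n) := by
    rw [Real.le_log_iff_exp_le p]
    linarith [Real.exp_one_lt_d9]
  have hF := Fsq_near (T := T n) (by linarith) (X n) hη0
  refine absurd (hbad n) (not_lt.mpr ?_)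
  rw [Fxt_eq hRH, ← Complex.ofReal_sub, Complex.norm_real, Real.norm_eq_abs]
  set m := ∫ u in (0:ℝ)..1, fd (T n) (X n) u
  set E := (1 + 1/η) * (CC * (T n + 2) ^ (1/4:ℝ))
  rw [Real.dist_eq] at h2
  have hTl : 0 < T n * Real.log (T n) := by positivity
  have hE : E ≤ T n * Real.log (T n) * (ε / 4 * (1/(2*π))) := by
    rw [div_lt_iff₀ p] at h3
    have : 0 ≤ ε / 4 * (1/(2*π)) * T n := by positivity
    nlinarith
  have e1 : T n / (2*π) * Real.log (T n) = T n * Real.log (T n) * (1/(2*π)) := by ring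
  rw [e1]
  calc _ ≤ |Fsq (X n) (T n) - T n * Real.log (T n) * m| + |T n * Real.log (T n) * m - T n * Real.log (T n) * (1/(2*π))| := abs_sub_le _ _ _
    _ ≤ (η * (T n * Real.log (T n) * m) + E) + T n * Real.log (T n) * |m - 1/(2*π)| := by
        rw [← mul_sub, abs_mul, abs_of_pos hTl]; gcongr
    _ ≤ (η * (T n * Real.log (T n) * (2 * (1/(2*π)))) + T n * Real.log (T n) * (ε / 4 * (1/(2*π)))) + T n * Real.log (T n) * (ε / 4 * (1/(2*π))) := by
        gcongr
    _ = T n * Real.log (T n) * (ε * (3/4) * (1/(2*π))) := by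
        rw [show η * (T n * Real.log (T n) * (2 * (1/(2*π)))) = T n * Real.log (T n) * (η * (2 * (1/(2*π)))) by ring, hη]; ring
    _ ≤ _ := by
        have : 0 ≤ T n * Real.log (T n) * (1/(2*π)) := by positivity
        nlinarith

end
end GM

/-- Goldston–Montgomery (converse direction): assume RH and `1 ≤ A₁ ≤ A₂ < ∞`.  If
`I(X,δ) ~ ½ δ X² log(1/δ)` uniformly for `X^{-1/A₁}(log X)⁻³ ≤ δ ≤ X^{-1/A₂}(log X)³`,
then `F(X,T) ~ (T/2π) log T` uniformly for `T^{A₁} ≤ X ≤ T^{A₂}`. -/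
theorem second_moment_implies_SPC (hRH : RiemannHypothesis)
    (A₁ A₂ : ℝ) (hA₁ : 1 ≤ A₁) (hA₁₂ : A₁ ≤ A₂)
    (hI : ∀ ε : ℝ, 0 < ε → ∃ X₀ : ℝ, ∀ X : ℝ, X₀ ≤ X → ∀ δ : ℝ,
      X ^ (-(1 / A₁)) * (Real.log X)⁻¹ ^ 3 ≤ δ → δ ≤ X ^ (-(1 / A₂)) * (Real.log X) ^ 3 →
        |Imoment X δ - 1 / 2 * δ * X ^ 2 * Real.log (1 / δ)|
          ≤ ε * (1 / 2 * δ * X ^ 2 * Real.log (1 / δ))) :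
    ∀ ε : ℝ, 0 < ε → ∃ T₀ : ℝ, ∀ T : ℝ, T₀ ≤ T → ∀ X : ℝ,
      T ^ A₁ ≤ X → X ≤ T ^ A₂ →
        ‖Fxt X T - ((T / (2 * π) * Real.log T : ℝ) : ℂ)‖
          ≤ ε * (T / (2 * π) * Real.log T) := by
  exact GM.final hRH hA₁ hA₁₂ hI
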